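/- Let b > 0 and let S_b be a random variable with law (4/b)·(√(bx−1)/(2πx²))·1_{(1/b,∞)}(x)dx (which is a probability measure). Then for every real r with |r| ≥ 1, the law of S_b^r (the pushforward under x ↦ x^r) belongs to the class UI. -/

import Mathlib

open MeasureTheory Set

/-- The Cauchy transform of a measure on `ℝ`, `G_μ(z) = ∫ (z-x)⁻¹ dμ(x)`. -/
noncomputable def cauchyTransform (μ : Measure ℝ) (z : ℂ) : ℂ :=
  ∫ x : ℝ, (z - (x : ℂ))⁻¹ ∂μ

/-- The class UI: the right inverse of the Cauchy transform, defined on some triangular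
domain `Λ_{γ,δ} = {w ∈ ℂ⁻ : γ|Re w| < -Im w, Im w > -δ}`, has a univalent (injective)
analytic continuation `F` to the whole lower half-plane. -/
def IsUI (μ : Measure ℝ) : Prop :=
  ∃ F : ℂ → ℂ,
    AnalyticOnNhd ℂ F {z : ℂ | z.im < 0} ∧
    Set.InjOn F {z : ℂ | z.im < 0} ∧
    ∃ γ : ℝ, 0 < γ ∧ ∃ δ : ℝ, 0 < δ ∧
      ∀ w : ℂ, γ * |w.re| < -w.im → -δ < w.im →
        0 < (F w).im ∧ cauchyTransform μ (F w) = w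

/-- The measure `(4/b)·(√(bx-1)/(2πx²))·1_{(1/b,∞)}(x)dx` for `b > 0`. -/
noncomputable def sbMeasure (b : ℝ) : Measure ℝ :=
  MeasureTheory.volume.withDensity
    (fun x => ENNReal.ofReal
      ((Set.Ioi (1 / b)).indicator
        (fun x => 4 / b * (Real.sqrt (b * x - 1) / (2 * Real.pi * x ^ 2))) x))

open Filter Topology

theorem eventually_exists_pair_of_deriv_eq_zero {g : ℂ → ℂ} {z₀ : ℂ} (hg : AnalyticAt ℂ g z₀)
    (hnc : ¬ ∀ᶠ z in 𝓝 z₀, g z = g z₀) (hd : deriv g z₀ = 0) {U : Set ℂ} (hU : U ∈ 𝓝 z₀) :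
    ∀ᶠ w in 𝓝[≠] (g z₀), ∃ z₁ ∈ U, ∃ z₂ ∈ U, z₁ ≠ z₂ ∧ g z₁ = w ∧ g z₂ = w := by
  have hG : AnalyticAt ℂ (fun z => g z - g z₀) z₀ := by fun_prop
  have htop : analyticOrderAt (fun z => g z - g z₀) z₀ ≠ ⊤ := by
    rw [Ne, analyticOrderAt_eq_top]
    simpa [sub_eq_zero] using hnc
  obtain ⟨n, hn⟩ := ENat.ne_top_iff_exists.1 htop
  obtain ⟨h, hh, hh0, hev⟩ := (hG.analyticOrderAt_eq_natCast).1 hn.symm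
  simp only [smul_eq_mul] at hev
  have hn2 : 2 ≤ n := by
    by_contra hlt
    interval_cases n
    · have := hev.self_of_nhds
      simp at this
      exact hh0 this.symm
    · have h1 : HasDerivAt (fun z => (z - z₀) ^ 1 * h z) (h z₀) z₀ := by
        have h2 := ((hasDerivAt_id' z₀).sub_const z₀).fun_mul hh.differentiableAt.hasDerivAt
        simpa using h2
      have h3 : HasDerivAt (fun z => g z - g z₀) (deriv g z₀) z₀ :=
        hg.differentiableAt.hasDerivAt.sub_const _
      have := (h1.congr_of_eventuallyEq hev).unique h3
      exact hh0 (this.trans hd)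
  have hn0 : n ≠ 0 := by omega
  have hnC : (n : ℂ) ≠ 0 := by exact_mod_cast hn0
  obtain ⟨a, ha⟩ := IsAlgClosed.exists_pow_nat_eq (h z₀) (Nat.pos_of_ne_zero hn0)
  have ha0 : a ≠ 0 := by rintro rfl; rw [zero_pow hn0] at ha; exact hh0 ha.symm
  set φ : ℂ → ℂ := fun z => (z - z₀) * (a * Complex.exp (Complex.log (h z / h z₀) / n)) with hφ
  have hk : AnalyticAt ℂ (fun z => a * Complex.exp (Complex.log (h z / h z₀) / n)) z₀ := by
    have h1 : AnalyticAt ℂ (fun z => h z / h z₀) z₀ := hh.div analyticAt_const hh0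
    have h2 : AnalyticAt ℂ (fun z => Complex.log (h z / h z₀)) z₀ := by
      refine h1.clog ?_
      simp [div_self hh0]
    exact analyticAt_const.mul ((h2.div analyticAt_const hnC).cexp)
  have hφa : AnalyticAt ℂ φ z₀ := (by fun_prop : AnalyticAt ℂ (fun z => z - z₀) z₀).mul hk
  have hφd : HasDerivAt φ a z₀ := by
    have h2 := ((hasDerivAt_id' z₀).sub_const z₀).fun_mul hk.differentiableAt.hasDerivAt
    simpa [div_self hh0, hφ] using h2
  have hφs : HasStrictDerivAt φ a z₀ := by
    have := hφa.hasStrictDerivAt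
    rwa [hφd.deriv] at this
  have hmap := hφs.map_nhds_eq ha0
  have hφ0 : φ z₀ = 0 := by simp [hφ]
  have hpow : ∀ᶠ z in 𝓝 z₀, φ z ^ n = g z - g z₀ := by
    have hne : ∀ᶠ z in 𝓝 z₀, h z ≠ 0 := hh.continuousAt.eventually_ne hh0
    filter_upwards [hev, hne] with z hz hz0
    rw [hz, hφ]
    simp only [mul_pow]
    rw [← Complex.exp_nat_mul, mul_div_cancel₀ _ hnC, Complex.exp_log (div_ne_zero hz0 hh0), ha]
    field_simp
  have hV : φ '' (U ∩ {z | φ z ^ n = g z - g z₀}) ∈ 𝓝 (0 : ℂ) := by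
    rw [← hφ0, ← hmap]
    exact image_mem_map (inter_mem hU hpow)
  obtain ⟨ε, hε, hball⟩ := Metric.mem_nhds_iff.1 hV
  have hprim := Complex.isPrimitiveRoot_exp n hn0
  set ω := Complex.exp (2 * Real.pi * Complex.I / n) with hω
  have hω1 : ω ≠ 1 := hprim.ne_one (by omega)
  have hωn : ω ^ n = 1 := hprim.pow_eq_one
  have hωnorm : ‖ω‖ = 1 := by
    exact Complex.norm_eq_one_of_pow_eq_one hωn hn0
  have hsmall : ∀ᶠ w in 𝓝[≠] (g z₀), ‖w - g z₀‖ < ε ^ n := by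
    have : Tendsto (fun w => ‖w - g z₀‖) (𝓝[≠] (g z₀)) (𝓝 0) := by
      have : Tendsto (fun w => ‖w - g z₀‖) (𝓝 (g z₀)) (𝓝 ‖g z₀ - g z₀‖) :=
        Continuous.tendsto (by fun_prop) _
      simp only [sub_self, norm_zero] at this
      exact this.mono_left nhdsWithin_le_nhds
    exact this.eventually_lt_const (by positivity)
  filter_upwards [hsmall, self_mem_nhdsWithin] with w hw hwne
  obtain ⟨u, hu⟩ := IsAlgClosed.exists_pow_nat_eq (w - g z₀) (Nat.pos_of_ne_zero hn0)
  have hu0 : u ≠ 0 := by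
    rintro rfl
    rw [zero_pow hn0] at hu
    exact hwne (sub_eq_zero.1 hu.symm)
  have hunorm : ‖u‖ < ε := by
    rw [← hu, norm_pow] at hw
    exact lt_of_pow_lt_pow_left₀ n hε.le hw
  obtain ⟨z₁, ⟨hz1U, hz1⟩, hz1u⟩ := hball (show u ∈ Metric.ball 0 ε by simpa using hunorm)
  obtain ⟨z₂, ⟨hz2U, hz2⟩, hz2u⟩ := hball (show u * ω ∈ Metric.ball 0 ε by
    simpa [hωnorm] using hunorm)
  refine ⟨z₁, hz1U, z₂, hz2U, ?_, ?_, ?_⟩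
  · rintro rfl
    rw [hz1u] at hz2u
    exact hω1 (mul_left_cancel₀ hu0 (by rw [← hz2u, mul_one]))
  · have : φ z₁ ^ n = g z₁ - g z₀ := hz1
    rw [hz1u, hu] at this
    exact (sub_left_injective this).symm
  · have : φ z₂ ^ n = g z₂ - g z₀ := hz2
    rw [hz2u, mul_pow, hωn, mul_one, hu] at this
    exact (sub_left_injective this).symm

section ProperMap

variable {D : Set ℂ} {g : ℂ → ℂ}

/-- `g` is proper over the lower half-plane, in terms of ultrafilters on its domain `D`. -/
def ProperOverLower (D : Set ℂ) (g : ℂ → ℂ) : Prop :=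
  ∀ 𝓤 : Ultrafilter ℂ, D ∈ 𝓤 → ∀ w : ℂ, w.im < 0 → Tendsto g 𝓤 (𝓝 w) → ∃ z ∈ D, ↑𝓤 ≤ 𝓝 z

theorem ProperOverLower.exists_tendsto (hp : ProperOverLower D g) (hg : ContinuousOn g D)
    (hD : IsOpen D) {w : ℂ} (hw : w.im < 0) {α : Type*} {𝓦 : Ultrafilter α} {W s : α → ℂ}
    (hW : Tendsto W 𝓦 (𝓝 w)) (hs : ∀ᶠ x in (𝓦 : Filter α), s x ∈ D ∧ g (s x) = W x) :
    ∃ z ∈ D, g z = w ∧ Tendsto s 𝓦 (𝓝 z) := by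
  have h1 : Tendsto g (𝓦.map s) (𝓝 w) := by
    rw [Ultrafilter.coe_map, tendsto_map'_iff]
    exact hW.congr' (hs.mono fun x hx => hx.2.symm)
  obtain ⟨z, hzD, hz⟩ := hp (𝓦.map s) (hs.mono fun x hx => hx.1) w hw h1
  refine ⟨z, hzD, ?_, hz⟩
  exact tendsto_nhds_unique ((hg.continuousAt (hD.mem_nhds hzD)).tendsto.mono_left hz) h1

theorem ProperOverLower.not_eventually_const (hp : ProperOverLower D g)
    (hg : DifferentiableOn ℂ g D) (hD : IsOpen D) {z : ℂ} (hz : z ∈ D) (hw : (g z).im < 0) :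
    ¬ ∀ᶠ x in 𝓝 z, g x = g z := by
  intro hev
  set C : Set ℂ := {x | x ∈ D ∧ ∀ᶠ y in 𝓝 x, g y = g z} with hC
  have hCcomp : IsCompact C := by
    rw [isCompact_iff_ultrafilter_le_nhds']
    intro 𝓤 hU
    have hUD : D ∈ 𝓤 := mem_of_superset hU fun x hx => hx.1
    have ht : Tendsto g 𝓤 (𝓝 (g z)) :=
      tendsto_nhds_of_eventually_eq (mem_of_superset hU fun x hx => hx.2.self_of_nhds)
    obtain ⟨x, hxD, hx⟩ := hp 𝓤 hUD _ hw ht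
    refine ⟨x, ⟨hxD, ?_⟩, hx⟩
    have hfr : ∃ᶠ y in 𝓝 x, ∀ᶠ t in 𝓝 y, g t = g z :=
      ((show ∀ᶠ y in (𝓤 : Filter ℂ), ∀ᶠ t in 𝓝 y, g t = g z from
        mem_of_superset hU fun x hx => hx.2).frequently).filter_mono hx
    have hga : AnalyticAt ℂ g x := hg.analyticAt (hD.mem_nhds hxD)
    refine (hga.frequently_eq_iff_eventually_eq analyticAt_const).1 ?_
    rw [frequently_iff] at hfr ⊢
    intro V hV
    obtain ⟨O, hO, hOo, hxO⟩ := mem_nhds_iff.1 (mem_nhdsWithin_iff_exists_mem_nhds_inter.1 hV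
      |>.choose_spec.1)
    obtain ⟨y, hyO, hy⟩ := hfr (hOo.mem_nhds hxO)
    have h1 : ∀ᶠ t in 𝓝 y, g t = g z ∧ t ∈ O := hy.and (hOo.mem_nhds hyO)
    have h2 : ∃ t, (g t = g z ∧ t ∈ O) ∧ t ≠ x := by
      have h3 : ∀ᶠ t in 𝓝[≠] y, (g t = g z ∧ t ∈ O) := h1.filter_mono nhdsWithin_le_nhds
      have h4 : ∀ᶠ t in 𝓝[≠] y, t ≠ x := by
        by_cases hyx : y = x
        · subst hyx; exact self_mem_nhdsWithin
        · exact (eventually_ne_nhds hyx).filter_mono nhdsWithin_le_nhds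
      exact (h3.and h4).exists
    obtain ⟨t, ⟨ht1, ht2⟩, ht3⟩ := h2
    exact ⟨t, (mem_nhdsWithin_iff_exists_mem_nhds_inter.1 hV).choose_spec.2 ⟨hO ht2, ht3⟩, ht1⟩
  have hCopen : IsOpen C := by
    have : C = D ∩ {x | ∀ᶠ y in 𝓝 x, g y = g z} := rfl
    rw [this]
    exact hD.inter isOpen_setOfPred_eventually_nhds
  rcases isClopen_iff.1 ⟨hCcomp.isClosed, hCopen⟩ with h | h
  · exact (h ▸ (⟨hz, hev⟩ : z ∈ C) : z ∈ (∅ : Set ℂ))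
  · exact noncompact_univ ℂ (h ▸ hCcomp)

/-- A holomorphic map which is proper over the lower half-plane, attains some value there, and
attains some value there at most once and without branching, has a holomorphic inverse on the
lower half-plane. -/
theorem ProperOverLower.exists_inverse (hp : ProperOverLower D g)
    (hg : DifferentiableOn ℂ g D) (hD : IsOpen D) (hex : ∃ z ∈ D, (g z).im < 0)
    (hb : ∃ w₀ : ℂ, w₀.im < 0 ∧ (∀ z ∈ D, ∀ z' ∈ D, g z = w₀ → g z' = w₀ → z = z') ∧
      ∀ z ∈ D, g z = w₀ → deriv g z ≠ 0) :
    ∃ Λ : ℂ → ℂ, DifferentiableOn ℂ Λ {w | w.im < 0} ∧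
      ∀ w : ℂ, w.im < 0 → Λ w ∈ D ∧ g (Λ w) = w ∧ ∀ z ∈ D, g z = w → z = Λ w := by
  have hLo : IsOpen {w : ℂ | w.im < 0} := isOpen_lt Complex.continuous_im continuous_const
  have hLc : IsPreconnected {w : ℂ | w.im < 0} := (convex_halfSpace_im_lt 0).isPreconnected
  have hcont := hg.continuousOn
  have hop : ∀ z ∈ D, (g z).im < 0 → 𝓝 (g z) ≤ map g (𝓝 z) := fun z hz hw =>
    ((hg.analyticAt (hD.mem_nhds hz)).eventually_constant_or_nhds_le_map_nhds).resolve_left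
      (hp.not_eventually_const hg hD hz hw)
  have hopV : ∀ z ∈ D, (g z).im < 0 → ∀ V ∈ 𝓝 z, ∀ᶠ w in 𝓝 (g z), ∃ x ∈ V, g x = w := by
    intro z hz hw V hV
    exact hop z hz hw (image_mem_map hV)
  -- surjectivity
  have hsurj : {w : ℂ | w.im < 0} ⊆ {w | w.im < 0 ∧ ∃ z ∈ D, g z = w} := by
    refine hLc.subset_of_closure_inter_subset ?_ ?_ ?_
    · rw [isOpen_iff_mem_nhds]
      rintro w ⟨hw, z, hz, rfl⟩
      filter_upwards [hopV z hz hw D (hD.mem_nhds hz), hLo.mem_nhds hw] with w' h1 h2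
      exact ⟨h2, h1⟩
    · obtain ⟨z, hz, hw⟩ := hex
      exact ⟨g z, hw, hw, z, hz, rfl⟩
    · rintro w ⟨hwc, hw⟩
      obtain ⟨𝓦, h1, h2⟩ := mem_closure_iff_ultrafilter.1 hwc
      have h3 : ∀ w' : ℂ, ∃ z, (w'.im < 0 ∧ ∃ z ∈ D, g z = w') → z ∈ D ∧ g z = w' := by
        intro w'
        by_cases h : (w'.im < 0 ∧ ∃ z ∈ D, g z = w')
        · obtain ⟨_, z, hz⟩ := h
          exact ⟨z, fun _ => hz⟩
        · exact ⟨0, fun h' => absurd h' h⟩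
      choose s hs using h3
      obtain ⟨z, hz, hgz, -⟩ := hp.exists_tendsto hcont hD hw (W := id) h2
        (mem_of_superset h1 fun w' hw' => hs w' hw')
      exact ⟨hw, z, hz, hgz⟩
  have hinv : ∀ w : ℂ, ∃ z, w.im < 0 → z ∈ D ∧ g z = w := by
    intro w
    by_cases h : w.im < 0
    · obtain ⟨-, z, hz⟩ := hsurj h
      exact ⟨z, fun _ => hz⟩
    · exact ⟨0, fun h' => absurd h' h⟩
  choose Λ hΛ using hinv
  set A : Set ℂ := {w | w.im < 0 ∧ (∀ z ∈ D, g z = w → z = Λ w) ∧ deriv g (Λ w) ≠ 0} with hA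
  have hAopen : IsOpen A := by
    rw [isOpen_iff_mem_nhds]
    rintro w ⟨hw, huniq, hd⟩
    by_contra hnot
    have hne : (𝓝 w ⊓ 𝓟 Aᶜ).NeBot := by
      rw [← frequently_mem_iff_neBot]
      exact fun h => hnot (mem_of_superset h fun x hx => not_not.1 hx)
    set 𝓦 := @Ultrafilter.of _ (𝓝 w ⊓ 𝓟 Aᶜ) hne with h𝓦
    have hle : (𝓦 : Filter ℂ) ≤ 𝓝 w ⊓ 𝓟 Aᶜ := @Ultrafilter.of_le _ _ hne
    have hle1 : (𝓦 : Filter ℂ) ≤ 𝓝 w := hle.trans inf_le_left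
    have hneg : ∀ᶠ w' in (𝓦 : Filter ℂ), w'.im < 0 := hle1 (hLo.mem_nhds hw)
    have hAc : ∀ᶠ w' in (𝓦 : Filter ℂ), w' ∉ A := (hle.trans inf_le_right) (mem_principal_self _)
    have hlim : ∀ s : ℂ → ℂ, (∀ᶠ w' in (𝓦 : Filter ℂ), s w' ∈ D ∧ g (s w') = w') →
        Tendsto s 𝓦 (𝓝 (Λ w)) := by
      intro s hs
      obtain ⟨z, hz, hgz, ht⟩ := hp.exists_tendsto hcont hD hw (W := id) hle1 hs
      rwa [← huniq z hz hgz]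
    have hΛt := hlim Λ (hneg.mono fun w' h => hΛ w' h)
    have han : AnalyticAt ℂ g (Λ w) := hg.analyticAt (hD.mem_nhds (hΛ w hw).1)
    have hd' : ∀ᶠ w' in (𝓦 : Filter ℂ), deriv g (Λ w') ≠ 0 :=
      hΛt (han.deriv.continuousAt.eventually_ne hd)
    have h3 : ∀ w' : ℂ, ∃ z, (w' ∉ A → w'.im < 0 → deriv g (Λ w') ≠ 0 →
        z ∈ D ∧ g z = w' ∧ z ≠ Λ w') := by
      intro w'
      by_cases h : w' ∉ A ∧ w'.im < 0 ∧ deriv g (Λ w') ≠ 0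
      · obtain ⟨h1, h2, h3⟩ := h
        have : ∃ z ∈ D, g z = w' ∧ z ≠ Λ w' := by
          by_contra hcon
          push Not at hcon
          exact h1 ⟨h2, hcon, h3⟩
        obtain ⟨z, hz⟩ := this
        exact ⟨z, fun _ _ _ => hz⟩
      · exact ⟨0, fun h1 h2 h3 => absurd ⟨h1, h2, h3⟩ h⟩
    choose s hs using h3
    have hs' : ∀ᶠ w' in (𝓦 : Filter ℂ), s w' ∈ D ∧ g (s w') = w' ∧ s w' ≠ Λ w' := by
      filter_upwards [hAc, hneg, hd'] with w' h1 h2 h3 using hs w' h1 h2 h3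
    have hst := hlim s (hs'.mono fun w' h => ⟨h.1, h.2.1⟩)
    have hstr : HasStrictDerivAt g (deriv g (Λ w)) (Λ w) := han.hasStrictDerivAt
    have hli := hstr.eventually_left_inverse hd
    obtain ⟨w', ⟨h1, h2⟩, h3, h4⟩ := (((hΛt.eventually hli).and (hst.eventually hli)).and
      (hs'.and hneg)).exists
    apply h3.2.2
    have h1' : HasStrictDerivAt.localInverse g (deriv g (Λ w)) (Λ w) hstr hd (g (Λ w')) = Λ w' := h1
    have h2' : HasStrictDerivAt.localInverse g (deriv g (Λ w)) (Λ w) hstr hd (g (s w')) = s w' := h2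
    rw [← h2', ← h1', h3.2.1, (hΛ w' h4).2]
  have hAall : {w : ℂ | w.im < 0} ⊆ A := by
    refine hLc.subset_of_closure_inter_subset hAopen ?_ ?_
    · obtain ⟨w₀, hw, h1, h2⟩ := hb
      exact ⟨w₀, hw, hw, fun z hz hgz => h1 z hz _ (hΛ w₀ hw).1 hgz (hΛ w₀ hw).2,
        h2 _ (hΛ w₀ hw).1 (hΛ w₀ hw).2⟩
    · rintro w ⟨hwc, hw⟩
      by_contra hwA
      obtain ⟨hzD, hgz⟩ := hΛ w hw
      have hfreq : ∃ᶠ w' in 𝓝 w, w' ∈ A := mem_closure_iff_frequently.1 hwc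
      by_cases huniq : ∀ z ∈ D, g z = w → z = Λ w
      · have hd : deriv g (Λ w) = 0 := by
          by_contra hd
          exact hwA ⟨hw, huniq, hd⟩
        have han : AnalyticAt ℂ g (Λ w) := hg.analyticAt (hD.mem_nhds hzD)
        have h1 := eventually_exists_pair_of_deriv_eq_zero han
          (hp.not_eventually_const hg hD hzD (by rwa [hgz])) hd (hD.mem_nhds hzD)
        rw [hgz, eventually_nhdsWithin_iff] at h1
        obtain ⟨w', hw', h2⟩ := (hfreq.and_eventually h1).exists
        have hne : w' ≠ w := fun h => hwA (h ▸ hw')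
        obtain ⟨z₁, hz1, z₂, hz2, h12, e1, e2⟩ := h2 hne
        exact h12 ((hw'.2.1 z₁ hz1 e1).trans (hw'.2.1 z₂ hz2 e2).symm)
      · push Not at huniq
        obtain ⟨z, hz, hgz', hne⟩ := huniq
        obtain ⟨U, V, hU, hV, hzU, hΛV, hdis⟩ := t2_separation hne
        have h1 := hopV z hz (by rwa [hgz']) (U ∩ D) (inter_mem (hU.mem_nhds hzU) (hD.mem_nhds hz))
        have h2 := hopV (Λ w) hzD (by rwa [hgz]) (V ∩ D)
          (inter_mem (hV.mem_nhds hΛV) (hD.mem_nhds hzD))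
        rw [hgz'] at h1
        rw [hgz] at h2
        obtain ⟨w', hw', ⟨x, hx, ex⟩, ⟨y, hy, ey⟩⟩ := (hfreq.and_eventually (h1.and h2)).exists
        have : x = y := (hw'.2.1 x hx.2 ex).trans (hw'.2.1 y hy.2 ey).symm
        exact Set.disjoint_left.1 hdis hx.1 (this ▸ hy.1)
  refine ⟨Λ, ?_, fun w hw => ⟨(hΛ w hw).1, (hΛ w hw).2, (hAall hw).2.1⟩⟩
  intro w hw
  obtain ⟨-, huniq, hd⟩ := hAall hw
  obtain ⟨hzD, hgz⟩ := hΛ w hw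
  have han : AnalyticAt ℂ g (Λ w) := hg.analyticAt (hD.mem_nhds hzD)
  have hstr : HasStrictDerivAt g (deriv g (Λ w)) (Λ w) := han.hasStrictDerivAt
  have hloc := hstr.to_localInverse hd
  have hri := hstr.eventually_right_inverse hd
  have hl0 : HasStrictDerivAt.localInverse g (deriv g (Λ w)) (Λ w) hstr hd (g (Λ w)) = Λ w :=
    (hstr.eventually_left_inverse hd).self_of_nhds
  rw [hgz] at hloc hri hl0
  have hmem : ∀ᶠ w' in 𝓝 w,
      HasStrictDerivAt.localInverse g (deriv g (Λ w)) (Λ w) hstr hd w' ∈ D := by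
    apply hloc.hasDerivAt.continuousAt
    rw [hl0]
    exact hD.mem_nhds hzD
  refine (hloc.hasDerivAt.congr_of_eventuallyEq ?_).differentiableAt.differentiableWithinAt
  filter_upwards [hri, hmem, hLo.mem_nhds hw] with w' h1 h2 h3
  exact ((hAall h3).2.1 _ h2 h1).symm

end ProperMap

theorem differentiableOn_integral_of_locally_dominated {α : Type*} [MeasurableSpace α]
    {μ : Measure α} {F : ℂ → α → ℂ} {U : Set ℂ} (hU : IsOpen U)
    (hmeas : ∀ z ∈ U, AEStronglyMeasurable (F z) μ)
    (hdiff : ∀ a, DifferentiableOn ℂ (fun z => F z a) U)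
    (hbound : ∀ z ∈ U, ∃ V ∈ 𝓝 z, ∃ bound : α → ℝ, Integrable bound μ ∧
      ∀ᵐ a ∂μ, ∀ z' ∈ V, ‖F z' a‖ ≤ bound a) :
    DifferentiableOn ℂ (fun z => ∫ a, F z a ∂μ) U := by
  intro z₀ hz₀
  obtain ⟨V, hV, bound, hbi, hb⟩ := hbound z₀ hz₀
  obtain ⟨ε, hε, hball⟩ := Metric.mem_nhds_iff.1 (inter_mem hV (hU.mem_nhds hz₀))
  have hsub : ∀ x ∈ Metric.ball z₀ (ε / 2), Metric.closedBall x (ε / 4) ⊆ Metric.ball z₀ ε := by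
    intro x hx y hy
    rw [Metric.mem_ball] at hx ⊢
    rw [Metric.mem_closedBall] at hy
    have := dist_triangle y x z₀
    linarith
  have hd : ∀ a, ∀ x ∈ Metric.ball z₀ ε, HasDerivAt (fun z => F z a) (deriv (fun z => F z a) x) x :=
    fun a x hx => ((hdiff a).differentiableAt (hU.mem_nhds (hball hx).2)).hasDerivAt
  have hball2 : Metric.ball z₀ (ε / 2) ⊆ Metric.ball z₀ ε := Metric.ball_subset_ball (by linarith)
  have hz0' : z₀ ∈ Metric.ball z₀ (ε / 2) := Metric.mem_ball_self (by linarith)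
  refine (hasDerivAt_integral_of_dominated_loc_of_deriv_le (𝕜 := ℂ) (μ := μ) (F := F)
    (F' := fun x a => deriv (fun z => F z a) x)
    (bound := fun a => bound a / (ε / 4)) (x₀ := z₀) (Metric.ball_mem_nhds z₀ (half_pos hε))
    ?_ ?_ ?_ ?_ (hbi.div_const _) ?_).2.differentiableAt.differentiableWithinAt
  · filter_upwards [hU.mem_nhds hz₀] with x hx using hmeas x hx
  · refine hbi.mono' (hmeas z₀ hz₀) ?_
    filter_upwards [hb] with a ha using ha z₀ (mem_of_mem_nhds hV)
  · have hlim : Tendsto (fun n : ℕ => z₀ + ((ε / 2 / (n + 1) : ℝ) : ℂ)) atTop (𝓝[≠] z₀) := by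
      refine tendsto_nhdsWithin_iff.2 ⟨?_, Eventually.of_forall fun n => ?_⟩
      · have h1 : Tendsto (fun n : ℕ => ε / 2 / ((n : ℝ) + 1)) atTop (𝓝 0) := by
          have := (tendsto_one_div_add_atTop_nhds_zero_nat (𝕜 := ℝ)).const_mul (ε / 2)
          simpa [div_eq_mul_inv] using this
        have h2 := ((Complex.continuous_ofReal.tendsto 0).comp h1).const_add z₀
        simpa using h2
      · have : (ε / 2 / ((n : ℝ) + 1)) ≠ 0 := by positivity
        simpa [-Complex.ofReal_div] using this
    have hslope : ∀ᵐ a ∂μ, Tendsto (fun n : ℕ => slope (fun z => F z a) z₀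
        (z₀ + ((ε / 2 / (n + 1) : ℝ) : ℂ))) atTop (𝓝 (deriv (fun z => F z a) z₀)) :=
      Eventually.of_forall fun a => ((hd a z₀ (hball2 hz0')).tendsto_slope).comp hlim
    have hzU : ∀ᶠ n : ℕ in atTop, z₀ + ((ε / 2 / (n + 1) : ℝ) : ℂ) ∈ U :=
      (hlim.mono_right nhdsWithin_le_nhds) (hU.mem_nhds hz₀)
    obtain ⟨N, hN⟩ := eventually_atTop.1 hzU
    refine aestronglyMeasurable_of_tendsto_ae atTop
      (f := fun n a => slope (fun z => F z a) z₀ (z₀ + ((ε / 2 / ((n + N : ℕ) + 1) : ℝ) : ℂ)))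
      (fun n => ?_) (hslope.mono fun a ha => (tendsto_add_atTop_iff_nat N).2 ha)
    simp only [slope_def_field, div_eq_mul_inv]
    exact ((hmeas _ (hN (n + N) (by omega))).sub (hmeas _ hz₀)).mul_const _
  · filter_upwards [hb] with a ha x hx
    refine Complex.norm_deriv_le_of_forall_mem_sphere_norm_le (by linarith) ?_ ?_
    · refine DifferentiableOn.diffContOnCl ?_
      refine (hdiff a).mono ?_
      rw [closure_ball _ (by linarith)]
      exact fun y hy => (hball (hsub x hx hy)).2
    · exact fun y hy => ha y (hball (hsub x hx (Metric.sphere_subset_closedBall hy))).1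
  · exact Eventually.of_forall fun a x hx => hd a x (hball2 hx)

/-- The entire function `(e^τ - 1) / τ`. -/
noncomputable def expSlope (τ : ℂ) : ℂ := dslope Complex.exp 0 τ

/-- The holomorphic extension of `1 / (1 - e^τ) + 1 / τ` to `|Im τ| < 2π`. -/
noncomputable def bernoulliKernel (τ : ℂ) : ℂ := dslope expSlope 0 τ / expSlope τ

theorem exp_eq_one_of_abs_im_lt {τ : ℂ} (h : |τ.im| < 2 * Real.pi) (h1 : Complex.exp τ = 1) :
    τ = 0 := by
  obtain ⟨n, hn⟩ := Complex.exp_eq_one_iff.1 h1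
  have him : τ.im = n * (2 * Real.pi) := by
    rw [hn]; simp
  have hn0 : n = 0 := by
    rw [him, abs_mul, abs_of_pos Real.two_pi_pos] at h
    have : |(n : ℝ)| < 1 := by
      have := Real.two_pi_pos
      by_contra hh
      push Not at hh
      nlinarith
    have h2 : |n| < 1 := by exact_mod_cast this
    exact Int.abs_lt_one_iff.1 h2
  rw [hn, hn0]; simp

theorem expSlope_of_ne {τ : ℂ} (h : τ ≠ 0) : expSlope τ = (Complex.exp τ - 1) / τ := by
  simp [expSlope, dslope_of_ne _ h, slope_def_field]

theorem expSlope_zero : expSlope 0 = 1 := by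
  simp [expSlope]

theorem differentiable_expSlope : Differentiable ℂ expSlope := by
  rw [← differentiableOn_univ]
  exact (Complex.differentiableOn_dslope univ_mem).2 Complex.differentiable_exp.differentiableOn

theorem expSlope_ne_zero {τ : ℂ} (h : |τ.im| < 2 * Real.pi) : expSlope τ ≠ 0 := by
  by_cases h0 : τ = 0
  · simp [h0, expSlope_zero]
  · rw [expSlope_of_ne h0]
    refine div_ne_zero (fun h1 => h0 (exp_eq_one_of_abs_im_lt h (sub_eq_zero.1 h1))) h0

theorem isOpen_abs_im_lt (c : ℝ) : IsOpen {τ : ℂ | |τ.im| < c} :=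
  isOpen_lt (continuous_abs.comp Complex.continuous_im) continuous_const

theorem differentiableOn_bernoulliKernel :
    DifferentiableOn ℂ bernoulliKernel {τ | |τ.im| < 2 * Real.pi} := by
  refine DifferentiableOn.div ?_ differentiable_expSlope.differentiableOn
    fun τ hτ => expSlope_ne_zero hτ
  have h : DifferentiableOn ℂ (dslope expSlope 0) univ :=
    (Complex.differentiableOn_dslope univ_mem).2 differentiable_expSlope.differentiableOn
  exact h.mono (subset_univ _)

theorem bernoulliKernel_of_ne {τ : ℂ} (h : |τ.im| < 2 * Real.pi) (h0 : τ ≠ 0) :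
    bernoulliKernel τ = 1 / (1 - Complex.exp τ) + 1 / τ := by
  have h1 : Complex.exp τ ≠ 1 := fun h1 => h0 (exp_eq_one_of_abs_im_lt h h1)
  have h2 : 1 - Complex.exp τ ≠ 0 := sub_ne_zero.2 h1.symm
  have h3 : Complex.exp τ - 1 ≠ 0 := sub_ne_zero.2 h1
  rw [bernoulliKernel, dslope_of_ne _ h0, slope_def_field, expSlope_zero, expSlope_of_ne h0]
  field_simp
  ring

theorem norm_one_div_one_sub_exp_le {τ : ℂ} (h : 1 ≤ τ.re) :
    ‖1 / (1 - Complex.exp τ)‖ ≤ 2 * Real.exp (-τ.re) := by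
  have h1 : Real.exp τ.re - 1 ≤ ‖1 - Complex.exp τ‖ := by
    have := norm_sub_norm_le (Complex.exp τ) 1
    rwa [Complex.norm_exp, norm_one, norm_sub_rev] at this
  have h2 : 2 ≤ Real.exp τ.re := by
    have := Real.add_one_le_exp τ.re
    linarith
  rw [norm_div, norm_one, Real.exp_neg, div_le_iff₀ (by linarith)]
  have h3 : 0 < Real.exp τ.re := Real.exp_pos _
  calc (1 : ℝ) ≤ 2 * (Real.exp τ.re)⁻¹ * (Real.exp τ.re - 1) := by
        field_simp; linarith
    _ ≤ _ := by gcongr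

theorem norm_one_div_one_sub_exp_le_two {τ : ℂ} (h : τ.re ≤ -1) :
    ‖1 / (1 - Complex.exp τ)‖ ≤ 2 := by
  have h1 : 1 - Real.exp τ.re ≤ ‖1 - Complex.exp τ‖ := by
    have := norm_sub_norm_le 1 (Complex.exp τ)
    rwa [Complex.norm_exp, norm_one] at this
  have h2 : Real.exp τ.re ≤ 1 / 2 := by
    have h3 : 2 ≤ Real.exp (-τ.re) := by
      have := Real.add_one_le_exp (-τ.re)
      linarith
    rw [Real.exp_neg] at h3
    have := Real.exp_pos τ.re
    rw [le_inv_comm₀ (by norm_num) this] at h3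
    linarith
  rw [norm_div, norm_one, div_le_iff₀ (by linarith)]
  linarith

theorem exists_norm_bernoulliKernel_le :
    ∃ C : ℝ, ∀ τ : ℂ, |τ.im| ≤ 3 * Real.pi / 2 → ‖bernoulliKernel τ‖ ≤ C := by
  have hpi := Real.pi_pos
  have hcomp : IsCompact (Icc (-1 : ℝ) 1 ×ℂ Icc (-(3 * Real.pi / 2)) (3 * Real.pi / 2)) :=
    isCompact_Icc.reProdIm isCompact_Icc
  obtain ⟨C, hC⟩ := hcomp.exists_bound_of_continuousOn
    (differentiableOn_bernoulliKernel.continuousOn.mono fun τ hτ => by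
      have := abs_le.2 hτ.2
      simp only [mem_ofPred_eq]
      linarith)
  refine ⟨max C 3, fun τ hτ => ?_⟩
  by_cases hre : |τ.re| ≤ 1
  · exact (hC τ ⟨abs_le.1 hre, abs_le.1 hτ⟩).trans (le_max_left _ _)
  · push Not at hre
    refine le_trans ?_ (le_max_right _ _)
    have h0 : τ ≠ 0 := by rintro rfl; norm_num at hre
    rw [bernoulliKernel_of_ne (by linarith) h0]
    refine (norm_add_le _ _).trans ?_
    have h1 : ‖1 / τ‖ ≤ 1 := by
      rw [norm_div, norm_one, div_le_iff₀ (norm_pos_iff.2 h0), one_mul]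
      exact hre.le.trans (Complex.abs_re_le_norm τ)
    have h2 : ‖1 / (1 - Complex.exp τ)‖ ≤ 2 := by
      rcases lt_abs.1 hre with h | h
      · refine (norm_one_div_one_sub_exp_le h.le).trans ?_
        have : Real.exp (-τ.re) ≤ 1 := Real.exp_le_one_iff.2 (by linarith)
        linarith
      · exact norm_one_div_one_sub_exp_le_two (by linarith)
    linarith

/-- The holomorphic extension of `1 / (1 - e^{ρx}) - 1 / (ρ(1 - e^x))`. -/
noncomputable def powKernel (ρ : ℝ) (x : ℂ) : ℂ :=
  bernoulliKernel (ρ * x) - bernoulliKernel x / ρ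

section PowKernel

variable {ρ : ℝ}

theorem abs_im_ofReal_mul_le (hρ : 1 ≤ ρ) {c : ℝ} {x : ℂ} (hx : |x.im| ≤ c / ρ) :
    |((ρ : ℂ) * x).im| ≤ c ∧ |x.im| ≤ c := by
  have h0 : 0 < ρ := by linarith
  have h1 : |x.im| * ρ ≤ c := (le_div_iff₀ h0).1 hx
  refine ⟨by rw [Complex.im_ofReal_mul, abs_mul, abs_of_pos h0]; linarith, ?_⟩
  nlinarith [abs_nonneg x.im]

theorem powKernel_of_ne (hρ : 1 ≤ ρ) {x : ℂ} (hx : |x.im| ≤ 3 * Real.pi / 2 / ρ) (h0 : x ≠ 0) :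
    powKernel ρ x = 1 / (1 - Complex.exp (ρ * x)) - 1 / (1 - Complex.exp x) / ρ := by
  have hpi := Real.pi_pos
  have hρ0 : (ρ : ℂ) ≠ 0 := by exact_mod_cast (by linarith : ρ ≠ 0)
  obtain ⟨h1, h2⟩ := abs_im_ofReal_mul_le hρ hx
  rw [powKernel, bernoulliKernel_of_ne (by linarith) h0,
    bernoulliKernel_of_ne (by linarith) (mul_ne_zero hρ0 h0)]
  field_simp
  ring

theorem differentiableOn_powKernel (hρ : 1 ≤ ρ) :
    DifferentiableOn ℂ (powKernel ρ) {x | |x.im| < 3 * Real.pi / 2 / ρ} := by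
  have hpi := Real.pi_pos
  refine DifferentiableOn.sub ?_ (DifferentiableOn.div_const ?_ _)
  · refine differentiableOn_bernoulliKernel.comp (by fun_prop) fun x hx => ?_
    have := (abs_im_ofReal_mul_le hρ (le_of_lt hx)).1
    simp only [mem_ofPred_eq]
    linarith
  · refine differentiableOn_bernoulliKernel.mono fun x hx => ?_
    have := (abs_im_ofReal_mul_le hρ (le_of_lt hx)).2
    simp only [mem_ofPred_eq]
    linarith

theorem exists_norm_powKernel_le (hρ : 1 ≤ ρ) :
    ∃ C : ℝ, 0 < C ∧ ∀ x : ℂ, |x.im| ≤ 3 * Real.pi / 2 / ρ →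
      ‖powKernel ρ x‖ ≤ C ∧ ‖powKernel ρ x‖ ≤ C * Real.exp (-x.re) := by
  have hpi := Real.pi_pos
  obtain ⟨C, hC⟩ := exists_norm_bernoulliKernel_le
  have hC0 : 0 ≤ C := (norm_nonneg _).trans (hC 0 (by simp; positivity))
  have hρn : ‖(ρ : ℂ)‖ = ρ := by
    rw [Complex.norm_real, Real.norm_of_nonneg (by linarith)]
  have h1 : ∀ x : ℂ, |x.im| ≤ 3 * Real.pi / 2 / ρ → ‖powKernel ρ x‖ ≤ 2 * C := by
    intro x hx
    obtain ⟨h1, h2⟩ := abs_im_ofReal_mul_le hρ hx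
    refine (norm_sub_le _ _).trans ?_
    rw [norm_div, hρn]
    have h3 := hC _ h1
    have h4 : ‖bernoulliKernel x‖ / ρ ≤ C :=
      (div_le_self (norm_nonneg _) hρ).trans (hC _ h2)
    linarith
  have hexp1 : 1 ≤ Real.exp 1 := Real.one_le_exp (by norm_num)
  refine ⟨2 * C * Real.exp 1 + 4, by positivity, fun x hx => ⟨(h1 x hx).trans ?_, ?_⟩⟩
  · nlinarith
  · by_cases hre : 1 ≤ x.re
    · have hx0 : x ≠ 0 := by rintro rfl; norm_num at hre
      have hre' : x.re ≤ ((ρ : ℂ) * x).re := by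
        rw [Complex.re_ofReal_mul]
        nlinarith
      rw [powKernel_of_ne hρ hx hx0]
      refine (norm_sub_le _ _).trans ?_
      rw [norm_div (1 / (1 - Complex.exp x)), hρn]
      have h3 := norm_one_div_one_sub_exp_le hre
      have h4 := norm_one_div_one_sub_exp_le (hre.trans hre')
      have h5 : Real.exp (-((ρ : ℂ) * x).re) ≤ Real.exp (-x.re) :=
        Real.exp_le_exp.2 (neg_le_neg hre')
      have h6 := div_le_self (norm_nonneg (1 / (1 - Complex.exp x))) hρ
      have : 0 ≤ 2 * C * Real.exp 1 * Real.exp (-x.re) := by positivity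
      nlinarith
    · push Not at hre
      refine (h1 x hx).trans ?_
      have h7 : 1 ≤ Real.exp 1 * Real.exp (-x.re) := by
        rw [← Real.exp_add]
        exact Real.one_le_exp (by linarith)
      have := Real.exp_pos (-x.re)
      nlinarith

end PowKernel

/-- The density `(4/π) t² / (1 + t²)²`. -/
noncomputable def baseDensity (t : ℝ) : ℝ := 4 / Real.pi * (t ^ 2 / (1 + t ^ 2) ^ 2)

/-- The law of `√(S - 1)` where `S` is the free positive stable law with index `1/2`,
normalised to be supported on `(1, ∞)`. -/
noncomputable def baseMeasure : Measure ℝ :=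
  (volume.restrict (Ioi 0)).withDensity fun t => ENNReal.ofReal (baseDensity t)

theorem baseDensity_nonneg (t : ℝ) : 0 ≤ baseDensity t := by
  have := Real.pi_pos
  unfold baseDensity
  positivity

theorem continuous_baseDensity : Continuous baseDensity := by
  unfold baseDensity
  refine continuous_const.mul ((continuous_pow 2).div (by fun_prop) fun t => ?_)
  positivity

theorem integral_baseMeasure {E : Type*} [NormedAddCommGroup E] [NormedSpace ℝ E] (f : ℝ → E) :
    ∫ t, f t ∂baseMeasure = ∫ t in Ioi 0, baseDensity t • f t := by
  rw [baseMeasure, integral_withDensity_eq_integral_toReal_smul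
    (continuous_baseDensity.measurable.ennreal_ofReal) (by simp)]
  simp only [ENNReal.toReal_ofReal (baseDensity_nonneg _)]

theorem ae_baseMeasure {p : ℝ → Prop} (h : ∀ t, 0 < t → p t) : ∀ᵐ t ∂baseMeasure, p t := by
  refine (withDensity_absolutelyContinuous _ _).ae_le ?_
  filter_upwards [ae_restrict_mem measurableSet_Ioi] with t ht using h t ht

theorem hasDerivAt_half_arctan_add (t : ℝ) :
    HasDerivAt (fun t : ℝ => (Real.arctan t + t / (1 + t ^ 2)) / 2) (1 / (1 + t ^ 2) ^ 2) t := by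
  have h0 : (1 + t ^ 2) ≠ 0 := by positivity
  have h1 : HasDerivAt (fun t : ℝ => 1 + t ^ 2) (2 * t) t := by
    simpa using ((hasDerivAt_id' t).fun_pow 2).const_add 1
  refine (((Real.hasDerivAt_arctan t).fun_add
    ((hasDerivAt_id' t).fun_div h1 h0)).div_const 2).congr_deriv ?_
  field_simp
  ring

theorem tendsto_id_div_one_add_sq : Tendsto (fun t : ℝ => t / (1 + t ^ 2)) atTop (𝓝 0) := by
  refine squeeze_zero' (g := fun t : ℝ => t⁻¹) ?_ ?_ tendsto_inv_atTop_zero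
  · filter_upwards [eventually_gt_atTop 0] with t ht using by positivity
  · filter_upwards [eventually_gt_atTop 0] with t ht
    rw [div_le_iff₀ (by positivity)]
    field_simp
    nlinarith

theorem tendsto_arctan : Tendsto Real.arctan atTop (𝓝 (Real.pi / 2)) :=
  Real.tendsto_arctan_atTop.mono_right nhdsWithin_le_nhds

theorem tendsto_half_arctan_add :
    Tendsto (fun t : ℝ => (Real.arctan t + t / (1 + t ^ 2)) / 2) atTop (𝓝 (Real.pi / 4)) := by
  convert (tendsto_arctan.add tendsto_id_div_one_add_sq).div_const 2 using 2
  ring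

theorem integrable_baseDensity : Integrable baseDensity := by
  refine (integrable_inv_one_add_sq.const_mul (4 / Real.pi)).mono'
    continuous_baseDensity.aestronglyMeasurable (Eventually.of_forall fun t => ?_)
  have := Real.pi_pos
  rw [Real.norm_of_nonneg (baseDensity_nonneg t), baseDensity]
  gcongr
  rw [div_le_iff₀ (by positivity)]
  field_simp
  linarith

theorem integral_baseDensity : ∫ t in Ioi 0, baseDensity t = 1 := by
  have hpi := Real.pi_pos
  have h := integral_Ioi_of_hasDerivAt_of_tendsto (a := 0) (f' := baseDensity)
    (f := fun t => 4 / Real.pi * (Real.arctan t - (Real.arctan t + t / (1 + t ^ 2)) / 2))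
    (m := 4 / Real.pi * (Real.pi / 2 - Real.pi / 4)) ?_ ?_ integrable_baseDensity.integrableOn ?_
  · rw [h]
    simp
    field_simp
    norm_num
  · refine Continuous.continuousWithinAt ?_
    have : Continuous fun t : ℝ => t / (1 + t ^ 2) :=
      continuous_id.div (by fun_prop) fun t => by positivity
    fun_prop
  · intro t _
    refine (((Real.hasDerivAt_arctan t).fun_sub (hasDerivAt_half_arctan_add t)).const_mul
      (4 / Real.pi)).congr_deriv ?_
    rw [baseDensity]
    field_simp
    ring
  · exact (tendsto_arctan.sub tendsto_half_arctan_add).const_mul _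

instance isProbabilityMeasure_baseMeasure : IsProbabilityMeasure baseMeasure := by
  refine ⟨?_⟩
  rw [baseMeasure, withDensity_apply _ MeasurableSet.univ, Measure.restrict_univ,
    ← ofReal_integral_eq_lintegral_ofReal integrable_baseDensity.integrableOn
      (Eventually.of_forall baseDensity_nonneg), integral_baseDensity, ENNReal.ofReal_one]

section ResolventIntegral

variable {q : ℂ}

theorem sq_add_sq_ne_zero (hq : 0 < q.re) (t : ℝ) : q ^ 2 + (t : ℂ) ^ 2 ≠ 0 := by
  have h : q ^ 2 + (t : ℂ) ^ 2 = (q + Complex.I * t) * (q - Complex.I * t) := by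
    ring_nf
    rw [Complex.I_sq]
    ring
  rw [h]
  refine mul_ne_zero (fun h => ?_) (fun h => ?_)
  · have := congrArg Complex.re h
    simp at this
    linarith
  · have := congrArg Complex.re h
    simp at this
    linarith

theorem sq_re_le_norm_sq_add_sq (hq : 0 < q.re) (t : ℝ) : q.re ^ 2 ≤ ‖q ^ 2 + (t : ℂ) ^ 2‖ := by
  have h : q ^ 2 + (t : ℂ) ^ 2 = (q + Complex.I * t) * (q - Complex.I * t) := by
    ring_nf
    rw [Complex.I_sq]
    ring
  rw [h, norm_mul, sq]
  have h1 : q.re ≤ ‖q + Complex.I * t‖ := by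
    simpa using Complex.re_le_norm (q + Complex.I * t)
  have h2 : q.re ≤ ‖q - Complex.I * t‖ := by
    simpa using Complex.re_le_norm (q - Complex.I * t)
  gcongr

theorem norm_inv_sq_add_sq_le (hq : 0 < q.re) (t : ℝ) :
    ‖1 / (q ^ 2 + (t : ℂ) ^ 2)‖ ≤ (1 + (‖q‖ ^ 2 + 1) / q.re ^ 2) * (1 + t ^ 2)⁻¹ := by
  have h1 := sq_re_le_norm_sq_add_sq hq t
  have h2 : t ^ 2 ≤ ‖q ^ 2 + (t : ℂ) ^ 2‖ + ‖q‖ ^ 2 := by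
    have := norm_sub_le (q ^ 2 + (t : ℂ) ^ 2) (q ^ 2)
    rw [add_sub_cancel_left, norm_pow, norm_pow, Complex.norm_real, Real.norm_eq_abs, sq_abs] at this
    exact this
  have h0 : 0 < ‖q ^ 2 + (t : ℂ) ^ 2‖ := norm_pos_iff.2 (sq_add_sq_ne_zero hq t)
  rw [norm_div, norm_one, div_le_iff₀ h0, ← div_eq_mul_inv, div_mul_eq_mul_div,
    le_div_iff₀ (by positivity)]
  have h3 : (‖q‖ ^ 2 + 1) ≤ (‖q‖ ^ 2 + 1) / q.re ^ 2 * ‖q ^ 2 + (t : ℂ) ^ 2‖ := by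
    rw [div_mul_eq_mul_div, le_div_iff₀ (by positivity)]
    gcongr
  linarith

theorem continuous_inv_sq_add_sq (hq : 0 < q.re) :
    Continuous fun t : ℝ => 1 / (q ^ 2 + (t : ℂ) ^ 2) :=
  continuous_const.div (by fun_prop) (sq_add_sq_ne_zero hq)

theorem integrable_inv_sq_add_sq (hq : 0 < q.re) :
    Integrable fun t : ℝ => 1 / (q ^ 2 + (t : ℂ) ^ 2) :=
  (integrable_inv_one_add_sq.const_mul (1 + (‖q‖ ^ 2 + 1) / q.re ^ 2)).mono'
    (continuous_inv_sq_add_sq hq).aestronglyMeasurable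
    (Eventually.of_forall (norm_inv_sq_add_sq_le hq))

theorem ne_zero_of_re_pos (hq : 0 < q.re) : q ≠ 0 := by
  rintro rfl
  simp at hq

theorem hasDerivAt_log_sub_log (hq : 0 < q.re) (t : ℝ) :
    HasDerivAt (fun t : ℝ => (Complex.log (q + t * Complex.I) - Complex.log (q - t * Complex.I)) /
      (2 * q * Complex.I)) (1 / (q ^ 2 + (t : ℂ) ^ 2)) t := by
  have h0 : HasDerivAt (fun t : ℝ => (t : ℂ) * Complex.I) Complex.I t := by
    simpa using (Complex.ofRealCLM.hasDerivAt (x := t)).mul_const Complex.I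
  have hp := (h0.const_add q).clog_real (Or.inl (by simpa using hq))
  have hm := (h0.const_sub q).clog_real (Or.inl (by simpa using hq))
  have h1 : q + t * Complex.I ≠ 0 := ne_zero_of_re_pos (by simpa using hq)
  have h2 : q - t * Complex.I ≠ 0 := ne_zero_of_re_pos (by simpa using hq)
  have h3 := ne_zero_of_re_pos hq
  have h4 : q ^ 2 + (t : ℂ) ^ 2 = (q + t * Complex.I) * (q - t * Complex.I) := by
    ring_nf
    rw [Complex.I_sq]
    ring
  refine ((hp.fun_sub hm).div_const (2 * q * Complex.I)).congr_deriv ?_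
  rw [h4, div_sub_div _ _ h1 h2, div_div, div_eq_div_iff
    (mul_ne_zero (mul_ne_zero h1 h2) (mul_ne_zero (mul_ne_zero two_ne_zero h3) Complex.I_ne_zero))
    (mul_ne_zero h1 h2)]
  ring

theorem tendsto_log_sub_log (hq : 0 < q.re) :
    Tendsto (fun t : ℝ => (Complex.log (q + t * Complex.I) - Complex.log (q - t * Complex.I)) /
      (2 * q * Complex.I)) atTop (𝓝 (Real.pi / (2 * q))) := by
  have h3 := ne_zero_of_re_pos hq
  have hinv : Tendsto (fun t : ℝ => q / (t : ℂ)) atTop (𝓝 0) := by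
    have := ((Complex.continuous_ofReal.tendsto 0).comp tendsto_inv_atTop_zero).const_mul q
    simpa [div_eq_mul_inv] using this
  have hp : Tendsto (fun t : ℝ => Complex.log (q / t + Complex.I)) atTop
      (𝓝 (Complex.log Complex.I)) := by
    have h := (continuousAt_clog (x := Complex.I) (Or.inr (by simp))).tendsto
    have h2 := hinv.add_const Complex.I
    rw [zero_add] at h2
    exact h.comp h2
  have hm : Tendsto (fun t : ℝ => Complex.log (q / t - Complex.I)) atTop
      (𝓝 (Complex.log (-Complex.I))) := by
    have h := (continuousAt_clog (x := -Complex.I) (Or.inr (by simp))).tendsto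
    have h2 := hinv.sub_const Complex.I
    rw [zero_sub] at h2
    exact h.comp h2
  have h := (hp.sub hm).div_const (2 * q * Complex.I)
  have hval : (Complex.log Complex.I - Complex.log (-Complex.I)) / (2 * q * Complex.I) =
      Real.pi / (2 * q) := by
    rw [Complex.log_I, Complex.log_neg_I]
    field_simp
    ring
  rw [hval] at h
  refine h.congr' ?_
  filter_upwards [eventually_gt_atTop 0] with t ht
  have ht0 : (t : ℂ) ≠ 0 := by exact_mod_cast ht.ne'
  have e1 : q + t * Complex.I = t * (q / t + Complex.I) := by field_simp
  have e2 : q - t * Complex.I = t * (q / t - Complex.I) := by field_simp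
  have n1 : q / t + Complex.I ≠ 0 := fun h => by
    rw [h, mul_zero] at e1
    exact ne_zero_of_re_pos (by simpa using hq) e1
  have n2 : q / t - Complex.I ≠ 0 := fun h => by
    rw [h, mul_zero] at e2
    exact ne_zero_of_re_pos (by simpa using hq) e2
  rw [e1, e2, Complex.log_ofReal_mul ht n1, Complex.log_ofReal_mul ht n2]
  ring

theorem integral_Ioi_inv_sq_add_sq (hq : 0 < q.re) :
    ∫ t in Ioi (0 : ℝ), 1 / (q ^ 2 + (t : ℂ) ^ 2) = Real.pi / (2 * q) := by
  rw [integral_Ioi_of_hasDerivAt_of_tendsto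
    (hasDerivAt_log_sub_log hq 0).continuousAt.continuousWithinAt
    (fun t _ => hasDerivAt_log_sub_log hq t) (integrable_inv_sq_add_sq hq).integrableOn
    (tendsto_log_sub_log hq)]
  simp

theorem integral_inv_one_add_sq_sq :
    IntegrableOn (fun t : ℝ => (1 / (1 + t ^ 2) ^ 2 : ℝ)) (Ioi 0) ∧
      ∫ t in Ioi (0 : ℝ), 1 / (1 + t ^ 2) ^ 2 = Real.pi / 4 := by
  have hi : Integrable (fun t : ℝ => (1 / (1 + t ^ 2) ^ 2 : ℝ)) := by
    refine integrable_inv_one_add_sq.mono' (Continuous.aestronglyMeasurable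
      (continuous_const.div (by fun_prop) fun t => by positivity))
      (Eventually.of_forall fun t => ?_)
    rw [Real.norm_of_nonneg (by positivity), div_le_iff₀ (by positivity)]
    field_simp
    nlinarith [sq_nonneg t]
  refine ⟨hi.integrableOn, ?_⟩
  rw [integral_Ioi_of_hasDerivAt_of_tendsto
    (hasDerivAt_half_arctan_add 0).continuousAt.continuousWithinAt
    (fun t _ => hasDerivAt_half_arctan_add t) hi.integrableOn tendsto_half_arctan_add]
  simp

theorem integral_baseMeasure_resolvent (hq : 0 < q.re) :
    ∫ t, (q ^ 2 - 1) / (q ^ 2 + (t : ℂ) ^ 2) ∂baseMeasure = (q - 1) / (q + 1) := by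
  have hpi : (Real.pi : ℂ) ≠ 0 := by exact_mod_cast Real.pi_ne_zero
  have hq1 : q + 1 ≠ 0 := ne_zero_of_re_pos (by simp; linarith)
  have hq0 := ne_zero_of_re_pos hq
  by_cases h1 : q = 1
  · simp [h1]
  have h1' : q - 1 ≠ 0 := sub_ne_zero.2 h1
  have h2 : q ^ 2 - 1 ≠ 0 := by
    rw [show q ^ 2 - 1 = (q - 1) * (q + 1) by ring]
    exact mul_ne_zero h1' hq1
  rw [integral_baseMeasure]
  have hpt : ∀ t : ℝ, baseDensity t • ((q ^ 2 - 1) / (q ^ 2 + (t : ℂ) ^ 2)) =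
      (4 / Real.pi : ℂ) * (q ^ 2 / (q ^ 2 - 1) * (1 / ((1 : ℂ) ^ 2 + (t : ℂ) ^ 2) -
        1 / (q ^ 2 + (t : ℂ) ^ 2)) - ((1 / (1 + t ^ 2) ^ 2 : ℝ) : ℂ)) := by
    intro t
    have h3 := sq_add_sq_ne_zero hq t
    have h4 : (1 + (t : ℂ) ^ 2) ≠ 0 := by
      have := sq_add_sq_ne_zero (q := 1) (by simp) t
      simpa using this
    rw [baseDensity, Complex.real_smul]
    push_cast
    rw [one_pow]
    field_simp
    ring
  simp only [hpt]
  have hone : (0 : ℝ) < (1 : ℂ).re := by simp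
  have i1 := (integrable_inv_sq_add_sq hone).integrableOn (s := Ioi 0)
  have i2 := (integrable_inv_sq_add_sq hq).integrableOn (s := Ioi 0)
  have i3 : IntegrableOn (fun t : ℝ => ((1 / (1 + t ^ 2) ^ 2 : ℝ) : ℂ)) (Ioi 0) :=
    integral_inv_one_add_sq_sq.1.ofReal
  rw [integral_const_mul, integral_sub (Integrable.const_mul (by exact i1.sub i2) _) i3, integral_const_mul,
    integral_sub i1 i2, integral_complex_ofReal, integral_Ioi_inv_sq_add_sq hq,
    integral_Ioi_inv_sq_add_sq hone, integral_inv_one_add_sq_sq.2]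
  push_cast
  field_simp
  ring

end ResolventIntegral

/-- The Cauchy transform of the law of `(1 + t²)^{ρσ}` under `baseMeasure`. -/
noncomputable def powTransform (ρ σ : ℝ) (z : ℂ) : ℂ :=
  ∫ t, (z - (Real.exp (ρ * (σ * Real.log (1 + t ^ 2))) : ℂ))⁻¹ ∂baseMeasure

theorem image_Ioi_one_add_sq_div {b : ℝ} (hb : 0 < b) :
    (fun t : ℝ => (1 + t ^ 2) / b) '' Ioi 0 = Ioi (1 / b) := by
  ext x
  simp only [mem_image, mem_Ioi]
  constructor
  · rintro ⟨t, ht, rfl⟩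
    gcongr
    nlinarith
  · intro hx
    have h1 : 1 < x * b := (div_lt_iff₀ hb).1 hx
    refine ⟨Real.sqrt (x * b - 1), Real.sqrt_pos.2 (by linarith), ?_⟩
    rw [Real.sq_sqrt (by linarith)]
    field_simp
    ring

theorem integral_sbMeasure {b : ℝ} (hb : 0 < b) (f : ℝ → ℂ) :
    ∫ x, f x ∂sbMeasure b = ∫ t, f ((1 + t ^ 2) / b) ∂baseMeasure := by
  have hpi := Real.pi_pos
  have hm : Measurable fun x : ℝ => (Ioi (1 / b)).indicator
      (fun x => 4 / b * (Real.sqrt (b * x - 1) / (2 * Real.pi * x ^ 2))) x := by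
    refine Measurable.indicator ?_ measurableSet_Ioi
    fun_prop
  have hnn : ∀ x : ℝ, 0 ≤ (Ioi (1 / b)).indicator
      (fun x => 4 / b * (Real.sqrt (b * x - 1) / (2 * Real.pi * x ^ 2))) x :=
    fun x => indicator_nonneg (fun x _ => by positivity) x
  rw [sbMeasure, integral_withDensity_eq_integral_toReal_smul hm.ennreal_ofReal (by simp),
    integral_baseMeasure]
  simp only [ENNReal.toReal_ofReal (hnn _)]
  have h1 : (fun x : ℝ => (Ioi (1 / b)).indicator
      (fun x => 4 / b * (Real.sqrt (b * x - 1) / (2 * Real.pi * x ^ 2))) x • f x) =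
      (Ioi (1 / b)).indicator
        (fun x => (4 / b * (Real.sqrt (b * x - 1) / (2 * Real.pi * x ^ 2))) • f x) := by
    ext x
    by_cases hx : x ∈ Ioi (1 / b)
    · simp only [indicator_of_mem hx]
    · simp only [indicator_of_notMem hx, zero_smul]
  rw [h1, integral_indicator measurableSet_Ioi, ← image_Ioi_one_add_sq_div hb,
    integral_image_eq_integral_abs_deriv_smul (f' := fun t => 2 * t / b) measurableSet_Ioi]
  · refine setIntegral_congr_fun measurableSet_Ioi fun t ht => ?_
    have ht0 : 0 < t := ht
    have e1 : b * ((1 + t ^ 2) / b) - 1 = t ^ 2 := by field_simp; ring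
    rw [smul_smul, e1, Real.sqrt_sq ht0.le, abs_of_pos (by positivity), baseDensity]
    congr 1
    field_simp
  · intro t _
    have : HasDerivAt (fun t : ℝ => (1 + t ^ 2) / b) (2 * t / b) t := by
      simpa using (((hasDerivAt_id' t).fun_pow 2).const_add 1).div_const b
    exact this.hasDerivWithinAt
  · intro s hs t ht hst
    have hs0 : 0 < s := hs
    have ht0 : 0 < t := ht
    have h2 : (1 + s ^ 2) / b = (1 + t ^ 2) / b := hst
    rw [div_left_inj' hb.ne'] at h2
    nlinarith

theorem cauchyTransform_map_sbMeasure {b : ℝ} (hb : 0 < b) {ρ σ : ℝ} (z : ℂ) :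
    cauchyTransform (Measure.map (fun x : ℝ => x ^ (ρ * σ)) (sbMeasure b))
      ((b ^ (-(ρ * σ)) : ℝ) * z) = ((b ^ (-(ρ * σ)) : ℝ) : ℂ)⁻¹ * powTransform ρ σ z := by
  have hm : Measurable fun x : ℝ => x ^ (ρ * σ) := by fun_prop
  rw [cauchyTransform, integral_map hm.aemeasurable
    (Measurable.aestronglyMeasurable (by fun_prop)), integral_sbMeasure hb, powTransform,
    ← integral_const_mul]
  congr 1
  ext t
  have h1 : 0 < 1 + t ^ 2 := by positivity
  have h2 : ((1 + t ^ 2) / b) ^ (ρ * σ) =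
      b ^ (-(ρ * σ)) * Real.exp (ρ * (σ * Real.log (1 + t ^ 2))) := by
    rw [Real.div_rpow h1.le hb.le, Real.rpow_neg hb.le, Real.rpow_def_of_pos h1,
      div_eq_inv_mul]
    congr 2
    ring
  rw [h2, ← mul_inv]
  congr 1
  push_cast
  ring

/-- The class UI is stable under dilations, in the form needed here. -/
theorem isUI_of_powTransform {b : ℝ} (hb : 0 < b) {ρ σ : ℝ} {F : ℂ → ℂ}
    (hF : DifferentiableOn ℂ F {w | w.im < 0}) (hinj : InjOn F {w | w.im < 0})
    (hinv : ∃ δ : ℝ, 0 < δ ∧ ∀ w : ℂ, |w.re| < -w.im → -δ < w.im →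
      0 < (F w).im ∧ powTransform ρ σ (F w) = w) :
    IsUI (Measure.map (fun x : ℝ => x ^ (ρ * σ)) (sbMeasure b)) := by
  set c : ℝ := b ^ (-(ρ * σ)) with hc
  have hc0 : 0 < c := Real.rpow_pos_of_pos hb _
  have hcC : (c : ℂ) ≠ 0 := by exact_mod_cast hc0.ne'
  have hmaps : MapsTo (fun w : ℂ => (c : ℂ) * w) {w | w.im < 0} {w | w.im < 0} := by
    intro w hw
    simp only [mem_ofPred_eq, Complex.im_ofReal_mul] at hw ⊢
    nlinarith
  have hLo : IsOpen {w : ℂ | w.im < 0} := isOpen_lt Complex.continuous_im continuous_const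
  obtain ⟨δ, hδ, h⟩ := hinv
  refine ⟨fun w => c * F (c * w), ?_, ?_, 1, one_pos, δ / c, by positivity, ?_⟩
  · refine DifferentiableOn.analyticOnNhd ?_ hLo
    exact (hF.comp (by fun_prop) hmaps).const_mul _
  · intro w hw w' hw' hww
    exact mul_left_cancel₀ hcC (hinj (hmaps hw) (hmaps hw') (mul_left_cancel₀ hcC hww))
  · intro w h1 h2
    have h2' : -δ < w.im * c := by
      rw [← neg_div, div_lt_iff₀ hc0] at h2
      exact h2
    obtain ⟨h3, h4⟩ := h (c * w) (by
      rw [Complex.re_ofReal_mul, Complex.im_ofReal_mul, abs_mul, abs_of_pos hc0]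
      nlinarith) (by rw [Complex.im_ofReal_mul]; linarith)
    refine ⟨by rw [Complex.im_ofReal_mul]; positivity, ?_⟩
    rw [hc, cauchyTransform_map_sbMeasure hb, ← hc, h4]
    field_simp

section Remainder

variable {ρ σ : ℝ}

/-- The part of `e^u G(e^u)` that continues holomorphically to a wide strip. -/
noncomputable def remainder (ρ σ : ℝ) (u : ℂ) : ℂ :=
  ∫ t, powKernel ρ ((σ * Real.log (1 + t ^ 2) : ℝ) - u / ρ) ∂baseMeasure

theorem abs_im_sub_div_le (hρ : 1 ≤ ρ) {u : ℂ} {c : ℝ} (a : ℝ) (hu : |u.im| ≤ c) :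
    |((a : ℂ) - u / ρ).im| ≤ c / ρ := by
  have h0 : 0 < ρ := by linarith
  rw [Complex.sub_im, Complex.ofReal_im, zero_sub, abs_neg, Complex.div_ofReal_im, abs_div,
    abs_of_pos h0]
  gcongr

theorem abs_im_sub_div_lt (hρ : 1 ≤ ρ) {u : ℂ} {c : ℝ} (a : ℝ) (hu : |u.im| < c) :
    |((a : ℂ) - u / ρ).im| < c / ρ := by
  have h0 : 0 < ρ := by linarith
  rw [Complex.sub_im, Complex.ofReal_im, zero_sub, abs_neg, Complex.div_ofReal_im, abs_div,
    abs_of_pos h0]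
  gcongr

theorem continuous_log_one_add_sq : Continuous fun t : ℝ => Real.log (1 + t ^ 2) :=
  Continuous.log (by fun_prop) fun t => by positivity

theorem continuous_powKernel_log (hρ : 1 ≤ ρ) {u : ℂ} (hu : |u.im| < 3 * Real.pi / 2) :
    Continuous fun t : ℝ => powKernel ρ ((σ * Real.log (1 + t ^ 2) : ℝ) - u / ρ) := by
  have h : ContinuousOn (powKernel ρ) {x | |x.im| < 3 * Real.pi / 2 / ρ} :=
    (differentiableOn_powKernel hρ).continuousOn
  have hc := continuous_log_one_add_sq
  exact h.comp_continuous (by fun_prop) fun t => abs_im_sub_div_lt hρ _ hu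

theorem integrable_powKernel_log (hρ : 1 ≤ ρ) {u : ℂ} (hu : |u.im| < 3 * Real.pi / 2) :
    Integrable (fun t : ℝ => powKernel ρ ((σ * Real.log (1 + t ^ 2) : ℝ) - u / ρ))
      baseMeasure := by
  obtain ⟨C, -, hC⟩ := exists_norm_powKernel_le hρ
  refine (integrable_const C).mono' (continuous_powKernel_log hρ hu).aestronglyMeasurable
    (Eventually.of_forall fun t => (hC _ (abs_im_sub_div_le hρ _ hu.le)).1)

theorem differentiableOn_remainder (hρ : 1 ≤ ρ) :
    DifferentiableOn ℂ (remainder ρ σ) {u | |u.im| < 3 * Real.pi / 2} := by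
  obtain ⟨C, -, hC⟩ := exists_norm_powKernel_le hρ
  refine differentiableOn_integral_of_locally_dominated (isOpen_abs_im_lt _)
    (fun u hu => (continuous_powKernel_log hρ hu).aestronglyMeasurable) (fun t => ?_)
    (fun u hu => ⟨_, (isOpen_abs_im_lt _).mem_nhds hu, fun _ => C, integrable_const C,
      Eventually.of_forall fun t v hv => (hC _ (abs_im_sub_div_le hρ _ (le_of_lt hv))).1⟩)
  exact (differentiableOn_powKernel hρ).comp (by fun_prop) fun u hu => abs_im_sub_div_lt hρ _ hu

theorem exists_norm_remainder_le (hρ : 1 ≤ ρ) :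
    ∃ C : ℝ, ∀ u : ℂ, |u.im| < 3 * Real.pi / 2 → ‖remainder ρ σ u‖ ≤ C := by
  obtain ⟨C, -, hC⟩ := exists_norm_powKernel_le hρ
  refine ⟨C, fun u hu => ?_⟩
  have := norm_integral_le_of_norm_le_const (μ := baseMeasure) (C := C)
    (Eventually.of_forall fun t : ℝ => (hC _
      (abs_im_sub_div_le hρ (σ * Real.log (1 + t ^ 2)) hu.le)).1)
  simpa [remainder] using this

theorem powKernel_ofReal_im (hρ : 1 ≤ ρ) {x : ℝ} (hx : x ≠ 0) : (powKernel ρ x).im = 0 := by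
  have hpi := Real.pi_pos
  rw [powKernel_of_ne hρ (by simp; positivity) (by exact_mod_cast hx)]
  have : (1 / (1 - Complex.exp (ρ * x)) - 1 / (1 - Complex.exp x) / ρ : ℂ) =
      ((1 / (1 - Real.exp (ρ * x)) - 1 / (1 - Real.exp x) / ρ : ℝ) : ℂ) := by push_cast; rfl
  rw [this, Complex.ofReal_im]

theorem log_one_add_sq_pos {t : ℝ} (ht : 0 < t) : 0 < Real.log (1 + t ^ 2) :=
  Real.log_pos (by nlinarith)

theorem im_integral {μ : Measure ℝ} {f : ℝ → ℂ} (hf : Integrable f μ) :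
    (∫ t, f t ∂μ).im = ∫ t, (f t).im ∂μ :=
  (Complex.imCLM.integral_comp_comm hf).symm

theorem remainder_zero_im (hρ : 1 ≤ ρ) (hσ : σ ≠ 0) : (remainder ρ σ 0).im = 0 := by
  have hpi := Real.pi_pos
  rw [remainder, im_integral (integrable_powKernel_log hρ (by simpa using hpi))]
  refine integral_eq_zero_of_ae (ae_baseMeasure fun t ht => ?_)
  simp only [zero_div, sub_zero]
  exact powKernel_ofReal_im hρ (mul_ne_zero hσ (log_one_add_sq_pos ht).ne')

theorem powTransform_exp (hρ : 1 ≤ ρ) {u : ℂ} (hu : |u.im| < 3 * Real.pi / 2) (h0 : u.im ≠ 0)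
    (h_int : Integrable (fun t : ℝ =>
      1 / (1 - Complex.exp ((σ * Real.log (1 + t ^ 2) : ℝ) - u / ρ))) baseMeasure) :
    powTransform ρ σ (Complex.exp u) = Complex.exp (-u) *
      ((∫ t, 1 / (1 - Complex.exp ((σ * Real.log (1 + t ^ 2) : ℝ) - u / ρ)) ∂baseMeasure) / ρ +
        remainder ρ σ u) := by
  have hρ0 : 0 < ρ := by linarith
  have hρC : (ρ : ℂ) ≠ 0 := by exact_mod_cast hρ0.ne'
  rw [remainder, ← integral_div, ← integral_add (h_int.div_const _) (integrable_powKernel_log hρ hu),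
    ← integral_const_mul, powTransform]
  congr 1
  ext t
  have hne : ((σ * Real.log (1 + t ^ 2) : ℝ) : ℂ) - u / ρ ≠ 0 := by
    intro h
    have := congrArg Complex.im h
    rw [Complex.sub_im, Complex.ofReal_im, zero_sub, Complex.div_ofReal_im, Complex.zero_im,
      neg_eq_zero, div_eq_zero_iff] at this
    exact this.elim h0 hρ0.ne'
  rw [powKernel_of_ne hρ (abs_im_sub_div_le hρ _ hu.le) hne]
  have e1 : (ρ : ℂ) * (((σ * Real.log (1 + t ^ 2) : ℝ) : ℂ) - u / ρ) =
      ((ρ * (σ * Real.log (1 + t ^ 2)) : ℝ) : ℂ) - u := by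
    push_cast
    field_simp
  rw [e1, Complex.exp_sub (((ρ * (σ * Real.log (1 + t ^ 2)) : ℝ) : ℂ)) u, ← Complex.ofReal_exp,
    Complex.exp_neg, add_sub_cancel, one_div,
    ← mul_inv, mul_sub, mul_one, mul_div_cancel₀ _ (Complex.exp_ne_zero u)]

end Remainder

section BranchRoot

/-- The principal square root of `1 - e^x`. -/
noncomputable def branchRoot (x : ℂ) : ℂ := Complex.sqrt (1 - Complex.exp x)

theorem branchRoot_sq (x : ℂ) : branchRoot x ^ 2 = 1 - Complex.exp x := by
  rw [branchRoot, Complex.sqrt]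
  exact Complex.cpow_ofNat_inv_pow _ 2

theorem branchRoot_re_nonneg (x : ℂ) : 0 ≤ (branchRoot x).re := by
  rw [branchRoot, Complex.sqrt, Complex.cpow_inv_two_re]
  exact Real.sqrt_nonneg _

theorem mem_slitPlane_one_sub_exp {x : ℂ} (hx : |x.im| ≤ Real.pi)
    (h : x.im ≠ 0 ∨ x.re < 0) : 1 - Complex.exp x ∈ Complex.slitPlane := by
  rw [Complex.mem_slitPlane_iff, Complex.sub_re, Complex.one_re, Complex.exp_re, Complex.sub_im,
    Complex.one_im, Complex.exp_im, zero_sub, neg_ne_zero]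
  rcases hx.lt_or_eq with hx | hx
  · obtain ⟨h1, h2⟩ := abs_lt.1 hx
    by_cases h0 : x.im = 0
    · left
      rw [h0, Real.cos_zero, mul_one, sub_pos]
      exact Real.exp_lt_one_iff.2 (h.resolve_left (not_not.2 h0))
    · right
      refine mul_ne_zero (Real.exp_ne_zero _) ?_
      rwa [Ne, Real.sin_eq_zero_iff_of_lt_of_lt h1 h2]
  · left
    rw [← Real.cos_abs, hx, Real.cos_pi]
    have := Real.exp_pos x.re
    linarith

theorem branchRoot_re_pos {x : ℂ} (hx : |x.im| ≤ Real.pi) (h : x.im ≠ 0 ∨ x.re < 0) :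
    0 < (branchRoot x).re := by
  refine lt_of_le_of_ne (branchRoot_re_nonneg x) fun h0 => ?_
  have h1 := mem_slitPlane_one_sub_exp hx h
  rw [← branchRoot_sq, Complex.mem_slitPlane_iff, sq, Complex.mul_re, Complex.mul_im, ← h0] at h1
  simp at h1
  nlinarith [sq_nonneg (branchRoot x).im]

theorem differentiableAt_branchRoot {x : ℂ} (hx : |x.im| ≤ Real.pi) (h : x.im ≠ 0 ∨ x.re < 0) :
    DifferentiableAt ℂ branchRoot x := by
  have := Complex.differentiableAt_sqrt (mem_slitPlane_one_sub_exp hx h)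
  exact this.comp x (by fun_prop)

theorem continuousAt_branchRoot_zero : ContinuousAt branchRoot 0 := by
  refine ContinuousAt.comp (g := Complex.sqrt) (f := fun x => 1 - Complex.exp x) ?_ (by fun_prop)
  exact Complex.continuousAt_sqrt (by simp)

theorem branchRoot_zero : branchRoot 0 = 0 := by
  simp [branchRoot]

theorem eq_of_sq_eq_sq_of_re {p q : ℂ} (h : p ^ 2 = q ^ 2) (hp : 0 < p.re) (hq : 0 < q.re) :
    p = q := by
  rcases sq_eq_sq_iff_eq_or_eq_neg.1 h with h | h
  · exact h
  · rw [h, Complex.neg_re] at hp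
    linarith

theorem exp_neg_half_sq (x : ℂ) : Complex.exp (-x / 2) ^ 2 = Complex.exp (-x) := by
  rw [← Complex.exp_nat_mul]
  congr 1
  push_cast
  ring

theorem branchRoot_im_mul_re {x : ℂ} :
    2 * (branchRoot x).re * (branchRoot x).im = -(Real.exp x.re * Real.sin x.im) := by
  have := congrArg Complex.im (branchRoot_sq x)
  rw [sq, Complex.mul_im, Complex.sub_im, Complex.one_im, Complex.exp_im] at this
  linarith

theorem branchRoot_neg_of_im_pos {x : ℂ} (h0 : 0 < x.im) (hpi : x.im < Real.pi) :
    branchRoot (-x) = Complex.I * Complex.exp (-x / 2) * branchRoot x := by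
  have habs : |x.im| < Real.pi := by rwa [abs_of_pos h0]
  refine eq_of_sq_eq_sq_of_re ?_
    (branchRoot_re_pos (by simpa using habs.le) (Or.inl (by simpa using h0.ne'))) ?_
  · rw [mul_pow, mul_pow, branchRoot_sq, branchRoot_sq, exp_neg_half_sq, Complex.I_sq, mul_sub,
      mul_assoc (-1) _ (Complex.exp x), ← Complex.exp_add]
    simp
    ring
  · have hre := branchRoot_re_pos habs.le (Or.inl h0.ne')
    have him : (branchRoot x).im < 0 := by
      have h1 := branchRoot_im_mul_re (x := x)
      have h2 : 0 < Real.exp x.re * Real.sin x.im :=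
        mul_pos (Real.exp_pos _) (Real.sin_pos_of_pos_of_lt_pi h0 hpi)
      by_contra h3
      push Not at h3
      nlinarith [mul_nonneg hre.le h3]
    have e : (-x / 2).im = -(x.im / 2) := by simp; ring
    have h3 : 0 < (Complex.exp (-x / 2)).re := by
      rw [Complex.exp_re, e, Real.cos_neg]
      exact mul_pos (Real.exp_pos _) (Real.cos_pos_of_mem_Ioo ⟨by linarith, by linarith⟩)
    have h4 : (Complex.exp (-x / 2)).im < 0 := by
      rw [Complex.exp_im, e, Real.sin_neg, mul_neg, neg_lt_zero]
      exact mul_pos (Real.exp_pos _) (Real.sin_pos_of_pos_of_lt_pi (by linarith) (by linarith))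
    rw [mul_assoc, Complex.I_mul_re, Complex.mul_im]
    nlinarith

/-- The boundary function `(q - 1) / (q + 1)` of the free positive stable law. -/
noncomputable def cayleyMap (q : ℂ) : ℂ := (q - 1) / (q + 1)

theorem one_add_sq_eq (q : ℂ) (t : ℝ) {x : ℂ} (hq : q ^ 2 = 1 - Complex.exp x)
    (hre : 0 < q.re) :
    1 / (1 - Complex.exp ((1 * Real.log (1 + t ^ 2) : ℝ) - x)) =
      (q ^ 2 - 1) / (q ^ 2 + (t : ℂ) ^ 2) := by
  have h0 : (0 : ℝ) < 1 + t ^ 2 := by positivity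
  have h1 := sq_add_sq_ne_zero hre t
  have h2 := Complex.exp_ne_zero x
  rw [one_mul, Complex.exp_sub, ← Complex.ofReal_exp, Real.exp_log h0]
  have h3 : 1 - ((1 + t ^ 2 : ℝ) : ℂ) / Complex.exp x = (q ^ 2 + (t : ℂ) ^ 2) / (q ^ 2 - 1) := by
    rw [hq]
    push_cast
    field_simp
    ring
  rw [h3, one_div_div]

theorem integral_resolvent_pos {q x : ℂ} (hq : q ^ 2 = 1 - Complex.exp x) (hre : 0 < q.re) :
    Integrable (fun t : ℝ => 1 / (1 - Complex.exp ((1 * Real.log (1 + t ^ 2) : ℝ) - x)))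
      baseMeasure ∧
    ∫ t, 1 / (1 - Complex.exp ((1 * Real.log (1 + t ^ 2) : ℝ) - x)) ∂baseMeasure =
      cayleyMap q := by
  simp only [one_add_sq_eq q _ hq hre]
  refine ⟨?_, integral_baseMeasure_resolvent hre⟩
  refine (integrable_const (‖q ^ 2 - 1‖ / q.re ^ 2)).mono' ?_ (Eventually.of_forall fun t => ?_)
  · exact (continuous_const.div (by fun_prop) (sq_add_sq_ne_zero hre)).aestronglyMeasurable
  · rw [norm_div]
    gcongr
    exact sq_re_le_norm_sq_add_sq hre t

theorem integral_resolvent_neg {q x : ℂ} (hq : q ^ 2 = 1 - Complex.exp (-x)) (hre : 0 < q.re) :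
    Integrable (fun t : ℝ => 1 / (1 - Complex.exp ((-1 * Real.log (1 + t ^ 2) : ℝ) - x)))
      baseMeasure ∧
    ∫ t, 1 / (1 - Complex.exp ((-1 * Real.log (1 + t ^ 2) : ℝ) - x)) ∂baseMeasure =
      1 - cayleyMap q := by
  obtain ⟨h1, h2⟩ := integral_resolvent_pos hq hre
  have h : ∀ t : ℝ, 1 / (1 - Complex.exp ((-1 * Real.log (1 + t ^ 2) : ℝ) - x)) =
      1 - 1 / (1 - Complex.exp ((1 * Real.log (1 + t ^ 2) : ℝ) - -x)) := by
    intro t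
    have e : ((-1 * Real.log (1 + t ^ 2) : ℝ) : ℂ) - x =
        -(((1 * Real.log (1 + t ^ 2) : ℝ) : ℂ) - -x) := by
      push_cast
      ring
    have h3 : 1 - Complex.exp (((1 * Real.log (1 + t ^ 2) : ℝ) : ℂ) - -x) ≠ 0 := by
      intro h0
      have h4 := one_add_sq_eq q t hq hre
      rw [h0, div_zero, eq_comm, div_eq_zero_iff] at h4
      rcases h4 with h4 | h4
      · rw [hq, sub_sub_cancel_left, neg_eq_zero] at h4
        exact Complex.exp_ne_zero _ h4
      · exact sq_add_sq_ne_zero hre t h4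
    rw [e, Complex.exp_neg]
    set E := Complex.exp (((1 * Real.log (1 + t ^ 2) : ℝ) : ℂ) - -x) with hE
    have hE0 : E ≠ 0 := Complex.exp_ne_zero _
    have h5 : E - 1 ≠ 0 := fun h => h3 (by rw [← neg_sub, h, neg_zero])
    have h6 : 1 - E⁻¹ = (E - 1) / E := by field_simp
    rw [h6]
    field_simp
    ring
  simp only [h]
  refine ⟨(integrable_const 1).sub h1, ?_⟩
  rw [integral_sub (integrable_const 1) h1, h2]
  simp

end BranchRoot

section LogTransform

variable {ρ σ : ℝ}

/-- The strip `|Im u| < π` slit along the half-line on which `e^u` meets the support. -/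
def slitStrip (σ : ℝ) : Set ℂ := {u | |u.im| < Real.pi ∧ (u.im ≠ 0 ∨ 0 < σ * u.re)}

theorem isOpen_slitStrip (σ : ℝ) : IsOpen (slitStrip σ) := by
  refine (isOpen_abs_im_lt _).inter (IsOpen.union ?_ ?_)
  · exact isOpen_ne.preimage Complex.continuous_im
  · exact isOpen_lt continuous_const (continuous_const.mul Complex.continuous_re)

/-- The continuation of `u ↦ G(e^u)` from `0 < Im u < π` across the slit, for positive powers. -/
noncomputable def logTransformPos (ρ : ℝ) (u : ℂ) : ℂ :=
  Complex.exp (-u) *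
    (cayleyMap (-Complex.I * (Complex.exp (u / ρ / 2) * branchRoot (-(u / ρ)))) / ρ +
      remainder ρ 1 u)

/-- The continuation of `u ↦ G(e^u)` from `0 < Im u < π` across the slit, for negative powers. -/
noncomputable def logTransformNeg (ρ : ℝ) (u : ℂ) : ℂ :=
  Complex.exp (-u) *
    ((1 - cayleyMap (Complex.I * (Complex.exp (-(u / ρ) / 2) * branchRoot (u / ρ)))) / ρ +
      remainder ρ (-1) u)

theorem abs_im_div_le (hρ : 1 ≤ ρ) (u : ℂ) : |(u / ρ).im| ≤ |u.im| := by
  have h0 : 0 < ρ := by linarith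
  rw [Complex.div_ofReal_im, abs_div, abs_of_pos h0]
  exact div_le_self (abs_nonneg _) hρ

theorem sq_exp_half_mul_branchRoot (x : ℂ) :
    (Complex.exp (x / 2) * branchRoot (-x)) ^ 2 = Complex.exp x - 1 := by
  have h := exp_neg_half_sq (-x)
  rw [neg_neg] at h
  rw [mul_pow, branchRoot_sq, h, mul_sub, ← Complex.exp_add]
  simp

theorem pos_denominator_ne_zero (x : ℂ) :
    -Complex.I * (Complex.exp (x / 2) * branchRoot (-x)) + 1 ≠ 0 := by
  intro h
  have h1 : (-Complex.I * (Complex.exp (x / 2) * branchRoot (-x))) ^ 2 = 1 := by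
    rw [eq_neg_of_add_eq_zero_left h]
    norm_num
  rw [mul_pow, sq_exp_half_mul_branchRoot, neg_sq, Complex.I_sq] at h1
  exact Complex.exp_ne_zero x (by linear_combination -h1)

theorem neg_denominator_ne_zero (x : ℂ) :
    Complex.I * (Complex.exp (-x / 2) * branchRoot x) + 1 ≠ 0 := by
  intro h
  have h1 : (Complex.I * (Complex.exp (-x / 2) * branchRoot (- -x))) ^ 2 = 1 := by
    rw [neg_neg, eq_neg_of_add_eq_zero_left h]
    norm_num
  rw [mul_pow, sq_exp_half_mul_branchRoot, Complex.I_sq] at h1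
  exact Complex.exp_ne_zero (-x) (by linear_combination -h1)

theorem differentiableAt_cayleyMap {q : ℂ} (h : q + 1 ≠ 0) : DifferentiableAt ℂ cayleyMap q := by
  unfold cayleyMap
  exact DifferentiableAt.div (by fun_prop) (by fun_prop) h

theorem differentiableAt_remainder (hρ : 1 ≤ ρ) {u : ℂ} (hu : |u.im| < 3 * Real.pi / 2) :
    DifferentiableAt ℂ (remainder ρ σ) u :=
  (differentiableOn_remainder hρ).differentiableAt ((isOpen_abs_im_lt _).mem_nhds hu)

theorem differentiableOn_logTransformPos (hρ : 1 ≤ ρ) :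
    DifferentiableOn ℂ (logTransformPos ρ) (slitStrip 1) := by
  rintro u ⟨hu, hu'⟩
  have h0 : 0 < ρ := by linarith
  have hpi := Real.pi_pos
  have hb : DifferentiableAt ℂ (fun u : ℂ => branchRoot (-(u / ρ))) u := by
    refine DifferentiableAt.comp (g := branchRoot) u (differentiableAt_branchRoot ?_ ?_)
      (by fun_prop)
    · rw [Complex.neg_im, abs_neg]
      exact ((abs_im_div_le hρ u).trans hu.le)
    · rw [Complex.neg_im, Complex.neg_re, Complex.div_ofReal_im, Complex.div_ofReal_re, neg_ne_zero,
        neg_lt_zero]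
      refine hu'.imp (fun h => div_ne_zero h h0.ne') fun h => ?_
      rw [one_mul] at h
      positivity
  have hc := (differentiableAt_cayleyMap (pos_denominator_ne_zero (u / ρ)))
  have hc' : DifferentiableAt ℂ (fun u : ℂ =>
      cayleyMap (-Complex.I * (Complex.exp (u / ρ / 2) * branchRoot (-(u / ρ))))) u :=
    DifferentiableAt.comp (g := cayleyMap)
      (f := fun u : ℂ => -Complex.I * (Complex.exp (u / ρ / 2) * branchRoot (-(u / ρ)))) u hc
      (by fun_prop)
  have hr := differentiableAt_remainder (σ := 1) hρ (show |u.im| < 3 * Real.pi / 2 by linarith)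
  unfold logTransformPos
  exact DifferentiableAt.differentiableWithinAt (by fun_prop)

theorem differentiableOn_logTransformNeg (hρ : 1 ≤ ρ) :
    DifferentiableOn ℂ (logTransformNeg ρ) (slitStrip (-1)) := by
  rintro u ⟨hu, hu'⟩
  have h0 : 0 < ρ := by linarith
  have hpi := Real.pi_pos
  have hb : DifferentiableAt ℂ (fun u : ℂ => branchRoot (u / ρ)) u := by
    refine DifferentiableAt.comp (g := branchRoot) u (differentiableAt_branchRoot ?_ ?_)
      (by fun_prop)
    · exact ((abs_im_div_le hρ u).trans hu.le)
    · rw [Complex.div_ofReal_im, Complex.div_ofReal_re]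
      refine hu'.imp (fun h => div_ne_zero h h0.ne') fun h => ?_
      exact div_neg_of_neg_of_pos (by linarith) h0
  have hc := (differentiableAt_cayleyMap (neg_denominator_ne_zero (u / ρ)))
  have hc' : DifferentiableAt ℂ (fun u : ℂ =>
      cayleyMap (Complex.I * (Complex.exp (-(u / ρ) / 2) * branchRoot (u / ρ)))) u :=
    DifferentiableAt.comp (g := cayleyMap)
      (f := fun u : ℂ => Complex.I * (Complex.exp (-(u / ρ) / 2) * branchRoot (u / ρ))) u hc
      (by fun_prop)
  have hr := differentiableAt_remainder (σ := -1) hρ (show |u.im| < 3 * Real.pi / 2 by linarith)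
  unfold logTransformNeg
  exact DifferentiableAt.differentiableWithinAt (by fun_prop)

theorem powTransform_one_exp (hρ : 1 ≤ ρ) {u : ℂ} (hu : |u.im| < Real.pi) (h0 : u.im ≠ 0) :
    powTransform ρ 1 (Complex.exp u) =
      Complex.exp (-u) * (cayleyMap (branchRoot (u / ρ)) / ρ + remainder ρ 1 u) := by
  have hρ0 : 0 < ρ := by linarith
  have hre : 0 < (branchRoot (u / ρ)).re := branchRoot_re_pos (((abs_im_div_le hρ u).trans hu.le))
    (Or.inl (by rw [Complex.div_ofReal_im]; exact div_ne_zero h0 hρ0.ne'))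
  obtain ⟨h1, h2⟩ := integral_resolvent_pos (branchRoot_sq (u / ρ)) hre
  rw [powTransform_exp hρ (by linarith [Real.pi_pos]) h0 h1, h2]

theorem powTransform_neg_one_exp (hρ : 1 ≤ ρ) {u : ℂ} (hu : |u.im| < Real.pi) (h0 : u.im ≠ 0) :
    powTransform ρ (-1) (Complex.exp u) =
      Complex.exp (-u) * ((1 - cayleyMap (branchRoot (-(u / ρ)))) / ρ + remainder ρ (-1) u) := by
  have hρ0 : 0 < ρ := by linarith
  have hre : 0 < (branchRoot (-(u / ρ))).re := by
    refine branchRoot_re_pos ?_ (Or.inl ?_)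
    · rw [Complex.neg_im, abs_neg]
      exact ((abs_im_div_le hρ u).trans hu.le)
    · rw [Complex.neg_im, Complex.div_ofReal_im, neg_ne_zero]
      exact div_ne_zero h0 hρ0.ne'
  obtain ⟨h1, h2⟩ := integral_resolvent_neg (branchRoot_sq (-(u / ρ))) hre
  rw [powTransform_exp hρ (by linarith [Real.pi_pos]) h0 h1, h2]

theorem exp_half_mul_exp_neg_half (x : ℂ) : Complex.exp (x / 2) * Complex.exp (-x / 2) = 1 := by
  rw [← Complex.exp_add, ← Complex.exp_zero]
  congr 1
  ring

theorem cayleyMap_neg {q x : ℂ} (hq : q ^ 2 = 1 - Complex.exp x) :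
    cayleyMap (-q) = cayleyMap q - 4 * Complex.exp (-x) * q := by
  have hx := Complex.exp_ne_zero x
  have h : (q - 1) * (q + 1) ≠ 0 := by
    rw [show (q - 1) * (q + 1) = -Complex.exp x by linear_combination hq]
    exact neg_ne_zero.2 hx
  have h1 := left_ne_zero_of_mul h
  have h2 := right_ne_zero_of_mul h
  have h3 : -q + 1 ≠ 0 := fun h => h1 (by linear_combination -h)
  rw [Complex.exp_neg, show Complex.exp x = -((q - 1) * (q + 1)) by linear_combination hq,
    cayleyMap, cayleyMap, show -q - 1 = -(q + 1) by ring, show -q + 1 = -(q - 1) by ring]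
  field_simp
  ring

theorem logTransformPos_upper (hρ : 1 ≤ ρ) {u : ℂ} (h0 : 0 < u.im) (h1 : u.im < Real.pi) :
    logTransformPos ρ u = powTransform ρ 1 (Complex.exp u) := by
  have hρ0 : 0 < ρ := by linarith
  rw [powTransform_one_exp hρ (by rwa [abs_of_pos h0]) h0.ne', logTransformPos,
    branchRoot_neg_of_im_pos]
  · congr 4
    linear_combination branchRoot (u / ρ) * exp_half_mul_exp_neg_half (u / ρ) -
      Complex.exp (u / ρ / 2) * Complex.exp (-(u / ρ) / 2) * branchRoot (u / ρ) *
        (Complex.I_sq)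
  · rw [Complex.div_ofReal_im]; positivity
  · rw [Complex.div_ofReal_im]
    exact (div_le_self h0.le hρ).trans_lt h1

theorem logTransformNeg_upper (hρ : 1 ≤ ρ) {u : ℂ} (h0 : 0 < u.im) (h1 : u.im < Real.pi) :
    logTransformNeg ρ u = powTransform ρ (-1) (Complex.exp u) := by
  have hρ0 : 0 < ρ := by linarith
  rw [powTransform_neg_one_exp hρ (by rwa [abs_of_pos h0]) h0.ne', logTransformNeg,
    branchRoot_neg_of_im_pos, mul_assoc]
  · rw [Complex.div_ofReal_im]; positivity
  · rw [Complex.div_ofReal_im]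
    exact (div_le_self h0.le hρ).trans_lt h1

theorem branchRoot_of_im_neg {x : ℂ} (h0 : x.im < 0) (hpi : -Real.pi < x.im) :
    branchRoot x = Complex.I * Complex.exp (x / 2) * branchRoot (-x) := by
  have := branchRoot_neg_of_im_pos (x := -x) (by simpa using h0) (by simp; linarith)
  simpa using this

theorem div_im_bounds (hρ : 1 ≤ ρ) {u : ℂ} (h0 : u.im < 0) (h1 : -Real.pi < u.im) :
    (u / ρ).im < 0 ∧ -Real.pi < (u / ρ).im := by
  have hρ0 : 0 < ρ := by linarith
  rw [Complex.div_ofReal_im]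
  refine ⟨div_neg_of_neg_of_pos h0 hρ0, ?_⟩
  rw [lt_div_iff₀ hρ0]
  nlinarith [Real.pi_pos]

theorem logTransformPos_lower (hρ : 1 ≤ ρ) {u : ℂ} (h0 : u.im < 0) (h1 : -Real.pi < u.im) :
    logTransformPos ρ u = powTransform ρ 1 (Complex.exp u) +
      -(4 / ρ) * Complex.exp (-u) * (Complex.exp (-(u / ρ)) * branchRoot (u / ρ)) := by
  have hρ0 : 0 < ρ := by linarith
  obtain ⟨h2, h3⟩ := div_im_bounds hρ h0 h1
  have hv := branchRoot_of_im_neg h2 h3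
  rw [powTransform_one_exp hρ (abs_lt.2 ⟨h1, by linarith [Real.pi_pos]⟩) h0.ne, logTransformPos,
    show -Complex.I * (Complex.exp (u / ρ / 2) * branchRoot (-(u / ρ))) = -branchRoot (u / ρ) by
      rw [hv]; ring, cayleyMap_neg (branchRoot_sq (u / ρ))]
  ring

theorem logTransformNeg_lower (hρ : 1 ≤ ρ) {u : ℂ} (h0 : u.im < 0) (h1 : -Real.pi < u.im) :
    logTransformNeg ρ u = powTransform ρ (-1) (Complex.exp u) +
      4 / ρ * Complex.exp (-u) * (Complex.exp (u / ρ) * branchRoot (-(u / ρ))) := by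
  have hρ0 : 0 < ρ := by linarith
  obtain ⟨h2, h3⟩ := div_im_bounds hρ h0 h1
  have hv := branchRoot_of_im_neg h2 h3
  have he := exp_half_mul_exp_neg_half (u / ρ)
  rw [powTransform_neg_one_exp hρ (abs_lt.2 ⟨h1, by linarith [Real.pi_pos]⟩) h0.ne,
    logTransformNeg,
    show Complex.I * (Complex.exp (-(u / ρ) / 2) * branchRoot (u / ρ)) = -branchRoot (-(u / ρ)) by
      rw [hv]
      linear_combination Complex.I ^ 2 * branchRoot (-(u / ρ)) * he +
        branchRoot (-(u / ρ)) * Complex.I_sq, cayleyMap_neg (branchRoot_sq (-(u / ρ))), neg_neg]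
  ring

end LogTransform

section PowTransform

variable {ρ σ : ℝ}

theorem continuous_powTransform_point (ρ σ : ℝ) :
    Continuous fun t : ℝ => (Real.exp (ρ * (σ * Real.log (1 + t ^ 2))) : ℂ) := by
  have := continuous_log_one_add_sq
  fun_prop

theorem aestronglyMeasurable_resolvent (z : ℂ) :
    AEStronglyMeasurable (fun t : ℝ => (z - (Real.exp (ρ * (σ * Real.log (1 + t ^ 2))) : ℂ))⁻¹)
      baseMeasure := by
  have := (continuous_powTransform_point ρ σ).measurable
  exact Measurable.aestronglyMeasurable (by fun_prop)

theorem abs_im_le_norm_sub_ofReal (z : ℂ) (x : ℝ) : |z.im| ≤ ‖z - (x : ℂ)‖ := by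
  simpa using Complex.abs_im_le_norm (z - (x : ℂ))

theorem differentiableAt_powTransform {z : ℂ} {ε : ℝ} (hε : 0 < ε)
    (h : ∀ t : ℝ, ε ≤ ‖z - (Real.exp (ρ * (σ * Real.log (1 + t ^ 2))) : ℂ)‖) :
    DifferentiableAt ℂ (powTransform ρ σ) z := by
  have hb : ∀ y ∈ Metric.ball z (ε / 2), ∀ t : ℝ,
      ε / 2 ≤ ‖y - (Real.exp (ρ * (σ * Real.log (1 + t ^ 2))) : ℂ)‖ := by
    intro y hy t
    have h1 := h t
    have h2 : ‖z - y‖ < ε / 2 := by rwa [← dist_eq_norm, dist_comm]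
    have h3 := norm_add_le (z - y) (y - (Real.exp (ρ * (σ * Real.log (1 + t ^ 2))) : ℂ))
    rw [sub_add_sub_cancel] at h3
    linarith
  refine DifferentiableOn.differentiableAt (s := Metric.ball z (ε / 2)) ?_
    (Metric.ball_mem_nhds _ (by positivity))
  refine differentiableOn_integral_of_locally_dominated Metric.isOpen_ball
    (fun y _ => aestronglyMeasurable_resolvent y) (fun t y hy => ?_) (fun y hy => ?_)
  · have := norm_pos_iff.1 ((half_pos hε).trans_le (hb y hy t))
    have hd : DifferentiableAt ℂ
        (fun y : ℂ => y - (Real.exp (ρ * (σ * Real.log (1 + t ^ 2))) : ℂ)) y := by fun_prop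
    exact (hd.fun_inv this).differentiableWithinAt
  · refine ⟨_, Metric.isOpen_ball.mem_nhds hy, fun _ => (ε / 2)⁻¹, integrable_const _,
      .of_forall fun t y' hy' => ?_⟩
    rw [norm_inv]
    exact inv_anti₀ (by positivity) (hb y' hy' t)

theorem differentiableAt_powTransform_of_im_ne_zero {z : ℂ} (h : z.im ≠ 0) :
    DifferentiableAt ℂ (powTransform ρ σ) z :=
  differentiableAt_powTransform (abs_pos.2 h) fun _ => abs_im_le_norm_sub_ofReal _ _

theorem powTransform_ofReal_im (x : ℝ) : (powTransform ρ σ x).im = 0 := by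
  have h : powTransform ρ σ x =
      ((∫ t, (x - Real.exp (ρ * (σ * Real.log (1 + t ^ 2))))⁻¹ ∂baseMeasure : ℝ) : ℂ) := by
    rw [powTransform, ← integral_complex_ofReal]
    push_cast
    rfl
  rw [h, Complex.ofReal_im]

theorem norm_powTransform_neg_one_le (hρ : 1 ≤ ρ) {z : ℂ} (hz : 1 < ‖z‖) :
    ‖powTransform ρ (-1) z‖ ≤ (‖z‖ - 1)⁻¹ := by
  have h1 : ∀ t : ℝ, ‖(z - (Real.exp (ρ * (-1 * Real.log (1 + t ^ 2))) : ℂ))⁻¹‖ ≤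
      (‖z‖ - 1)⁻¹ := by
    intro t
    rw [norm_inv]
    refine inv_anti₀ (by linarith) ?_
    have h2 := norm_sub_norm_le z (Real.exp (ρ * (-1 * Real.log (1 + t ^ 2))) : ℂ)
    rw [Complex.norm_real, Real.norm_of_nonneg (Real.exp_pos _).le] at h2
    have h3 : Real.exp (ρ * (-1 * Real.log (1 + t ^ 2))) ≤ 1 := by
      rw [Real.exp_le_one_iff]
      have : 0 ≤ Real.log (1 + t ^ 2) := Real.log_nonneg (by nlinarith)
      nlinarith
    linarith
  have h2 := norm_integral_le_of_norm_le_const (μ := baseMeasure) (.of_forall h1)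
  rwa [probReal_univ, mul_one] at h2

theorem tendsto_mul_powTransform :
    Tendsto (fun z => z * powTransform ρ σ z)
      (comap norm atTop ⊓ 𝓟 {z : ℂ | ‖z‖ ≤ 4 * z.im}) (𝓝 1) := by
  have h1 : ∀ z : ℂ, z * powTransform ρ σ z =
      ∫ t, z * (z - (Real.exp (ρ * (σ * Real.log (1 + t ^ 2))) : ℂ))⁻¹ ∂baseMeasure :=
    fun z => (integral_const_mul _ _).symm
  have h2 : (1 : ℂ) = ∫ _, 1 ∂baseMeasure := by simp
  simp only [h1]
  rw [h2]
  have hpos : ∀ᶠ z : ℂ in comap norm atTop ⊓ 𝓟 {z : ℂ | ‖z‖ ≤ 4 * z.im}, 0 < ‖z‖ :=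
    (tendsto_comap.mono_left inf_le_left).eventually_gt_atTop 0
  have hcone : ∀ᶠ z : ℂ in comap norm atTop ⊓ 𝓟 {z : ℂ | ‖z‖ ≤ 4 * z.im}, ‖z‖ ≤ 4 * z.im :=
    mem_inf_of_right (mem_principal_self _)
  refine tendsto_integral_filter_of_dominated_convergence (fun _ => 4)
    (.of_forall fun z => (aestronglyMeasurable_resolvent z).const_mul z) ?_ (integrable_const _)
    (.of_forall fun t => ?_)
  · filter_upwards [hpos, hcone] with z hz hc
    refine .of_forall fun t => ?_
    have h3 := abs_im_le_norm_sub_ofReal z (Real.exp (ρ * (σ * Real.log (1 + t ^ 2))))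
    have h4 := le_abs_self z.im
    rw [norm_mul, norm_inv, ← div_eq_mul_inv, div_le_iff₀ (by linarith)]
    linarith
  · have h5 : Tendsto (fun z : ℂ => z⁻¹) (comap norm atTop) (𝓝 0) := by
      rw [comap_norm_atTop]
      exact tendsto_inv₀_cobounded
    have h6 : Tendsto (fun z : ℂ => (1 - (Real.exp (ρ * (σ * Real.log (1 + t ^ 2))) : ℂ) * z⁻¹)⁻¹)
        (comap norm atTop) (𝓝 (1 - (Real.exp (ρ * (σ * Real.log (1 + t ^ 2))) : ℂ) * 0)⁻¹) :=
      ((h5.const_mul _).const_sub 1).inv₀ (by simp)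
    rw [mul_zero, sub_zero, inv_one] at h6
    refine (h6.mono_left inf_le_left).congr' ?_
    filter_upwards [hpos] with z hz
    have hz0 : z ≠ 0 := norm_pos_iff.1 hz
    rw [show (1 - (Real.exp (ρ * (σ * Real.log (1 + t ^ 2))) : ℂ) * z⁻¹) =
      z⁻¹ * (z - (Real.exp (ρ * (σ * Real.log (1 + t ^ 2))) : ℂ)) by field_simp, mul_inv, inv_inv]

theorem exists_powTransform_eq :
    ∃ δ : ℝ, 0 < δ ∧ ∀ w : ℂ, |w.re| < -w.im → -δ < w.im →
      ∃ z : ℂ, 0 < z.im ∧ powTransform ρ σ z = w := by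
  have h1 := (Metric.tendsto_nhds.1 (tendsto_mul_powTransform (ρ := ρ) (σ := σ)) (1 / 32)
    (by norm_num))
  rw [eventually_inf_principal, eventually_comap] at h1
  obtain ⟨R, hR⟩ := eventually_atTop.1 h1
  refine ⟨1 / (4 * (|R| + 1)), by positivity, fun w hw hδ => ?_⟩
  have hRp := abs_nonneg R
  have him : w.im < 0 := by linarith [abs_nonneg w.re]
  have hw0 : w ≠ 0 := by rintro rfl; simp at him
  have hnw : 0 < ‖w‖ := norm_pos_iff.2 hw0
  have hsq : ‖w‖ ^ 2 = w.re ^ 2 + w.im ^ 2 := by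
    rw [← Complex.normSq_eq_norm_sq, Complex.normSq_apply]; ring
  have hre : w.re ^ 2 < w.im ^ 2 := by
    rw [← neg_sq w.im, ← sq_abs w.re]
    gcongr
  have hle : ‖w‖ * 2 ≤ -w.im * 3 := abs_le_of_sq_le_sq' (by nlinarith) (by linarith) |>.2
  set z₀ := w⁻¹ with hz₀
  have hz₀0 : z₀ ≠ 0 := inv_ne_zero hw0
  have hnz : ‖z₀‖ * ‖w‖ = 1 := by rw [hz₀, norm_inv, inv_mul_cancel₀ hnw.ne']
  have hnzp : 0 < ‖z₀‖ := norm_pos_iff.2 hz₀0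
  have hzim : ‖z₀‖ * (2 / 3) ≤ z₀.im := by
    rw [hz₀, Complex.inv_im, Complex.normSq_eq_norm_sq, norm_inv, le_div_iff₀ (by positivity)]
    field_simp
    linarith
  have hbig : 2 * (|R| + 1) ≤ ‖z₀‖ := by
    have h2 : ‖w‖ < 1 / (2 * (|R| + 1)) := by
      have : (1 : ℝ) / (2 * (|R| + 1)) = 2 * (1 / (4 * (|R| + 1))) := by field_simp; norm_num
      rw [this]
      linarith
    rw [hz₀, norm_inv]
    rw [lt_div_iff₀ (by positivity)] at h2
    rw [le_inv_comm₀ (by positivity) hnw, ← one_div, le_div_iff₀ (by positivity)]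
    exact h2.le
  have hball : ∀ z ∈ Metric.closedBall z₀ (‖z₀‖ / 4),
      0 < z.im ∧ ‖z * powTransform ρ σ z - 1‖ < 1 / 32 := by
    intro z hz
    rw [Metric.mem_closedBall, dist_eq_norm] at hz
    have h3 := (Complex.abs_im_le_norm (z - z₀)).trans hz
    rw [Complex.sub_im] at h3
    have h4 := (abs_le.1 h3).1
    have h5 : ‖z‖ ≤ ‖z₀‖ * (5 / 4) := by
      have := norm_add_le (z - z₀) z₀
      rw [sub_add_cancel] at this
      linarith
    have h6 : ‖z₀‖ * (3 / 4) ≤ ‖z‖ := by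
      have := norm_sub_norm_le z₀ z
      rw [norm_sub_rev] at this
      linarith
    refine ⟨by linarith, ?_⟩
    rw [← dist_eq_norm]
    refine hR ‖z‖ ?_ z rfl (by rw [mem_ofPred_eq]; linarith)
    linarith [le_abs_self R]
  set f : ℂ → ℂ := fun z => z - z₀ * (z * powTransform ρ σ z) with hf
  have hdiff : DifferentiableOn ℂ f {z | 0 < z.im} := by
    intro z hz
    have := differentiableAt_powTransform_of_im_ne_zero (ρ := ρ) (σ := σ)
      (show z.im ≠ 0 from ne_of_gt hz)
    exact DifferentiableAt.differentiableWithinAt (by fun_prop)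
  have hsub : Metric.closedBall z₀ (‖z₀‖ / 4) ⊆ {z | 0 < z.im} := fun z hz => (hball z hz).1
  have hself := hball z₀ (Metric.mem_closedBall_self (by positivity))
  have hsphere : ∀ z ∈ Metric.sphere z₀ (‖z₀‖ / 4), ‖z₀‖ * (3 / 16) ≤ ‖f z - f z₀‖ := by
    intro z hz
    have h7 := (hball z (Metric.sphere_subset_closedBall hz)).2
    rw [mem_sphere_iff_norm] at hz
    have h8 : z - z₀ = (f z - f z₀) +
        z₀ * ((z * powTransform ρ σ z - 1) - (z₀ * powTransform ρ σ z₀ - 1)) := by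
      simp only [hf]; ring
    have h9 := norm_add_le (f z - f z₀)
      (z₀ * ((z * powTransform ρ σ z - 1) - (z₀ * powTransform ρ σ z₀ - 1)))
    rw [← h8, norm_mul, hz] at h9
    have h10 := norm_sub_le (z * powTransform ρ σ z - 1) (z₀ * powTransform ρ σ z₀ - 1)
    have h11 : ‖z * powTransform ρ σ z - 1 - (z₀ * powTransform ρ σ z₀ - 1)‖ ≤ 1 / 16 := by
      linarith [hself.2]
    nlinarith
  have hne : ∃ᶠ z in 𝓝 z₀, f z ≠ f z₀ := by
    intro hev
    simp only [not_not] at hev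
    have hopen : IsOpen {z : ℂ | 0 < z.im} := isOpen_lt continuous_const Complex.continuous_im
    have heq := (hdiff.analyticOnNhd hopen).eqOn_of_preconnected_of_eventuallyEq
      (analyticOnNhd_const (v := f z₀)) (convex_halfSpace_im_gt 0).isPreconnected hself.1 hev
    have hmem : z₀ + (‖z₀‖ / 4 : ℝ) ∈ Metric.sphere z₀ (‖z₀‖ / 4) := by
      rw [mem_sphere_iff_norm, add_sub_cancel_left, Complex.norm_real, Real.norm_of_nonneg]
      positivity
    have h12 := hsphere _ hmem
    rw [heq (hsub (Metric.sphere_subset_closedBall hmem)), sub_self, norm_zero] at h12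
    linarith
  have hcl : DiffContOnCl ℂ f (Metric.ball z₀ (‖z₀‖ / 4)) :=
    (hdiff.mono hsub).diffContOnCl_ball subset_rfl
  have himg := hcl.ball_subset_image_closedBall (by positivity) hsphere hne
  have h0 : (0 : ℂ) ∈ Metric.ball (f z₀) (‖z₀‖ * (3 / 16) / 2) := by
    rw [Metric.mem_ball, dist_comm, dist_zero_right]
    have h13 : f z₀ = -z₀ * (z₀ * powTransform ρ σ z₀ - 1) := by simp only [hf]; ring
    rw [h13, norm_mul, norm_neg]
    nlinarith [hself.2]
  obtain ⟨z, hz, hfz⟩ := himg h0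
  refine ⟨z, hsub hz, ?_⟩
  have hzne : z ≠ 0 := by
    rintro rfl
    simpa using hsub hz
  have h14 : z * (z₀ * powTransform ρ σ z) = z * 1 := by
    have : z - z₀ * (z * powTransform ρ σ z) = 0 := hfz
    linear_combination -this
  have h15 := mul_left_cancel₀ hzne h14
  rw [hz₀, inv_mul_eq_one₀ hw0] at h15
  exact h15.symm

end PowTransform

section Boundary

variable {ρ σ : ℝ} {g : ℂ → ℂ}

/-- The factor governing the jump between the two branches of the transform. -/
noncomputable def jumpFactor (y : ℂ) : ℂ := Complex.exp (-y) * branchRoot y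

theorem jumpFactor_im (y : ℂ) :
    2 * (branchRoot y).re * (jumpFactor y).im =
      -(Real.sin y.im * (Real.exp (-y.re) * (1 + (branchRoot y).re ^ 2 + (branchRoot y).im ^ 2)))
      := by
  have h1 := branchRoot_im_mul_re (x := y)
  have h2 : (branchRoot y).re ^ 2 - (branchRoot y).im ^ 2 =
      1 - Real.exp y.re * Real.cos y.im := by
    have := congrArg Complex.re (branchRoot_sq y)
    simpa [pow_two, Complex.exp_re] using this
  have h3 : Real.exp (-y.re) * Real.exp y.re = 1 := by rw [← Real.exp_add]; simp
  have h4 : (jumpFactor y).im = Real.exp (-y.re) *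
      (Real.cos y.im * (branchRoot y).im - Real.sin y.im * (branchRoot y).re) := by
    simp only [jumpFactor, Complex.mul_im, Complex.exp_re, Complex.exp_im, Complex.neg_re,
      Complex.neg_im, Real.cos_neg, Real.sin_neg]
    ring
  rw [h4]
  linear_combination Real.exp (-y.re) * Real.cos y.im * h1 -
    Real.exp (-y.re) * Real.sin y.im * h2

/-- `g` continues `u ↦ G(e^u)` from the upper half of the strip to the lower one by adding
the jump term, and is real at the branch point. -/
structure IsLogTransform (ρ σ : ℝ) (g : ℂ → ℂ) : Prop where
  sign : σ = 1 ∨ σ = -1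
  upper : ∀ u : ℂ, 0 < u.im → u.im < Real.pi → g u = powTransform ρ σ (Complex.exp u)
  lower : ∀ u : ℂ, u.im < 0 → -Real.pi < u.im → g u = powTransform ρ σ (Complex.exp u) +
    -(σ * (4 / ρ)) * Complex.exp (-u) * jumpFactor (σ * u / ρ)
  continuousAt_zero : ContinuousAt g 0
  zero_im : (g 0).im = 0

theorem pos_point_le (hρ : 1 ≤ ρ) (t : ℝ) : 1 ≤ Real.exp (ρ * (1 * Real.log (1 + t ^ 2))) := by
  rw [Real.one_le_exp_iff]
  have : 0 ≤ Real.log (1 + t ^ 2) := Real.log_nonneg (by nlinarith)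
  nlinarith

theorem neg_point_le (hρ : 1 ≤ ρ) (t : ℝ) : Real.exp (ρ * (-1 * Real.log (1 + t ^ 2))) ≤ 1 := by
  rw [Real.exp_le_one_iff]
  have : 0 ≤ Real.log (1 + t ^ 2) := Real.log_nonneg (by nlinarith)
  nlinarith

theorem exists_dist_point (hρ : 1 ≤ ρ) (hσ : σ = 1 ∨ σ = -1) {x : ℝ}
    (h : x ≤ 0 ∧ x ≠ 0 ∨ 0 < x ∧ σ * Real.log x < 0) :
    ∃ ε > 0, ∀ t : ℝ, ε ≤ ‖(x : ℂ) - (Real.exp (ρ * (σ * Real.log (1 + t ^ 2))) : ℂ)‖ := by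
  have hn : ∀ y : ℝ, ‖(x : ℂ) - (y : ℂ)‖ = |x - y| := fun y => by
    rw [← Complex.ofReal_sub, Complex.norm_real, Real.norm_eq_abs]
  simp only [hn]
  rcases h with ⟨hx, hx0⟩ | ⟨hx, hl⟩
  · refine ⟨-x, by linarith [lt_of_le_of_ne hx hx0], fun t => ?_⟩
    have := Real.exp_pos (ρ * (σ * Real.log (1 + t ^ 2)))
    rw [abs_of_nonpos (by linarith)]
    linarith
  · rcases hσ with rfl | rfl
    · have h1 : x < 1 := by
        rw [one_mul] at hl
        exact (Real.log_neg_iff hx).1 hl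
      refine ⟨1 - x, by linarith, fun t => ?_⟩
      have := pos_point_le hρ t
      rw [abs_of_nonpos (by linarith)]
      linarith
    · have h1 : 1 < x := (Real.log_pos_iff hx.le).1 (by linarith)
      refine ⟨x - 1, by linarith, fun t => ?_⟩
      have := neg_point_le hρ t
      rw [abs_of_nonneg (by linarith)]
      linarith

theorem continuousAt_jumpTerm (hρ : 1 ≤ ρ) (hσ : σ = 1 ∨ σ = -1) {u : ℂ}
    (hu : |u.im| ≤ Real.pi) (h : u.im ≠ 0 ∨ σ * u.re < 0) :
    ContinuousAt (fun u : ℂ => -(σ * (4 / ρ)) * Complex.exp (-u) * jumpFactor (σ * u / ρ)) u := by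
  have h0 : 0 < ρ := by linarith
  have hσ1 : |σ| = 1 := by rcases hσ with rfl | rfl <;> simp
  have hσ0 : σ ≠ 0 := by rcases hσ with rfl | rfl <;> simp
  have him : (σ * u / ρ : ℂ).im = σ * u.im / ρ := by
    rw [Complex.div_ofReal_im, Complex.im_ofReal_mul]
  have hre : (σ * u / ρ : ℂ).re = σ * u.re / ρ := by
    rw [Complex.div_ofReal_re, Complex.re_ofReal_mul]
  have hb : ContinuousAt branchRoot (σ * u / ρ) := by
    refine (differentiableAt_branchRoot ?_ ?_).continuousAt
    · rw [him, abs_div, abs_mul, hσ1, one_mul, abs_of_pos h0]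
      exact (div_le_self (abs_nonneg _) hρ).trans hu
    · rw [him, hre]
      exact h.imp (fun h => div_ne_zero (mul_ne_zero hσ0 h) h0.ne')
        fun h => div_neg_of_neg_of_pos h h0
  have hb' : ContinuousAt (fun u : ℂ => branchRoot (σ * u / ρ)) u :=
    ContinuousAt.comp (g := branchRoot) (f := fun u : ℂ => (σ * u / ρ : ℂ)) hb (by fun_prop)
  unfold jumpFactor
  fun_prop

theorem jumpTerm_im_nonneg (hρ : 1 ≤ ρ) (hσ : σ = 1 ∨ σ = -1) {u : ℂ}
    (h : u.im = -Real.pi ∨ u.im = 0 ∧ σ * u.re < 0) :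
    0 ≤ (-(σ * (4 / ρ)) * Complex.exp (-u) * jumpFactor (σ * u / ρ)).im := by
  have h0 : 0 < ρ := by linarith
  have hpi := Real.pi_pos
  have him : (σ * u / ρ : ℂ).im = σ * u.im / ρ := by
    rw [Complex.div_ofReal_im, Complex.im_ofReal_mul]
  have hre : (σ * u / ρ : ℂ).re = σ * u.re / ρ := by
    rw [Complex.div_ofReal_re, Complex.re_ofReal_mul]
  have hJ := jumpFactor_im (σ * u / ρ)
  rw [him] at hJ
  rcases h with h | ⟨h, h1⟩
  · have hq : 0 < (branchRoot (σ * u / ρ)).re := by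
      refine branchRoot_re_pos ?_ (Or.inl ?_)
      · rw [him, h, abs_div, abs_mul, abs_neg, abs_of_pos h0, abs_of_pos hpi]
        rcases hσ with rfl | rfl <;> simpa using div_le_self hpi.le hρ
      · rw [him, h]
        rcases hσ with rfl | rfl <;> simp [hpi.ne', h0.ne']
    have hexp : Complex.exp (-u) = ((-Real.exp (-u.re) : ℝ) : ℂ) := by
      apply Complex.ext
      · simp [Complex.exp_re, h]
      · simp [Complex.exp_im, h]
    have heq : -(σ * (4 / ρ)) * Complex.exp (-u) * jumpFactor (σ * u / ρ) =
        ((4 / ρ * Real.exp (-u.re) * σ : ℝ) : ℂ) * jumpFactor (σ * u / ρ) := by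
      rw [hexp]; push_cast; ring
    rw [heq, Complex.im_ofReal_mul, mul_assoc]
    refine mul_nonneg (by positivity) ?_
    have hs : 0 ≤ Real.sin (Real.pi / ρ) :=
      Real.sin_nonneg_of_nonneg_of_le_pi (by positivity) (div_le_self hpi.le hρ)
    have hsin : -(σ * Real.sin (σ * u.im / ρ)) = Real.sin (Real.pi / ρ) := by
      rw [h]
      rcases hσ with rfl | rfl
      · rw [one_mul, one_mul, neg_div, Real.sin_neg, neg_neg]
      · rw [neg_one_mul, neg_one_mul, neg_neg, neg_neg]
    have hP : 0 ≤ Real.exp (-(σ * u / ρ : ℂ).re) * (1 + (branchRoot (σ * u / ρ)).re ^ 2 +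
      (branchRoot (σ * u / ρ)).im ^ 2) := by positivity
    have hfin : 2 * (branchRoot (σ * u / ρ)).re * (σ * (jumpFactor (σ * u / ρ)).im) =
        Real.sin (Real.pi / ρ) * (Real.exp (-(σ * u / ρ : ℂ).re) *
          (1 + (branchRoot (σ * u / ρ)).re ^ 2 + (branchRoot (σ * u / ρ)).im ^ 2)) := by
      rw [← hsin]; linear_combination σ * hJ
    have : 0 ≤ 2 * (branchRoot (σ * u / ρ)).re * (σ * (jumpFactor (σ * u / ρ)).im) := by
      rw [hfin]; exact mul_nonneg hs hP
    exact nonneg_of_mul_nonneg_right this (by positivity)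
  · have hq : 0 < (branchRoot (σ * u / ρ)).re := by
      refine branchRoot_re_pos ?_ (Or.inr ?_)
      · rw [him, h]; simp [hpi.le]
      · rw [hre]; exact div_neg_of_neg_of_pos h1 h0
    have hj0 : (jumpFactor (σ * u / ρ)).im = 0 := by
      rw [h] at hJ
      simpa [hq.ne'] using hJ
    have hexp : Complex.exp (-u) = ((Real.exp (-u.re) : ℝ) : ℂ) := by
      apply Complex.ext
      · rw [Complex.exp_re, Complex.ofReal_re]; simp [h]
      · rw [Complex.exp_im, Complex.ofReal_im]; simp [h]
    have heq : -(σ * (4 / ρ)) * Complex.exp (-u) * jumpFactor (σ * u / ρ) =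
        ((-(σ * (4 / ρ)) * Real.exp (-u.re) : ℝ) : ℂ) * jumpFactor (σ * u / ρ) := by
      rw [hexp]; push_cast; ring
    rw [heq, Complex.im_ofReal_mul, hj0, mul_zero]

theorem ultrafilter_im_cases {𝓤 : Ultrafilter ℂ} (hD : slitStrip σ ∈ 𝓤) :
    {u : ℂ | 0 < u.im ∧ u.im < Real.pi} ∈ 𝓤 ∨ {u : ℂ | u.im < 0 ∧ -Real.pi < u.im} ∈ 𝓤 ∨
      {u : ℂ | u.im = 0 ∧ 0 < σ * u.re} ∈ 𝓤 := by
  rw [← Ultrafilter.union_mem_iff, ← Ultrafilter.union_mem_iff]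
  filter_upwards [hD] with u hu
  obtain ⟨h1, h2⟩ := hu
  obtain ⟨h3, h4⟩ := abs_lt.1 h1
  rcases lt_trichotomy u.im 0 with h | h | h
  · exact Or.inr (Or.inl ⟨h, h3⟩)
  · exact Or.inr (Or.inr ⟨h, h2.resolve_left (not_not.2 h)⟩)
  · exact Or.inl ⟨h, h4⟩

theorem IsLogTransform.of_le_nhds (h : IsLogTransform ρ σ g) (hρ : 1 ≤ ρ) {𝓤 : Ultrafilter ℂ}
    (hD : slitStrip σ ∈ 𝓤) {u₀ : ℂ} (hu₀ : ↑𝓤 ≤ 𝓝 u₀) :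
    u₀ ∈ slitStrip σ ∨ ∃ w : ℂ, 0 ≤ w.im ∧ Tendsto g 𝓤 (𝓝 w) := by
  have hpi := Real.pi_pos
  by_cases hmem : u₀ ∈ slitStrip σ
  · exact Or.inl hmem
  refine Or.inr ?_
  have hle : |u₀.im| ≤ Real.pi := by
    refine le_of_tendsto (((Complex.continuous_im.abs).tendsto u₀).mono_left hu₀) ?_
    filter_upwards [hD] with u hu using hu.1.le
  by_cases h0 : u₀ = 0
  · subst h0
    exact ⟨g 0, h.zero_im.ge, h.continuousAt_zero.tendsto.mono_left hu₀⟩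
  have hcase : |u₀.im| = Real.pi ∨ u₀.im = 0 ∧ σ * u₀.re < 0 := by
    by_contra! hcon
    apply hmem
    refine ⟨lt_of_le_of_ne hle hcon.1, ?_⟩
    by_contra! h2
    have h3 := hcon.2 h2.1
    have h4 : σ * u₀.re = 0 := le_antisymm h2.2 h3
    have hσ0 : σ ≠ 0 := by rcases h.sign with h | h <;> simp [h]
    exact h0 (Complex.ext ((mul_eq_zero.1 h4).resolve_left hσ0) h2.1)
  obtain ⟨x, hx, hxd⟩ : ∃ x : ℝ, Complex.exp u₀ = x ∧
      (x ≤ 0 ∧ x ≠ 0 ∨ 0 < x ∧ σ * Real.log x < 0) := by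
    rcases hcase with h1 | ⟨h1, h2⟩
    · refine ⟨-Real.exp u₀.re, ?_, Or.inl ⟨by linarith [Real.exp_pos u₀.re], by simp⟩⟩
      have hc : Real.cos u₀.im = -1 ∧ Real.sin u₀.im = 0 := by
        rcases eq_or_eq_neg_of_abs_eq h1 with h1 | h1 <;> simp [h1]
      apply Complex.ext <;> simp [Complex.exp_re, Complex.exp_im, hc.1, hc.2]
    · refine ⟨Real.exp u₀.re, ?_, Or.inr ⟨Real.exp_pos _, by rwa [Real.log_exp]⟩⟩
      apply Complex.ext
      · rw [Complex.exp_re, Complex.ofReal_re]; simp [h1]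
      · rw [Complex.exp_im, Complex.ofReal_im]; simp [h1]
  obtain ⟨ε, hε, hdist⟩ := exists_dist_point hρ h.sign hxd
  rw [← hx] at hdist
  have hG : Tendsto (fun u => powTransform ρ σ (Complex.exp u)) 𝓤
      (𝓝 (powTransform ρ σ (Complex.exp u₀))) :=
    (ContinuousAt.comp (g := powTransform ρ σ) (f := Complex.exp)
      (differentiableAt_powTransform hε hdist).continuousAt
      Complex.continuous_exp.continuousAt).tendsto.mono_left hu₀
  have hG0 : (powTransform ρ σ (Complex.exp u₀)).im = 0 := by rw [hx, powTransform_ofReal_im]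
  have him : Tendsto (fun u : ℂ => u.im) 𝓤 (𝓝 u₀.im) :=
    (Complex.continuous_im.tendsto u₀).mono_left hu₀
  have hre : Tendsto (fun u : ℂ => u.re) 𝓤 (𝓝 u₀.re) :=
    (Complex.continuous_re.tendsto u₀).mono_left hu₀
  rcases ultrafilter_im_cases hD with hU | hU | hU
  · refine ⟨_, hG0.ge, hG.congr' ?_⟩
    filter_upwards [hU] with u hu using (h.upper u hu.1 hu.2).symm
  · have him0 : u₀.im ≤ 0 := le_of_tendsto him (mem_of_superset hU fun u hu => hu.1.le)
    have hcase' : u₀.im = -Real.pi ∨ u₀.im = 0 ∧ σ * u₀.re < 0 := by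
      refine hcase.imp_left fun h1 => ?_
      rw [abs_of_nonpos him0] at h1
      linarith
    have hc' : u₀.im ≠ 0 ∨ σ * u₀.re < 0 := by
      rcases hcase' with h1 | h1
      · exact Or.inl (by rw [h1]; linarith)
      · exact Or.inr h1.2
    have hQ := (continuousAt_jumpTerm hρ h.sign hle hc').tendsto.mono_left hu₀
    refine ⟨_, ?_, (hG.add hQ).congr' ?_⟩
    · rw [Complex.add_im, hG0, zero_add]
      exact jumpTerm_im_nonneg hρ h.sign hcase'
    · filter_upwards [hU] with u hu using (h.lower u hu.1 hu.2).symm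
  · exfalso
    have h1 : u₀.im = 0 := by
      refine tendsto_nhds_unique him (tendsto_const_nhds.congr' ?_)
      filter_upwards [hU] with u hu using hu.1.symm
    have h2 : 0 ≤ σ * u₀.re :=
      ge_of_tendsto (hre.const_mul σ) (mem_of_superset hU fun u hu => hu.2.le)
    rcases hcase with h3 | h3
    · rw [h1, abs_zero] at h3; linarith
    · linarith [h3.2]

theorem ultrafilter_re_cases {𝓤 : Ultrafilter ℂ} {c : ℝ} (hD : {u : ℂ | |u.im| < c} ∈ 𝓤) :
    (∃ u₀ : ℂ, ↑𝓤 ≤ 𝓝 u₀) ∨ Tendsto Complex.re 𝓤 atTop ∨ Tendsto Complex.re 𝓤 atBot := by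
  by_cases h : ∃ M, {u : ℂ | |u.re| ≤ M} ∈ 𝓤
  · obtain ⟨M, hM⟩ := h
    refine Or.inl ?_
    have hK : Metric.closedBall (0 : ℂ) (M + c) ∈ 𝓤 := by
      filter_upwards [hM, hD] with u h1 h2
      rw [mem_closedBall_zero_iff]
      have h1' : |u.re| ≤ M := h1
      have h2' : |u.im| < c := h2
      linarith [Complex.norm_le_abs_re_add_abs_im u]
    obtain ⟨u₀, -, hu₀⟩ := isCompact_iff_ultrafilter_le_nhds'.1 (isCompact_closedBall _ _) 𝓤 hK
    exact ⟨u₀, hu₀⟩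
  · right
    push Not at h
    have h' : ∀ M : ℝ, {u : ℂ | M < |u.re|} ∈ 𝓤 := fun M => by
      have := Ultrafilter.compl_mem_iff_notMem.2 (h M)
      filter_upwards [this] with u hu using not_le.1 hu
    rcases 𝓤.mem_or_compl_mem {u : ℂ | 0 ≤ u.re} with hs | hs
    · refine Or.inl (tendsto_atTop.2 fun M => ?_)
      filter_upwards [h' M, hs] with u h1 h2
      have h1' : M < |u.re| := h1
      rw [abs_of_nonneg h2] at h1'
      exact h1'.le
    · refine Or.inr (tendsto_atBot.2 fun M => ?_)
      filter_upwards [h' (-M), hs] with u h1 h2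
      have h1' : -M < |u.re| := h1
      have h2' : u.re < 0 := not_le.1 h2
      rw [abs_of_neg h2'] at h1'
      linarith

end Boundary

section LeftEnd

variable {D : Set ℂ} {g : ℂ → ℂ} {a b β : ℝ} {c : ℂ}

/-- The end `Re u → -∞` of the horizontal strip `a < Im u < b`. -/
def leftEnd (a b : ℝ) : Filter ℂ := comap Complex.re atBot ⊓ 𝓟 {u | a < u.im ∧ u.im < b}

theorem le_leftEnd {𝓤 : Filter ℂ} (h1 : Tendsto Complex.re 𝓤 atBot)
    (h2 : {u : ℂ | a < u.im ∧ u.im < b} ∈ 𝓤) : 𝓤 ≤ leftEnd a b :=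
  le_inf (tendsto_iff_comap.1 h1) (le_principal_iff.2 h2)

theorem eventually_leftEnd {p : ℂ → Prop} (h : ∀ᶠ u in leftEnd a b, p u) :
    ∃ R : ℝ, ∀ u : ℂ, u.re < R → a < u.im → u.im < b → p u := by
  rw [leftEnd, eventually_inf_principal, eventually_comap] at h
  obtain ⟨R, hR⟩ := eventually_atBot.1 h
  exact ⟨R, fun u h1 h2 h3 => hR u.re h1.le u rfl ⟨h2, h3⟩⟩

/-- Along an ultrafilter on `D`, either there is a limit point in `D`, or `g` has a limit in the
closed upper half-plane, or one escapes through the left end. -/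
def EscapesLeft (D : Set ℂ) (g : ℂ → ℂ) (a b : ℝ) : Prop :=
  ∀ 𝓤 : Ultrafilter ℂ, D ∈ 𝓤 → (∃ u₀ ∈ D, ↑𝓤 ≤ 𝓝 u₀) ∨
    (∃ w : ℂ, 0 ≤ w.im ∧ Tendsto g 𝓤 (𝓝 w)) ∨
    (Tendsto Complex.re 𝓤 atBot ∧ {u : ℂ | a < u.im ∧ u.im < b} ∈ 𝓤)

theorem norm_exp_ofReal_mul (β : ℝ) (u : ℂ) : ‖Complex.exp (β * u)‖ = Real.exp (β * u.re) := by
  rw [Complex.norm_exp, Complex.re_ofReal_mul]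

theorem EscapesLeft.properOverLower (h : EscapesLeft D g a b) (hβ : 0 < β) (hc : c ≠ 0)
    (hC : Tendsto (fun u => g u * Complex.exp (β * u)) (leftEnd a b) (𝓝 c)) :
    ProperOverLower D g := by
  intro 𝓤 hD w hw hg
  rcases h 𝓤 hD with h1 | ⟨w', hw', h2⟩ | ⟨h3, h4⟩
  · exact h1
  · rw [tendsto_nhds_unique hg h2] at hw
    linarith
  · exfalso
    have h5 : Tendsto (fun u : ℂ => Complex.exp (β * u)) 𝓤 (𝓝 0) := by
      rw [tendsto_zero_iff_norm_tendsto_zero]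
      simp only [norm_exp_ofReal_mul]
      exact Real.tendsto_exp_atBot.comp (h3.const_mul_atBot hβ)
    have h6 := tendsto_nhds_unique (hg.mul h5) (hC.mono_left (le_leftEnd h3 h4))
    rw [mul_zero] at h6
    exact hc h6.symm

theorem EscapesLeft.tendsto_preimage (h : EscapesLeft D g a b) (hg : ContinuousOn g D)
    (hD : IsOpen D)
    (hC : Tendsto (fun u => g u * Complex.exp (β * u)) (leftEnd a b) (𝓝 c)) {y₀ : ℝ}
    (hy₀ : ∀ y ∈ Icc a b, Complex.exp (-(β * y * Complex.I)) * c = -Complex.I * ‖c‖ → y = y₀)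
    {𝓥 : Ultrafilter ℕ} (h𝓥 : (𝓥 : Filter ℕ) ≤ atTop) {s : ℕ → ℂ} (hs : ∀ n, s n ∈ D)
    (hgs : ∀ n, g (s n) = -Complex.I * (n + 1 : ℝ)) :
    Tendsto (fun n => (s n).re) 𝓥 atBot ∧ Tendsto (fun n => (s n).im) 𝓥 (𝓝 y₀) ∧
      ∀ᶠ n in (𝓥 : Filter ℕ), a < (s n).im ∧ (s n).im < b := by
  have hinf : Tendsto (fun n => ‖g (s n)‖) 𝓥 atTop := by
    have h1 : ∀ n : ℕ, ‖g (s n)‖ = n + 1 := fun n => by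
      rw [hgs, norm_mul, norm_neg, Complex.norm_I, one_mul, Complex.norm_real,
        Real.norm_of_nonneg (by positivity)]
    simp only [h1]
    exact (tendsto_atTop_add_const_right _ _ tendsto_natCast_atTop_atTop).mono_left h𝓥
  have hno : ∀ w, ¬ Tendsto (fun n => g (s n)) 𝓥 (𝓝 w) := fun w hw =>
    not_tendsto_nhds_of_tendsto_atTop hinf _ hw.norm
  rcases h (𝓥.map s) (Ultrafilter.mem_map.2 (univ_mem' hs)) with ⟨u₀, hu₀, h1⟩ | ⟨w, -, h2⟩ | ⟨h3, h4⟩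
  · exact absurd (((hg.continuousAt (hD.mem_nhds hu₀)).tendsto).comp h1) (hno _)
  · exact absurd (h2.comp (tendsto_map (f := s))) (hno _)
  have h3' : Tendsto (fun n => (s n).re) 𝓥 atBot := h3.comp (tendsto_map (f := s))
  have h4' : ∀ᶠ n in (𝓥 : Filter ℕ), a < (s n).im ∧ (s n).im < b := h4
  have hlim : Tendsto (fun n => g (s n) * Complex.exp (β * s n)) 𝓥 (𝓝 c) :=
    (hC.mono_left (le_leftEnd h3 h4)).comp (tendsto_map (f := s))
  obtain ⟨y, hy, hys⟩ := isCompact_iff_ultrafilter_le_nhds'.1 (isCompact_Icc (a := a) (b := b))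
    (𝓥.map fun n => (s n).im) (h4'.mono fun n hn => ⟨hn.1.le, hn.2.le⟩)
  have hys' : Tendsto (fun n => (s n).im) 𝓥 (𝓝 y) := hys
  have hprod : Tendsto (fun n => Complex.exp (-(β * (s n).im * Complex.I)) *
      (g (s n) * Complex.exp (β * s n))) 𝓥 (𝓝 (Complex.exp (-(β * y * Complex.I)) * c)) := by
    refine Tendsto.mul ?_ hlim
    have hcont : Continuous fun y : ℝ => Complex.exp (-(β * y * Complex.I)) := by fun_prop
    exact (hcont.tendsto y).comp hys'
  have hnorm : Tendsto (fun n => -Complex.I * (‖g (s n) * Complex.exp (β * s n)‖ : ℂ)) 𝓥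
      (𝓝 (-Complex.I * (‖c‖ : ℂ))) :=
    ((Complex.continuous_ofReal.tendsto _).comp hlim.norm).const_mul _
  have heq : ∀ n, Complex.exp (-(β * (s n).im * Complex.I)) * (g (s n) * Complex.exp (β * s n)) =
      -Complex.I * (‖g (s n) * Complex.exp (β * s n)‖ : ℂ) := by
    intro n
    have e1 : Complex.exp (-(β * (s n).im * Complex.I)) * Complex.exp (β * s n) =
        (Real.exp (β * (s n).re) : ℂ) := by
      rw [← Complex.exp_add, Complex.ofReal_exp]
      congr 1
      push_cast
      linear_combination -(β : ℂ) * Complex.re_add_im (s n)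
    have e2 : ‖g (s n) * Complex.exp (β * s n)‖ = (n + 1) * Real.exp (β * (s n).re) := by
      rw [norm_mul, norm_exp_ofReal_mul, hgs, norm_mul, norm_neg, Complex.norm_I, one_mul,
        Complex.norm_real, Real.norm_of_nonneg (by positivity)]
    rw [e2, mul_left_comm, e1, hgs]
    push_cast
    ring
  simp only [heq] at hprod
  have := hy₀ y hy (tendsto_nhds_unique hprod hnorm)
  exact ⟨h3', this ▸ hys', h4'⟩

theorem eq_of_exp_eq_of_abs_im_sub_lt {x y : ℂ} (h : Complex.exp x = Complex.exp y)
    (him : |x.im - y.im| < 2 * Real.pi) : x = y := by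
  have h1 : Complex.exp (x - y) = 1 := by
    rw [Complex.exp_sub, h, div_self (Complex.exp_ne_zero y)]
  exact sub_eq_zero.1 (exp_eq_one_of_abs_im_lt (by rwa [Complex.sub_im]) h1)

theorem exists_locally_injective_leftEnd (hβ : 0 < β) (hc : c ≠ 0)
    (hC : Tendsto (fun u => g u * Complex.exp (β * u)) (leftEnd a b) (𝓝 c))
    (hg : DifferentiableOn ℂ g D) (hD : IsOpen D)
    (hsub : ∀ u : ℂ, u.re < 0 → a < u.im → u.im < b → u ∈ D) {y₀ : ℝ} (hy₀ : y₀ ∈ Ioo a b) :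
    ∃ R r : ℝ, 0 < r ∧ ∀ u : ℂ, u.re < R → |u.im - y₀| < r → deriv g u ≠ 0 ∧
      ∀ v : ℂ, v.re < R → |v.im - y₀| < r → g u = g v → u = v := by
  obtain ⟨hay, hyb⟩ := hy₀
  obtain ⟨r, hr, hr1, hra, hrb, hrβ⟩ : ∃ r : ℝ, 0 < r ∧ r ≤ 1 ∧ a < y₀ - 2 * r ∧
      y₀ + 2 * r < b ∧ 2 * β * r ≤ 1 := by
    refine ⟨min (min 1 ((y₀ - a) / 3)) (min ((b - y₀) / 3) (1 / (2 * β))), ?_, ?_, ?_, ?_, ?_⟩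
    · have : 0 < y₀ - a := by linarith
      have : 0 < b - y₀ := by linarith
      positivity
    · exact (min_le_left _ _).trans (min_le_left _ _)
    · have := (min_le_left (min 1 ((y₀ - a) / 3)) (min ((b - y₀) / 3) (1 / (2 * β)))).trans
        (min_le_right _ _)
      linarith
    · have := (min_le_right (min 1 ((y₀ - a) / 3)) (min ((b - y₀) / 3) (1 / (2 * β)))).trans
        (min_le_left _ _)
      linarith
    · have := (min_le_right (min 1 ((y₀ - a) / 3)) (min ((b - y₀) / 3) (1 / (2 * β)))).trans
        (min_le_right _ _)
      rwa [le_div_iff₀ (by positivity), mul_comm] at this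
  set η : ℝ := min (1 / 2) (r * β / 4) with hη
  have hη0 : 0 < η := by positivity
  have hη1 : η ≤ 1 / 2 := min_le_left _ _
  have hη2 : η ≤ r * β / 4 := min_le_right _ _
  have hcn : 0 < ‖c‖ := norm_pos_iff.2 hc
  obtain ⟨R₀, hR₀⟩ := eventually_leftEnd
    (Metric.tendsto_nhds.1 hC (η * ‖c‖) (by positivity))
  set q : ℂ → ℂ := fun u => (g u * Complex.exp (β * u) - c) / c with hq
  set m : ℂ → ℂ := fun u => Complex.log (1 + q u) with hm
  set T : Set ℂ := {u | u.re < min R₀ 0 ∧ a < u.im ∧ u.im < b} with hT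
  have hqT : ∀ u ∈ T, ‖q u‖ ≤ η := by
    rintro u ⟨h1, h2, h3⟩
    have := hR₀ u (h1.trans_le (min_le_left _ _)) h2 h3
    rw [dist_eq_norm] at this
    rw [hq]
    simp only
    rw [norm_div, div_le_iff₀ hcn]
    exact this.le
  have hTD : T ⊆ D := fun u hu => hsub u (hu.1.trans_le (min_le_right _ _)) hu.2.1 hu.2.2
  have hslit : ∀ u ∈ T, 1 + q u ∈ Complex.slitPlane := fun u hu =>
    Complex.mem_slitPlane_of_norm_lt_one (by linarith [hqT u hu])
  have hmT : ∀ u ∈ T, ‖m u‖ ≤ 3 / 2 * η := fun u hu =>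
    (Complex.norm_log_one_add_half_le_self ((hqT u hu).trans hη1)).trans
      (by linarith [hqT u hu])
  have hmd : ∀ u ∈ T, DifferentiableAt ℂ m u := by
    intro u hu
    have h1 : DifferentiableAt ℂ g u := (hg.differentiableAt (hD.mem_nhds (hTD hu)))
    have h2 : DifferentiableAt ℂ (fun u => 1 + q u) u := by
      simp only [hq, div_eq_mul_inv]
      fun_prop
    exact h2.clog (hslit u hu)
  have hexp : ∀ u ∈ T, g u = c * Complex.exp (m u - β * u) := by
    intro u hu
    rw [Complex.exp_sub, hm]
    simp only
    rw [Complex.exp_log (Complex.slitPlane_ne_zero (hslit u hu)), hq]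
    have := Complex.exp_ne_zero (β * u)
    field_simp
    ring
  have hTo : IsOpen T := by
    refine (isOpen_lt Complex.continuous_re continuous_const).inter
      ((isOpen_lt continuous_const Complex.continuous_im).inter
        (isOpen_lt Complex.continuous_im continuous_const))
  set S : Set ℂ := {u | u.re < min R₀ 0 - r ∧ |u.im - y₀| < r} with hS
  have hST : ∀ u ∈ S, Metric.closedBall u r ⊆ T := by
    rintro u ⟨h1, h2⟩ v hv
    rw [Metric.mem_closedBall, dist_eq_norm] at hv
    have h3 := (Complex.abs_re_le_norm (v - u)).trans hv
    have h4 := (Complex.abs_im_le_norm (v - u)).trans hv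
    rw [Complex.sub_re, abs_le] at h3
    rw [Complex.sub_im, abs_le] at h4
    rw [abs_lt] at h2
    exact ⟨by linarith, by linarith, by linarith⟩
  have hSself : ∀ u ∈ S, u ∈ T := fun u hu => hST u hu (Metric.mem_closedBall_self hr.le)
  have hderiv : ∀ u ∈ S, ‖deriv m u‖ ≤ β / 2 := by
    intro u hu
    have h1 : DiffContOnCl ℂ m (Metric.ball u r) :=
      DifferentiableOn.diffContOnCl_ball (U := T)
        (fun v hv => (hmd v hv).differentiableWithinAt) (hST u hu)
    refine (Complex.norm_deriv_le_of_forall_mem_sphere_norm_le hr h1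
      (C := 3 / 2 * η) fun v hv => hmT v (hST u hu (Metric.sphere_subset_closedBall hv))).trans ?_
    rw [div_le_iff₀ hr]
    nlinarith
  have hSconv : Convex ℝ S := by
    have h1 : S = {u : ℂ | u.re < min R₀ 0 - r} ∩ ({u | y₀ - r < u.im} ∩ {u | u.im < y₀ + r}) := by
      ext u
      simp only [hS, mem_inter_iff, mem_ofPred_eq, abs_lt]
      constructor <;> rintro ⟨h1, h2, h3⟩ <;> exact ⟨h1, by linarith, by linarith⟩
    rw [h1]
    exact (convex_halfSpace_re_lt _).inter
      ((convex_halfSpace_im_gt _).inter (convex_halfSpace_im_lt _))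
  refine ⟨min R₀ 0 - r, r, hr, fun u h1 h2 => ⟨?_, fun v h3 h4 huv => ?_⟩⟩
  · have huS : u ∈ S := ⟨h1, h2⟩
    have hev : g =ᶠ[𝓝 u] fun u => c * Complex.exp (m u - β * u) :=
      Filter.eventually_of_mem (hTo.mem_nhds (hSself u huS)) hexp
    have hd : HasDerivAt (fun u => c * Complex.exp (m u - β * u))
        (c * (Complex.exp (m u - β * u) * (deriv m u - β * 1))) u :=
      (((hmd u (hSself u huS)).hasDerivAt.sub ((hasDerivAt_id' u).const_mul (β : ℂ))).cexp).const_mul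
        c
    rw [hev.deriv_eq, hd.deriv]
    refine mul_ne_zero hc (mul_ne_zero (Complex.exp_ne_zero _) fun h5 => ?_)
    have h6 := hderiv u huS
    rw [sub_eq_zero.1 h5, mul_one, Complex.norm_real, Real.norm_of_nonneg hβ.le] at h6
    linarith
  · have huS : u ∈ S := ⟨h1, h2⟩
    have hvS : v ∈ S := ⟨h3, h4⟩
    have huT := hSself u huS
    have hvT := hSself v hvS
    rw [hexp u huT, hexp v hvT] at huv
    have h5 := mul_left_cancel₀ hc huv
    have h6 : |(m u).im| ≤ 3 / 4 :=
      (Complex.abs_im_le_norm _).trans ((hmT u huT).trans (by linarith))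
    have h7 : |(m v).im| ≤ 3 / 4 :=
      (Complex.abs_im_le_norm _).trans ((hmT v hvT).trans (by linarith))
    have h8 : m u - β * u = m v - β * v := by
      refine eq_of_exp_eq_of_abs_im_sub_lt h5 ?_
      simp only [Complex.sub_im, Complex.im_ofReal_mul]
      have h9 : (m u).im - β * u.im - ((m v).im - β * v.im) =
          (m u).im - (m v).im - β * (u.im - y₀) + β * (v.im - y₀) := by ring
      rw [abs_lt] at h2 h4
      rw [abs_le] at h6 h7
      have := Real.pi_gt_three
      rw [h9, abs_lt]
      constructor <;> nlinarith
    have h10 := hSconv.norm_image_sub_le_of_norm_deriv_le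
      (fun x hx => hmd x (hSself x hx)) hderiv huS hvS
    have h11 : m v - m u = β * (v - u) := by linear_combination -h8
    rw [h11, norm_mul, Complex.norm_real, Real.norm_of_nonneg hβ.le] at h10
    have h12 : ‖v - u‖ = 0 := by
      have := norm_nonneg (v - u)
      nlinarith
    exact (sub_eq_zero.1 (norm_eq_zero.1 h12)).symm

theorem EscapesLeft.exists_simple_value (h : EscapesLeft D g a b) (hβ : 0 < β) (hc : c ≠ 0)
    (hC : Tendsto (fun u => g u * Complex.exp (β * u)) (leftEnd a b) (𝓝 c))
    (hg : DifferentiableOn ℂ g D) (hD : IsOpen D)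
    (hsub : ∀ u : ℂ, u.re < 0 → a < u.im → u.im < b → u ∈ D) {y₀ : ℝ} (hy₀ : y₀ ∈ Ioo a b)
    (huniq : ∀ y ∈ Icc a b, Complex.exp (-(β * y * Complex.I)) * c = -Complex.I * ‖c‖ → y = y₀) :
    ∃ w₀ : ℂ, w₀.im < 0 ∧ (∀ z ∈ D, ∀ z' ∈ D, g z = w₀ → g z' = w₀ → z = z') ∧
      ∀ z ∈ D, g z = w₀ → deriv g z ≠ 0 := by
  by_contra! hcon
  have hseq : ∀ n : ℕ, ∃ z ∈ D, ∃ z' ∈ D, g z = -Complex.I * (n + 1 : ℝ) ∧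
      g z' = -Complex.I * (n + 1 : ℝ) ∧ (deriv g z ≠ 0 → z ≠ z') := by
    intro n
    by_cases h1 : ∀ z ∈ D, ∀ z' ∈ D, g z = -Complex.I * (n + 1 : ℝ) →
        g z' = -Complex.I * (n + 1 : ℝ) → z = z'
    · obtain ⟨z, hz, h2, h3⟩ := hcon (-Complex.I * (n + 1 : ℝ)) (by
        simp only [neg_mul, Complex.neg_im, Complex.I_mul_im, Complex.ofReal_re]
        have : (0 : ℝ) ≤ n := n.cast_nonneg
        linarith) h1
      exact ⟨z, hz, z, hz, h2, h2, fun h4 => absurd h3 h4⟩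
    · push Not at h1
      obtain ⟨z, hz, z', hz', h2, h3, h4⟩ := h1
      exact ⟨z, hz, z', hz', h2, h3, fun _ => h4⟩
  choose z hz z' hz' hgz hgz' hne using hseq
  have h𝓥 : (hyperfilter ℕ : Filter ℕ) ≤ atTop := Nat.hyperfilter_le_atTop
  obtain ⟨p1, p2, -⟩ := h.tendsto_preimage hg.continuousOn hD hC huniq h𝓥 hz hgz
  obtain ⟨p1', p2', -⟩ := h.tendsto_preimage hg.continuousOn hD hC huniq h𝓥 hz' hgz'
  obtain ⟨R, r, hr, hRr⟩ := exists_locally_injective_leftEnd hβ hc hC hg hD hsub hy₀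
  obtain ⟨n, h1, h2, h3, h4⟩ := ((p1.eventually_lt_atBot R).and
    ((Metric.tendsto_nhds.1 p2 r hr).and ((p1'.eventually_lt_atBot R).and
      (Metric.tendsto_nhds.1 p2' r hr)))).exists
  rw [Real.dist_eq] at h2 h4
  obtain ⟨h5, h6⟩ := hRr (z n) h1 h2
  exact hne n h5 (h6 (z' n) h3 h4 ((hgz n).trans (hgz' n).symm))

end LeftEnd

section Positive

variable {ρ : ℝ}

theorem tendsto_branchRoot {ι : Type*} {l : Filter ι} {f : ι → ℂ}
    (h : Tendsto (fun i => (f i).re) l atBot) : Tendsto (fun i => branchRoot (f i)) l (𝓝 1) := by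
  have h1 : Tendsto (fun i => Complex.exp (f i)) l (𝓝 0) := Complex.tendsto_exp_nhds_zero_iff.2 h
  have h2 : ContinuousAt Complex.sqrt (1 - 0) := by
    rw [sub_zero]
    exact (Complex.hasDerivAt_sqrt Complex.one_mem_slitPlane).continuousAt
  have h3 := h2.tendsto.comp (h1.const_sub 1)
  rwa [sub_zero, Complex.sqrt_one] at h3

theorem isLogTransform_pos (hρ : 1 ≤ ρ) : IsLogTransform ρ 1 (logTransformPos ρ) where
  sign := Or.inl rfl
  upper u h0 h1 := logTransformPos_upper hρ h0 h1
  lower u h0 h1 := by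
    rw [logTransformPos_lower hρ h0 h1, jumpFactor, Complex.ofReal_one, one_mul, one_mul]
  continuousAt_zero := by
    have hb : ContinuousAt (fun u : ℂ => branchRoot (-(u / ρ))) 0 :=
      ContinuousAt.comp (g := branchRoot) (f := fun u : ℂ => -(u / ρ))
        (by simpa using continuousAt_branchRoot_zero) (by fun_prop)
    have hc : ContinuousAt (fun u : ℂ =>
        cayleyMap (-Complex.I * (Complex.exp (u / ρ / 2) * branchRoot (-(u / ρ))))) 0 :=
      ContinuousAt.comp (g := cayleyMap)
        (f := fun u : ℂ => -Complex.I * (Complex.exp (u / ρ / 2) * branchRoot (-(u / ρ))))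
        (differentiableAt_cayleyMap (pos_denominator_ne_zero _)).continuousAt (by fun_prop)
    have hr := (differentiableAt_remainder (u := 0) (σ := 1) hρ
      (by simpa using Real.pi_pos)).continuousAt
    unfold logTransformPos
    fun_prop
  zero_im := by
    have h := remainder_zero_im (σ := 1) hρ one_ne_zero
    simp [logTransformPos, branchRoot_zero, cayleyMap, h]

theorem isLogTransform_neg (hρ : 1 ≤ ρ) : IsLogTransform ρ (-1) (logTransformNeg ρ) where
  sign := Or.inr rfl
  upper u h0 h1 := logTransformNeg_upper hρ h0 h1
  lower u h0 h1 := by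
    rw [logTransformNeg_lower hρ h0 h1, jumpFactor, Complex.ofReal_neg, Complex.ofReal_one,
      neg_one_mul, neg_one_mul, neg_neg, neg_div, neg_neg]
  continuousAt_zero := by
    have hb : ContinuousAt (fun u : ℂ => branchRoot (u / ρ)) 0 :=
      ContinuousAt.comp (g := branchRoot) (f := fun u : ℂ => u / ρ)
        (by simpa using continuousAt_branchRoot_zero) (by fun_prop)
    have hc : ContinuousAt (fun u : ℂ =>
        cayleyMap (Complex.I * (Complex.exp (-(u / ρ) / 2) * branchRoot (u / ρ)))) 0 :=
      ContinuousAt.comp (g := cayleyMap)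
        (f := fun u : ℂ => Complex.I * (Complex.exp (-(u / ρ) / 2) * branchRoot (u / ρ)))
        (differentiableAt_cayleyMap (neg_denominator_ne_zero _)).continuousAt (by fun_prop)
    have hr := (differentiableAt_remainder (u := 0) (σ := -1) hρ
      (by simpa using Real.pi_pos)).continuousAt
    unfold logTransformNeg
    fun_prop
  zero_im := by
    have h := remainder_zero_im (σ := -1) hρ (by norm_num)
    simp [logTransformNeg, branchRoot_zero, cayleyMap, h]

theorem tendsto_powTransform_exp_left (hρ : 1 ≤ ρ) {l : Filter ℂ} (hl : Tendsto Complex.re l atBot) :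
    Tendsto (fun u => powTransform ρ 1 (Complex.exp u)) l (𝓝 (powTransform ρ 1 0)) := by
  refine ContinuousAt.tendsto (f := powTransform ρ 1) ?_ |>.comp
    (Complex.tendsto_exp_nhds_zero_iff.2 hl)
  refine (differentiableAt_powTransform one_pos fun t => ?_).continuousAt
  rw [zero_sub, norm_neg, Complex.norm_real, Real.norm_of_nonneg (Real.exp_pos _).le]
  exact pos_point_le hρ t

theorem ultrafilter_im_cases_of_re {σ : ℝ} {𝓤 : Ultrafilter ℂ} (hD : slitStrip σ ∈ 𝓤)
    (hre : ∀ᶠ u in (𝓤 : Filter ℂ), σ * u.re ≤ 0) :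
    {u : ℂ | 0 < u.im ∧ u.im < Real.pi} ∈ 𝓤 ∨ {u : ℂ | u.im < 0 ∧ -Real.pi < u.im} ∈ 𝓤 := by
  rcases ultrafilter_im_cases hD with h | h | h
  · exact Or.inl h
  · exact Or.inr h
  · obtain ⟨u, h1, h2⟩ := (hre.and h).exists
    exact absurd h2.2 h1.not_gt

theorem norm_cayleyMap_le {A : ℂ} (h : 2 ≤ ‖A‖) : ‖cayleyMap A‖ ≤ 3 := by
  have h1 := norm_sub_le A 1
  have h2 := norm_sub_norm_le A (-1)
  rw [norm_one] at h1
  rw [norm_neg, norm_one, sub_neg_eq_add] at h2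
  rw [cayleyMap, norm_div, div_le_iff₀ (by linarith)]
  linarith

theorem tendsto_logTransformPos_right (hρ : 1 ≤ ρ) {l : Filter ℂ}
    (hl : Tendsto Complex.re l atTop) (hD : slitStrip 1 ∈ l) :
    Tendsto (logTransformPos ρ) l (𝓝 0) := by
  have h0 : 0 < ρ := by linarith
  obtain ⟨C, hC⟩ := exists_norm_remainder_le (σ := 1) hρ
  have hlim : Tendsto (fun u : ℂ => Real.exp (-u.re) * (3 / ρ + C)) l (𝓝 0) := by
    have := (Real.tendsto_exp_atBot.comp (tendsto_neg_atTop_atBot.comp hl)).mul_const (3 / ρ + C)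
    rwa [zero_mul] at this
  refine squeeze_zero_norm' ?_ hlim
  filter_upwards [hD, hl.eventually_ge_atTop (ρ * 4)] with u hu hre
  rw [logTransformPos, norm_mul, Complex.norm_exp, Complex.neg_re]
  refine mul_le_mul_of_nonneg_left ((norm_add_le _ _).trans (add_le_add ?_ (hC u ?_)))
    (Real.exp_pos _).le
  · rw [norm_div, Complex.norm_real, Real.norm_of_nonneg h0.le]
    refine div_le_div_of_nonneg_right (norm_cayleyMap_le ?_) h0.le
    have h1 : ‖-Complex.I * (Complex.exp (u / ρ / 2) * branchRoot (-(u / ρ)))‖ ^ 2 =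
        ‖Complex.exp (u / ρ) - 1‖ := by
      rw [← norm_pow, mul_pow, sq_exp_half_mul_branchRoot, neg_sq, Complex.I_sq, norm_mul,
        norm_neg, norm_one, one_mul]
    have h2 := norm_sub_norm_le (Complex.exp (u / ρ)) 1
    rw [Complex.norm_exp, norm_one, Complex.div_ofReal_re] at h2
    have h3 : 4 ≤ u.re / ρ := by
      rw [le_div_iff₀ h0]; linarith
    have h4 := Real.add_one_le_exp (u.re / ρ)
    refine abs_le_of_sq_le_sq' (a := 2) ?_ (norm_nonneg _) |>.2
    rw [h1]
    linarith
  · linarith [hu.1, Real.pi_pos]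

theorem escapesLeft_pos (hρ : 1 ≤ ρ) :
    EscapesLeft (slitStrip 1) (logTransformPos ρ) (-Real.pi) 0 := by
  intro 𝓤 hD
  have hT := isLogTransform_pos hρ
  rcases ultrafilter_re_cases (mem_of_superset hD fun u hu => hu.1) with ⟨u₀, h⟩ | h | h
  · rcases hT.of_le_nhds hρ hD h with h1 | h1
    · exact Or.inl ⟨u₀, h1, h⟩
    · exact Or.inr (Or.inl h1)
  · exact Or.inr (Or.inl ⟨0, le_rfl, tendsto_logTransformPos_right hρ h hD⟩)
  · right
    rcases ultrafilter_im_cases_of_re hD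
      ((h.eventually_le_atBot 0).mono fun u hu => by rwa [one_mul]) with h1 | h1
    · refine Or.inl ⟨powTransform ρ 1 0, ?_, (tendsto_powTransform_exp_left hρ h).congr' ?_⟩
      · rw [← Complex.ofReal_zero, powTransform_ofReal_im]
      · filter_upwards [h1] with u hu using (hT.upper u hu.1 hu.2).symm
    · refine Or.inr ⟨h, ?_⟩
      filter_upwards [h1] with u hu using ⟨hu.2, hu.1⟩

theorem tendsto_re_leftEnd (a b : ℝ) : Tendsto Complex.re (leftEnd a b) atBot :=
  tendsto_comap.mono_left inf_le_left

theorem tendsto_leftEnd_pos (hρ : 1 ≤ ρ) :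
    Tendsto (fun u => logTransformPos ρ u * Complex.exp ((1 + 1 / ρ : ℝ) * u))
      (leftEnd (-Real.pi) 0) (𝓝 (-(4 / ρ : ℝ))) := by
  have h0 : 0 < ρ := by linarith
  have hl := tendsto_re_leftEnd (-Real.pi) 0
  have hv : Tendsto (fun u : ℂ => branchRoot (u / ρ)) (leftEnd (-Real.pi) 0) (𝓝 1) := by
    refine tendsto_branchRoot ?_
    simp only [Complex.div_ofReal_re]
    exact hl.atBot_div_const h0
  have he : Tendsto (fun u : ℂ => Complex.exp ((1 + 1 / ρ : ℝ) * u)) (leftEnd (-Real.pi) 0)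
      (𝓝 0) := by
    refine Complex.tendsto_exp_nhds_zero_iff.2 ?_
    simp only [Complex.re_ofReal_mul]
    exact hl.const_mul_atBot (by positivity)
  have h1 := ((tendsto_powTransform_exp_left hρ hl).mul he).add (hv.const_mul (-(4 / ρ : ℝ) : ℂ))
  rw [mul_zero, zero_add, mul_one] at h1
  refine h1.congr' ?_
  have hmem : ∀ᶠ u : ℂ in leftEnd (-Real.pi) 0, -Real.pi < u.im ∧ u.im < 0 :=
    mem_inf_of_right (mem_principal_self _)
  filter_upwards [hmem] with u hu
  rw [logTransformPos_lower hρ hu.2 hu.1]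
  have h2 : Complex.exp (-u) * Complex.exp (-(u / ρ)) * Complex.exp ((1 + 1 / ρ : ℝ) * u) = 1 := by
    rw [← Complex.exp_add, ← Complex.exp_add, ← Complex.exp_zero]
    congr 1
    push_cast
    ring
  push_cast at h2 ⊢
  linear_combination (4 / ρ) * branchRoot (u / ρ) * h2

theorem unique_angle_pos (hρ : 1 ≤ ρ) {y : ℝ} (hy : y ∈ Icc (-Real.pi) 0)
    (h : Complex.exp (-((1 + 1 / ρ : ℝ) * y * Complex.I)) * (-(4 / ρ : ℝ)) =
      -Complex.I * ‖(-(4 / ρ : ℝ) : ℂ)‖) : y = -Real.pi / (2 * (1 + 1 / ρ)) := by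
  have h0 : 0 < ρ := by linarith
  have hpi := Real.pi_pos
  have hβ1 : 1 < 1 + 1 / ρ := by
    have : 0 < 1 / ρ := by positivity
    linarith
  have hβ2 : 1 + 1 / ρ ≤ 2 := by
    have : 1 / ρ ≤ 1 := (div_le_one h0).2 hρ
    linarith
  set β := 1 + 1 / ρ
  have hc : ((4 / ρ : ℝ) : ℂ) ≠ 0 := by
    rw [Complex.ofReal_ne_zero]; positivity
  rw [norm_neg, Complex.norm_real, Real.norm_of_nonneg (by positivity)] at h
  have h1 : Complex.exp (-(β * y * Complex.I)) = Complex.exp (Real.pi / 2 * Complex.I) := by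
    rw [Complex.exp_pi_div_two_mul_I]
    exact mul_right_cancel₀ hc (by linear_combination -h)
  have h2 := eq_of_exp_eq_of_abs_im_sub_lt h1 (by
    simp only [Complex.neg_im, Complex.mul_im, Complex.I_re, Complex.I_im, Complex.ofReal_im,
      Complex.mul_re, Complex.ofReal_re]
    have e : (Real.pi / 2 : ℂ).re = Real.pi / 2 := by
      rw [← Complex.ofReal_ofNat, ← Complex.ofReal_div, Complex.ofReal_re]
    rw [e, abs_lt]
    obtain ⟨h3, h4⟩ := hy
    constructor <;> nlinarith)
  have h3 := congrArg Complex.im h2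
  simp only [Complex.neg_im, Complex.mul_im, Complex.I_re, Complex.I_im, Complex.ofReal_im,
      Complex.mul_re, Complex.ofReal_re] at h3
  have e : (Real.pi / 2 : ℂ).re = Real.pi / 2 := by
    rw [← Complex.ofReal_ofNat, ← Complex.ofReal_div, Complex.ofReal_re]
  rw [e] at h3
  rw [eq_div_iff (by positivity)]
  linarith

end Positive

section Negative

variable {ρ : ℝ}

/-- The integrand of the remainder term after the substitution `t = τ / ε`. -/
noncomputable def scaledIntegrand (ρ ε : ℝ) (u : ℂ) (τ : ℝ) : ℂ :=
  ((τ ^ 2 / (ε ^ 2 + τ ^ 2) ^ 2 : ℝ) : ℂ) *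
    powKernel ρ ((-Real.log (ε ^ 2 + τ ^ 2) : ℝ) - u / ρ)

/-- The remainder term after the substitution `t = τ / ε`. -/
noncomputable def scaledRemainder (ρ ε : ℝ) (u : ℂ) : ℂ :=
  ∫ τ in Ioi 0, scaledIntegrand ρ ε u τ

theorem div_sq_mul_min_le {τ s : ℝ} (hτ : 0 < τ) (hs : τ ^ 2 ≤ s) :
    τ ^ 2 / s ^ 2 * min 1 s ≤ 2 * (1 + τ ^ 2)⁻¹ := by
  have h0 : 0 < τ ^ 2 := by positivity
  have hs0 : 0 < s := h0.trans_le hs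
  rw [← div_eq_mul_inv, div_mul_eq_mul_div, div_le_div_iff₀ (by positivity) (by positivity)]
  rcases le_total s 1 with h | h
  · rw [min_eq_right h]
    nlinarith [mul_le_mul_of_nonneg_right hs hs0.le, mul_pos h0 hs0]
  · rw [min_eq_left h, mul_one]
    nlinarith

theorem exists_norm_scaledIntegrand_le (hρ : 1 ≤ ρ) :
    ∃ C : ℝ, ∀ (ε : ℝ) (u : ℂ) (τ : ℝ), 0 < τ → |u.im| < 3 * Real.pi / 2 →
      ‖scaledIntegrand ρ ε u τ‖ ≤ C * (1 + Real.exp (u.re / ρ)) * (1 + τ ^ 2)⁻¹ := by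
  obtain ⟨C, hC0, hC⟩ := exists_norm_powKernel_le hρ
  refine ⟨C * 2, fun ε u τ hτ hu => ?_⟩
  obtain ⟨h1, h2⟩ := hC _ (abs_im_sub_div_le hρ (-Real.log (ε ^ 2 + τ ^ 2)) hu.le)
  have hs : τ ^ 2 ≤ ε ^ 2 + τ ^ 2 := by nlinarith [sq_nonneg ε]
  have hs0 : 0 < ε ^ 2 + τ ^ 2 := by positivity
  rw [Complex.sub_re, Complex.ofReal_re, Complex.div_ofReal_re, neg_sub, sub_neg_eq_add,
    Real.exp_add, Real.exp_log hs0] at h2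
  have hE := Real.exp_pos (u.re / ρ)
  have h3 : ‖powKernel ρ ((-Real.log (ε ^ 2 + τ ^ 2) : ℝ) - u / ρ)‖ ≤
      C * (1 + Real.exp (u.re / ρ)) * min 1 (ε ^ 2 + τ ^ 2) := by
    rcases le_total (ε ^ 2 + τ ^ 2) 1 with h | h
    · rw [min_eq_right h]
      nlinarith [mul_pos hC0 hs0]
    · rw [min_eq_left h]
      nlinarith [mul_pos hC0 hE]
  rw [scaledIntegrand, norm_mul, Complex.norm_real, Real.norm_of_nonneg (by positivity)]
  have h4 := div_sq_mul_min_le hτ hs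
  calc τ ^ 2 / (ε ^ 2 + τ ^ 2) ^ 2 * ‖powKernel ρ ((-Real.log (ε ^ 2 + τ ^ 2) : ℝ) - u / ρ)‖
      ≤ τ ^ 2 / (ε ^ 2 + τ ^ 2) ^ 2 *
        (C * (1 + Real.exp (u.re / ρ)) * min 1 (ε ^ 2 + τ ^ 2)) := by gcongr
    _ = C * (1 + Real.exp (u.re / ρ)) *
        (τ ^ 2 / (ε ^ 2 + τ ^ 2) ^ 2 * min 1 (ε ^ 2 + τ ^ 2)) := by ring
    _ ≤ C * (1 + Real.exp (u.re / ρ)) * (2 * (1 + τ ^ 2)⁻¹) := by gcongr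
    _ = _ := by ring

theorem aestronglyMeasurable_scaledIntegrand (hρ : 1 ≤ ρ) (ε : ℝ) {u : ℂ}
    (hu : |u.im| < 3 * Real.pi / 2) :
    AEStronglyMeasurable (scaledIntegrand ρ ε u) (volume.restrict (Ioi 0)) := by
  refine ContinuousOn.aestronglyMeasurable ?_ measurableSet_Ioi
  have hlog : ContinuousOn (fun τ : ℝ => -Real.log (ε ^ 2 + τ ^ 2)) (Ioi 0) :=
    (ContinuousOn.log (by fun_prop) fun τ hτ => by
      have : 0 < τ := hτ
      positivity).neg
  have hk : ContinuousOn (fun τ : ℝ => powKernel ρ ((-Real.log (ε ^ 2 + τ ^ 2) : ℝ) - u / ρ))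
      (Ioi 0) := by
    refine (differentiableOn_powKernel hρ).continuousOn.comp ?_ fun τ _ => abs_im_sub_div_lt hρ _ hu
    exact (Complex.continuous_ofReal.comp_continuousOn hlog).sub continuousOn_const
  refine ContinuousOn.mul (Complex.continuous_ofReal.comp_continuousOn ?_) hk
  refine ContinuousOn.div (by fun_prop) (by fun_prop) fun τ hτ => ?_
  have : 0 < τ := hτ
  positivity

theorem integrableOn_inv_one_add_sq (C : ℝ) :
    Integrable (fun τ : ℝ => C * (1 + τ ^ 2)⁻¹) (volume.restrict (Ioi 0)) :=
  (integrable_inv_one_add_sq.const_mul C).restrict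

theorem integrable_scaledIntegrand (hρ : 1 ≤ ρ) (ε : ℝ) {u : ℂ}
    (hu : |u.im| < 3 * Real.pi / 2) :
    Integrable (scaledIntegrand ρ ε u) (volume.restrict (Ioi 0)) := by
  obtain ⟨C, hC⟩ := exists_norm_scaledIntegrand_le hρ
  refine (integrableOn_inv_one_add_sq (C * (1 + Real.exp (u.re / ρ)))).mono'
    (aestronglyMeasurable_scaledIntegrand hρ ε hu) ?_
  exact ae_restrict_of_forall_mem measurableSet_Ioi fun τ hτ => hC ε u τ hτ hu

theorem differentiableOn_scaledRemainder (hρ : 1 ≤ ρ) (ε : ℝ) :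
    DifferentiableOn ℂ (scaledRemainder ρ ε) {u | |u.im| < 3 * Real.pi / 2} := by
  have hρ0 : 0 < ρ := by linarith
  obtain ⟨C, hC⟩ := exists_norm_scaledIntegrand_le hρ
  have hC0 : 0 ≤ C := by
    have h := (norm_nonneg _).trans (hC 0 0 1 one_pos (by simpa using Real.pi_pos))
    by_contra! hneg
    have : C * (1 + Real.exp ((0 : ℂ).re / ρ)) * (1 + 1 ^ 2)⁻¹ < 0 :=
      mul_neg_of_neg_of_pos (mul_neg_of_neg_of_pos hneg (by positivity)) (by norm_num)
    linarith
  refine differentiableOn_integral_of_locally_dominated (isOpen_abs_im_lt _)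
    (fun u hu => aestronglyMeasurable_scaledIntegrand hρ ε hu) (fun τ => ?_) (fun u hu => ?_)
  · refine DifferentiableOn.const_mul ?_ _
    exact (differentiableOn_powKernel hρ).comp (by fun_prop)
      fun u hu => abs_im_sub_div_lt hρ _ hu
  · refine ⟨{v | |v.im| < 3 * Real.pi / 2} ∩ {v | v.re < u.re + 1},
      ((isOpen_abs_im_lt _).inter (isOpen_lt Complex.continuous_re continuous_const)).mem_nhds
        ⟨hu, lt_add_one u.re⟩,
      fun τ => C * (1 + Real.exp ((u.re + 1) / ρ)) * (1 + τ ^ 2)⁻¹,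
      integrableOn_inv_one_add_sq _,
      ae_restrict_of_forall_mem measurableSet_Ioi fun τ hτ v hv => ?_⟩
    refine (hC ε v τ hτ hv.1).trans ?_
    have : v.re ≤ u.re + 1 := hv.2.le
    change C * (1 + Real.exp (v.re / ρ)) * (1 + τ ^ 2)⁻¹ ≤
      C * (1 + Real.exp ((u.re + 1) / ρ)) * (1 + τ ^ 2)⁻¹
    gcongr

theorem scaledRemainder_add (hρ : 1 ≤ ρ) {ε : ℝ} (x : ℝ) (v : ℂ) :
    scaledRemainder ρ ε (x + v) =
      Real.exp (x / (2 * ρ)) * scaledRemainder ρ (ε * Real.exp (x / (2 * ρ))) v := by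
  have hρ0 : 0 < ρ := by linarith
  set b := Real.exp (x / (2 * ρ)) with hb
  have hb0 : 0 < b := Real.exp_pos _
  have h := integral_comp_mul_left_Ioi (scaledIntegrand ρ (ε * b) v) 0 hb0
  rw [mul_zero] at h
  have h2 : ∀ τ ∈ Ioi (0 : ℝ), scaledIntegrand ρ ε (x + v) τ =
      (b ^ 2 : ℝ) * scaledIntegrand ρ (ε * b) v (b * τ) := by
    intro τ hτ
    have hτ0 : 0 < τ := hτ
    have hs : 0 < ε ^ 2 + τ ^ 2 := by positivity
    have hlog : Real.log ((ε * b) ^ 2 + (b * τ) ^ 2) = x / ρ + Real.log (ε ^ 2 + τ ^ 2) := by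
      rw [show (ε * b) ^ 2 + (b * τ) ^ 2 = b ^ 2 * (ε ^ 2 + τ ^ 2) by ring,
        Real.log_mul (by positivity) hs.ne', Real.log_pow, hb, Real.log_exp]
      congr 1
      push_cast
      field_simp
    rw [scaledIntegrand, scaledIntegrand, hlog, ← mul_assoc, ← Complex.ofReal_mul]
    congr 2
    · rw [show (ε * b) ^ 2 + (b * τ) ^ 2 = b ^ 2 * (ε ^ 2 + τ ^ 2) by ring]
      field_simp
    · push_cast
      ring
  rw [scaledRemainder, setIntegral_congr_fun measurableSet_Ioi h2, integral_const_mul, h,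
    scaledRemainder, Complex.real_smul, ← mul_assoc, ← Complex.ofReal_mul]
  congr 2
  field_simp

theorem remainder_neg_one_eq (ρ : ℝ) (u : ℂ) :
    remainder ρ (-1) u = (4 / Real.pi : ℝ) * scaledRemainder ρ 1 u := by
  rw [remainder, integral_baseMeasure, scaledRemainder, ← integral_const_mul]
  congr 1
  ext t
  rw [scaledIntegrand, baseDensity, Complex.real_smul, Complex.ofReal_mul, mul_assoc, one_pow,
    neg_one_mul]

theorem scaledRemainder_zero_eq (hρ : 1 ≤ ρ) {u : ℂ} (hu : |u.im| < 3 * Real.pi / 2) :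
    scaledRemainder ρ 0 u = Complex.exp (u / (2 * ρ)) * scaledRemainder ρ 0 0 := by
  have hpi := Real.pi_pos
  have hopen := isOpen_abs_im_lt (3 * Real.pi / 2)
  have h0 : (0 : ℂ) ∈ {u : ℂ | |u.im| < 3 * Real.pi / 2} := by simpa using hpi
  have hpre : IsPreconnected {u : ℂ | |u.im| < 3 * Real.pi / 2} := by
    have : {u : ℂ | |u.im| < 3 * Real.pi / 2} =
        {u | -(3 * Real.pi / 2) < u.im} ∩ {u | u.im < 3 * Real.pi / 2} := by
      ext u; simp [abs_lt]
    rw [this]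
    exact ((convex_halfSpace_im_gt _).inter (convex_halfSpace_im_lt _)).isPreconnected
  have hR : AnalyticOnNhd ℂ (fun u : ℂ => Complex.exp (u / (2 * ρ)) * scaledRemainder ρ 0 0)
      {u : ℂ | |u.im| < 3 * Real.pi / 2} :=
    DifferentiableOn.analyticOnNhd (by fun_prop) hopen
  refine ((differentiableOn_scaledRemainder hρ 0).analyticOnNhd hopen
    ).eqOn_of_preconnected_of_frequently_eq hR hpre h0 ?_ hu
  have hmap : Tendsto (fun n : ℕ => ((1 / ((n : ℝ) + 1) : ℝ) : ℂ)) atTop (𝓝[≠] 0) := by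
    refine tendsto_nhdsWithin_iff.2 ⟨?_, .of_forall fun n => ?_⟩
    · have := (Complex.continuous_ofReal.tendsto 0).comp tendsto_one_div_add_atTop_nhds_zero_nat
      rwa [Complex.ofReal_zero] at this
    · simp only [mem_compl_iff, mem_singleton_iff, Complex.ofReal_eq_zero]
      positivity
  refine hmap.frequently (Frequently.of_forall fun n => ?_)
  have h := scaledRemainder_add (ε := 0) hρ (1 / ((n : ℝ) + 1)) 0
  rw [add_zero, zero_mul] at h
  rw [h]
  push_cast
  rfl

theorem scaledRemainder_zero_zero_im (hρ : 1 ≤ ρ) : (scaledRemainder ρ 0 0).im = 0 := by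
  rw [scaledRemainder, im_integral (integrable_scaledIntegrand hρ 0 (by simpa using Real.pi_pos))]
  refine integral_eq_zero_of_ae ?_
  have h1 : ∀ᵐ τ : ℝ ∂volume.restrict (Ioi 0), τ ≠ 1 :=
    ae_restrict_of_ae (compl_mem_ae_iff.2 (measure_singleton 1))
  filter_upwards [h1, ae_restrict_mem measurableSet_Ioi] with τ hτ hτ0
  have hτ0' : 0 < τ := hτ0
  have hlog : -Real.log (0 ^ 2 + τ ^ 2) ≠ 0 := by
    rw [zero_pow two_ne_zero, zero_add, Real.log_pow, neg_ne_zero]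
    exact mul_ne_zero (by norm_num) (Real.log_ne_zero_of_pos_of_ne_one hτ0' hτ)
  simp only [scaledIntegrand, zero_div, sub_zero, Complex.im_ofReal_mul, Pi.zero_apply]
  rw [powKernel_ofReal_im hρ hlog, mul_zero]

theorem tendsto_scaledRemainder (hρ : 1 ≤ ρ) {y₀ : ℝ} (hy₀ : |y₀| ≤ Real.pi) :
    Tendsto (fun p : ℝ × ℝ => scaledRemainder ρ p.1 (p.2 * Complex.I)) (𝓝 (0, y₀))
      (𝓝 (scaledRemainder ρ 0 (y₀ * Complex.I))) := by
  have hpi := Real.pi_pos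
  have hρ0 : 0 < ρ := by linarith
  obtain ⟨C, hC⟩ := exists_norm_scaledIntegrand_le hρ
  have him : ∀ y : ℝ, ((y : ℂ) * Complex.I).im = y := fun y => by simp
  have hre : ∀ y : ℝ, ((y : ℂ) * Complex.I).re = 0 := fun y => by simp
  have hy : ∀ᶠ p : ℝ × ℝ in 𝓝 (0, y₀), |p.2| < 3 * Real.pi / 2 := by
    have hc : Continuous fun p : ℝ × ℝ => |p.2| := by fun_prop
    exact hc.tendsto (0, y₀) |>.eventually_lt_const (by simp only; linarith)
  refine tendsto_integral_filter_of_dominated_convergence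
    (fun τ => C * (1 + Real.exp (0 / ρ)) * (1 + τ ^ 2)⁻¹) ?_ ?_
    (integrableOn_inv_one_add_sq _) (ae_restrict_of_forall_mem measurableSet_Ioi fun τ hτ => ?_)
  · filter_upwards [hy] with p hp
    exact aestronglyMeasurable_scaledIntegrand hρ _ (by rwa [him])
  · filter_upwards [hy] with p hp
    refine ae_restrict_of_forall_mem measurableSet_Ioi fun τ hτ => ?_
    have := hC p.1 (p.2 * Complex.I) τ hτ (by rwa [him])
    rwa [hre] at this
  · have hτ0 : 0 < τ := hτ
    have hs : (0 : ℝ) ^ 2 + τ ^ 2 ≠ 0 := by positivity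
    have hk : ContinuousAt (powKernel ρ)
        ((-Real.log (((0 : ℝ), y₀).1 ^ 2 + τ ^ 2) : ℝ) - (((0 : ℝ), y₀).2 : ℂ) * Complex.I / ρ) :=
      ((differentiableOn_powKernel hρ).differentiableAt ((isOpen_abs_im_lt _).mem_nhds
        (abs_im_sub_div_lt hρ _ (by rw [him]; simp only; linarith)))).continuousAt
    have hlog : ContinuousAt (fun p : ℝ × ℝ => Real.log (p.1 ^ 2 + τ ^ 2)) (0, y₀) :=
      ContinuousAt.log (by fun_prop) hs
    have h1 : ContinuousAt (fun p : ℝ × ℝ =>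
        powKernel ρ ((-Real.log (p.1 ^ 2 + τ ^ 2) : ℝ) - (p.2 : ℂ) * Complex.I / ρ)) (0, y₀) :=
      ContinuousAt.comp (g := powKernel ρ) (f := fun p : ℝ × ℝ =>
        ((-Real.log (p.1 ^ 2 + τ ^ 2) : ℝ) : ℂ) - (p.2 : ℂ) * Complex.I / ρ) hk (by fun_prop)
    have h2 : ContinuousAt (fun p : ℝ × ℝ => τ ^ 2 / (p.1 ^ 2 + τ ^ 2) ^ 2) (0, y₀) :=
      ContinuousAt.div (by fun_prop) (by fun_prop) (pow_ne_zero 2 hs)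
    have h3 : ContinuousAt (fun p : ℝ × ℝ => scaledIntegrand ρ p.1 (p.2 * Complex.I) τ) (0, y₀) := by
      unfold scaledIntegrand
      fun_prop
    exact h3

end Negative

section NegativeEnds

variable {ρ : ℝ}

theorem tendsto_exp_mul_remainder (hρ : 1 ≤ ρ) :
    Tendsto (fun u => Complex.exp (-(u / (2 * ρ))) * remainder ρ (-1) u)
      (leftEnd (-Real.pi) Real.pi) (𝓝 ((4 / Real.pi : ℝ) * scaledRemainder ρ 0 0)) := by
  have hρ0 : 0 < ρ := by linarith
  have hpi := Real.pi_pos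
  refine tendsto_iff_ultrafilter _ _ _ |>.2 fun 𝓤 h𝓤 => ?_
  have hmem : {u : ℂ | -Real.pi < u.im ∧ u.im < Real.pi} ∈ (𝓤 : Filter ℂ) :=
    h𝓤 (mem_inf_of_right (mem_principal_self _))
  have hre : Tendsto Complex.re 𝓤 atBot := (tendsto_re_leftEnd _ _).mono_left h𝓤
  obtain ⟨y₀, hy₀, him⟩ := isCompact_Icc.ultrafilter_le_nhds (𝓤.map Complex.im)
    (le_principal_iff.2 (Ultrafilter.mem_map.2 (mem_of_superset hmem fun u hu =>
      ⟨hu.1.le, hu.2.le⟩)))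
  replace him : Tendsto Complex.im 𝓤 (𝓝 y₀) := him
  have hε : Tendsto (fun u : ℂ => Real.exp (u.re / (2 * ρ))) 𝓤 (𝓝 0) :=
    Real.tendsto_exp_atBot.comp (hre.atBot_div_const (by positivity))
  have hS := (tendsto_scaledRemainder hρ (abs_le.2 hy₀)).comp (hε.prodMk_nhds him)
  have hexp : Tendsto (fun u : ℂ => Complex.exp (-(u.im * Complex.I / (2 * ρ)))) 𝓤
      (𝓝 (Complex.exp (-(y₀ * Complex.I / (2 * ρ))))) := by
    have hc : Continuous fun y : ℝ => Complex.exp (-(y * Complex.I / (2 * ρ))) := by fun_prop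
    exact (hc.tendsto y₀).comp him
  have h := hexp.mul (hS.const_mul ((4 / Real.pi : ℝ) : ℂ))
  have hlim : Complex.exp (-(y₀ * Complex.I / (2 * ρ))) *
      ((4 / Real.pi : ℝ) * scaledRemainder ρ 0 (y₀ * Complex.I)) =
      (4 / Real.pi : ℝ) * scaledRemainder ρ 0 0 := by
    rw [scaledRemainder_zero_eq hρ (u := y₀ * Complex.I)
      (by simpa using (abs_le.2 hy₀).trans_lt (by linarith)), Complex.exp_neg]
    field_simp [Complex.exp_ne_zero]
  rw [hlim] at h
  refine h.congr fun u => ?_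
  have h1 := scaledRemainder_add (ε := 1) hρ u.re (u.im * Complex.I)
  rw [Complex.re_add_im, one_mul] at h1
  have h2 : Complex.exp (-(u / (2 * ρ))) * Real.exp (u.re / (2 * ρ)) =
      Complex.exp (-(u.im * Complex.I / (2 * ρ))) := by
    rw [Complex.ofReal_exp, ← Complex.exp_add]
    congr 1
    nth_rewrite 1 [← Complex.re_add_im u]
    push_cast
    ring
  rw [remainder_neg_one_eq, h1, ← h2]
  simp only [Function.comp_apply]
  ring

/-- The coefficient governing the left end for negative powers. -/
noncomputable def leftCoeff (ρ : ℝ) : ℂ :=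
  (4 / Real.pi : ℝ) * scaledRemainder ρ 0 0 - (2 / ρ : ℝ) * Complex.I

theorem leftCoeff_im (hρ : 1 ≤ ρ) : (leftCoeff ρ).im = -(2 / ρ) := by
  rw [leftCoeff, Complex.sub_im, Complex.im_ofReal_mul, Complex.im_ofReal_mul,
    scaledRemainder_zero_zero_im hρ, Complex.I_im]
  ring

theorem leftCoeff_ne_zero (hρ : 1 ≤ ρ) : leftCoeff ρ ≠ 0 := by
  intro h
  have h1 := leftCoeff_im hρ
  have : 0 < 2 / ρ := by positivity
  rw [h, Complex.zero_im] at h1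
  linarith

theorem tendsto_leftEnd_neg (hρ : 1 ≤ ρ) :
    Tendsto (fun u => logTransformNeg ρ u * Complex.exp ((1 - 1 / (2 * ρ) : ℝ) * u))
      (leftEnd (-Real.pi) Real.pi) (𝓝 (leftCoeff ρ)) := by
  have hρ0 : 0 < ρ := by linarith
  have hρc : (ρ : ℂ) ≠ 0 := by exact_mod_cast hρ0.ne'
  have hl := tendsto_re_leftEnd (-Real.pi) Real.pi
  have hv : Tendsto (fun u : ℂ => branchRoot (u / ρ)) (leftEnd (-Real.pi) Real.pi) (𝓝 1) := by
    refine tendsto_branchRoot ?_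
    simp only [Complex.div_ofReal_re]
    exact hl.atBot_div_const hρ0
  have he : Tendsto (fun u : ℂ => Complex.exp (u / ρ / 2)) (leftEnd (-Real.pi) Real.pi) (𝓝 0) := by
    refine Complex.tendsto_exp_nhds_zero_iff.2 ?_
    simp only [Complex.div_ofReal_re, Complex.div_ofNat_re]
    exact (hl.atBot_div_const hρ0).atBot_div_const two_pos
  have h1 := (((hv.const_mul Complex.I).add he).inv₀ (by simp)).const_mul (2 / ρ : ℂ)
  have h2 := (tendsto_exp_mul_remainder hρ).add h1
  have hlim : (4 / Real.pi : ℝ) * scaledRemainder ρ 0 0 + 2 / ρ * (Complex.I * 1 + 0)⁻¹ =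
      leftCoeff ρ := by
    rw [leftCoeff, mul_one, add_zero, Complex.inv_I]
    push_cast
    ring
  rw [hlim] at h2
  refine h2.congr fun u => ?_
  have hne := neg_denominator_ne_zero (u / ρ)
  have hE := Complex.exp_ne_zero (u / ρ / 2)
  have h3 : Complex.exp (-u) * Complex.exp ((1 - 1 / (2 * ρ) : ℝ) * u) =
      Complex.exp (-(u / (2 * ρ))) := by
    rw [← Complex.exp_add]
    congr 1
    push_cast
    ring
  have h4 : Complex.exp (-(u / (2 * ρ))) = (Complex.exp (u / ρ / 2))⁻¹ := by
    rw [← Complex.exp_neg]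
    congr 1
    field_simp
  have h5 : Complex.exp (-(u / ρ) / 2) = (Complex.exp (u / ρ / 2))⁻¹ := by
    rw [← Complex.exp_neg, neg_div]
  have h6 : Complex.I * branchRoot (u / ρ) + Complex.exp (u / ρ / 2) =
      Complex.exp (u / ρ / 2) *
        (Complex.I * (Complex.exp (-(u / ρ) / 2) * branchRoot (u / ρ)) + 1) := by
    rw [h5]
    field_simp
  have h7 : 1 - cayleyMap (Complex.I * (Complex.exp (-(u / ρ) / 2) * branchRoot (u / ρ))) =
      2 * (Complex.I * (Complex.exp (-(u / ρ) / 2) * branchRoot (u / ρ)) + 1)⁻¹ := by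
    rw [cayleyMap, ← div_eq_mul_inv, eq_div_iff hne, sub_mul, div_mul_cancel₀ _ hne]
    ring
  rw [h6, mul_inv, ← h4, logTransformNeg, h7, mul_right_comm, h3]
  ring

theorem tendsto_powTransform_neg_right (hρ : 1 ≤ ρ) {l : Filter ℂ}
    (hl : Tendsto Complex.re l atTop) :
    Tendsto (fun u => powTransform ρ (-1) (Complex.exp u)) l (𝓝 0) := by
  have h1 : Tendsto (fun u : ℂ => Real.exp u.re - 1) l atTop :=
    tendsto_atTop_add_const_right _ _ (Real.tendsto_exp_atTop.comp hl)
  refine squeeze_zero_norm' ?_ h1.inv_tendsto_atTop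
  filter_upwards [hl.eventually_gt_atTop 0] with u hu
  have := norm_powTransform_neg_one_le hρ (z := Complex.exp u)
    (by rw [Complex.norm_exp]; exact Real.one_lt_exp_iff.2 hu)
  rwa [Complex.norm_exp] at this

theorem exists_tendsto_jump_right (hρ : 1 ≤ ρ) {l : Filter ℂ} (hl : Tendsto Complex.re l atTop) :
    ∃ w : ℂ, 0 ≤ w.im ∧ Tendsto (fun u => 4 / ρ * Complex.exp (-u) *
      (Complex.exp (u / ρ) * branchRoot (-(u / ρ)))) l (𝓝 w) := by
  have hρ0 : 0 < ρ := by linarith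
  have hv : Tendsto (fun u : ℂ => branchRoot (-(u / ρ))) l (𝓝 1) := by
    refine tendsto_branchRoot ?_
    simp only [Complex.neg_re, Complex.div_ofReal_re]
    exact tendsto_neg_atTop_atBot.comp (hl.atTop_div_const hρ0)
  rcases hρ.eq_or_lt with rfl | h
  · refine ⟨4 * 1, by simp, (hv.const_mul 4).congr fun u => ?_⟩
    have : Complex.exp (-u) * Complex.exp u = 1 := by rw [← Complex.exp_add]; simp
    rw [Complex.ofReal_one, div_one, div_one]
    linear_combination -4 * branchRoot (-u) * this
  · have he : Tendsto (fun u : ℂ => Complex.exp ((-(1 - 1 / ρ) : ℝ) * u)) l (𝓝 0) := by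
      refine Complex.tendsto_exp_nhds_zero_iff.2 ?_
      simp only [Complex.re_ofReal_mul]
      have : 1 / ρ < 1 := (div_lt_one hρ0).2 h
      exact hl.const_mul_atTop_of_neg (by linarith)
    refine ⟨0, le_rfl, ?_⟩
    have h1 := (he.mul hv).const_mul (4 / ρ : ℂ)
    rw [zero_mul, mul_zero] at h1
    refine h1.congr fun u => ?_
    have h2 : Complex.exp (-u) * Complex.exp (u / ρ) =
        Complex.exp ((-(1 - 1 / ρ) : ℝ) * u) := by
      rw [← Complex.exp_add]
      congr 1
      push_cast
      ring
    rw [← h2]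
    ring

theorem escapesLeft_neg (hρ : 1 ≤ ρ) :
    EscapesLeft (slitStrip (-1)) (logTransformNeg ρ) (-Real.pi) Real.pi := by
  intro 𝓤 hD
  have hT := isLogTransform_neg hρ
  rcases ultrafilter_re_cases (mem_of_superset hD fun u hu => hu.1) with ⟨u₀, h⟩ | h | h
  · rcases hT.of_le_nhds hρ hD h with h1 | h1
    · exact Or.inl ⟨u₀, h1, h⟩
    · exact Or.inr (Or.inl h1)
  · right
    left
    have h0 := tendsto_powTransform_neg_right hρ h
    rcases ultrafilter_im_cases_of_re hD
      ((h.eventually_ge_atTop 0).mono fun u hu => by linarith) with h1 | h1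
    · refine ⟨0, le_rfl, h0.congr' ?_⟩
      filter_upwards [h1] with u hu using (hT.upper u hu.1 hu.2).symm
    · obtain ⟨w, hw, h2⟩ := exists_tendsto_jump_right hρ h
      refine ⟨0 + w, by rwa [zero_add], (h0.add h2).congr' ?_⟩
      filter_upwards [h1] with u hu using (logTransformNeg_lower hρ hu.1 hu.2).symm
  · refine Or.inr (Or.inr ⟨h, mem_of_superset hD fun u hu => abs_lt.1 hu.1⟩)

/-- The direction along which the preimage of the negative imaginary axis escapes. -/
noncomputable def leftAngle (ρ : ℝ) : ℝ :=
  Complex.arg (Complex.I * leftCoeff ρ) / (1 - 1 / (2 * ρ))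

theorem half_le_exponent (hρ : 1 ≤ ρ) : 1 / 2 ≤ 1 - 1 / (2 * ρ) := by
  have : 1 / (2 * ρ) ≤ 1 / 2 := one_div_le_one_div_of_le two_pos (by linarith)
  linarith

theorem leftAngle_mem (hρ : 1 ≤ ρ) : leftAngle ρ ∈ Ioo (-Real.pi) Real.pi := by
  have hβ := half_le_exponent hρ
  have hpi := Real.pi_pos
  have h1 : |Complex.arg (Complex.I * leftCoeff ρ)| < Real.pi / 2 := by
    refine Complex.abs_arg_lt_pi_div_two_iff.2 (Or.inl ?_)
    rw [Complex.I_mul_re, leftCoeff_im hρ, neg_neg]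
    positivity
  rw [mem_Ioo, ← abs_lt, leftAngle, abs_div, abs_of_pos (by linarith : 0 < 1 - 1 / (2 * ρ)),
    div_lt_iff₀ (by linarith)]
  nlinarith

theorem unique_angle_neg (hρ : 1 ≤ ρ) {y : ℝ} (hy : y ∈ Icc (-Real.pi) Real.pi)
    (h : Complex.exp (-((1 - 1 / (2 * ρ) : ℝ) * y * Complex.I)) * leftCoeff ρ =
      -Complex.I * ‖leftCoeff ρ‖) : y = leftAngle ρ := by
  have hβ := half_le_exponent hρ
  have hβ1 : 1 - 1 / (2 * ρ) < 1 := by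
    have : 0 < 1 / (2 * ρ) := by positivity
    linarith
  have hpi := Real.pi_pos
  rw [leftAngle, eq_div_iff (by linarith)]
  set β := 1 - 1 / (2 * ρ)
  have h1 : Complex.I * leftCoeff ρ =
      ‖leftCoeff ρ‖ * Complex.exp ((y * β : ℝ) * Complex.I) := by
    have e : Complex.exp ((y * β : ℝ) * Complex.I) * Complex.exp (-(β * y * Complex.I)) = 1 := by
      rw [← Complex.exp_add, ← Complex.exp_zero]
      congr 1
      push_cast
      ring
    linear_combination Complex.I * Complex.exp ((y * β : ℝ) * Complex.I) * h -
      Complex.I * leftCoeff ρ * e -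
      ‖leftCoeff ρ‖ * Complex.exp ((y * β : ℝ) * Complex.I) * Complex.I_sq
  have h2 : 0 < ‖leftCoeff ρ‖ := norm_pos_iff.2 (leftCoeff_ne_zero hρ)
  rw [h1, Complex.arg_real_mul _ h2, Complex.arg_exp_mul_I,
    (toIocMod_eq_self Real.two_pi_pos).2]
  obtain ⟨h3, h4⟩ := hy
  constructor <;> nlinarith

end NegativeEnds

section UnivalentInverse

variable {ρ σ : ℝ} {g : ℂ → ℂ}

theorem log_im_bounds {z : ℂ} (hz : 0 < z.im) :
    0 < (Complex.log z).im ∧ (Complex.log z).im < Real.pi := by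
  rw [Complex.log_im]
  refine ⟨(Complex.arg_nonneg_iff.2 hz.le).lt_of_ne fun h => ?_,
    Complex.arg_lt_pi_iff.2 (Or.inr hz.ne')⟩
  exact hz.ne' (Complex.arg_eq_zero_iff.1 h.symm).2

theorem IsLogTransform.log_mem (h : IsLogTransform ρ σ g) {z : ℂ} (hz : 0 < z.im) :
    Complex.log z ∈ slitStrip σ ∧ g (Complex.log z) = powTransform ρ σ z := by
  obtain ⟨h1, h2⟩ := log_im_bounds hz
  have hz0 : z ≠ 0 := fun h0 => by simp [h0] at hz
  refine ⟨⟨abs_lt.2 ⟨by linarith, h2⟩, Or.inl h1.ne'⟩, ?_⟩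
  rw [h.upper _ h1 h2, Complex.exp_log hz0]

theorem IsLogTransform.isUI {b : ℝ} (hb : 0 < b) (h : IsLogTransform ρ σ g)
    (hg : DifferentiableOn ℂ g (slitStrip σ)) (hp : ProperOverLower (slitStrip σ) g)
    (hw : ∃ w₀ : ℂ, w₀.im < 0 ∧
      (∀ z ∈ slitStrip σ, ∀ z' ∈ slitStrip σ, g z = w₀ → g z' = w₀ → z = z') ∧
      ∀ z ∈ slitStrip σ, g z = w₀ → deriv g z ≠ 0) :
    IsUI (Measure.map (fun x : ℝ => x ^ (ρ * σ)) (sbMeasure b)) := by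
  obtain ⟨δ, hδ, hex⟩ := exists_powTransform_eq (ρ := ρ) (σ := σ)
  have hex' : ∃ u ∈ slitStrip σ, (g u).im < 0 := by
    have him : (-Complex.I * (δ / 2 : ℝ)).im = -(δ / 2) := by
      rw [neg_mul, Complex.neg_im, Complex.I_mul_im, Complex.ofReal_re]
    have hre : (-Complex.I * (δ / 2 : ℝ)).re = 0 := by
      rw [neg_mul, Complex.neg_re, Complex.I_mul_re, Complex.ofReal_im, neg_zero, neg_zero]
    obtain ⟨z, hz, hzw⟩ := hex (-Complex.I * (δ / 2 : ℝ))
      (by rw [him, hre, abs_zero]; linarith) (by rw [him]; linarith)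
    refine ⟨Complex.log z, (h.log_mem hz).1, ?_⟩
    rw [(h.log_mem hz).2, hzw, him]
    linarith
  obtain ⟨V, hV, hVg⟩ := hp.exists_inverse hg (isOpen_slitStrip σ) hex' hw
  refine isUI_of_powTransform (F := fun w => Complex.exp (V w)) hb hV.cexp ?_ ⟨δ, hδ, ?_⟩
  · intro w hw w' hw' heq
    obtain ⟨h1, h2, -⟩ := hVg w hw
    obtain ⟨h3, h4, -⟩ := hVg w' hw'
    have h5 : V w = V w' := eq_of_exp_eq_of_abs_im_sub_lt heq
      ((abs_sub _ _).trans_lt (by linarith [h1.1, h3.1]))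
    rw [← h2, ← h4, h5]
  · intro w h1 h2
    obtain ⟨z, hz, hzw⟩ := hex w h1 h2
    have hz0 : z ≠ 0 := fun h0 => by simp [h0] at hz
    have h3 := (hVg w (by linarith [abs_nonneg w.re])).2.2 (Complex.log z) (h.log_mem hz).1
      ((h.log_mem hz).2.trans hzw)
    have h4 : Complex.exp (V w) = z := by rw [← h3, Complex.exp_log hz0]
    simp only [h4]
    exact ⟨hz, hzw⟩

theorem isUI_map_rpow {b : ℝ} (hb : 0 < b) (hρ : 1 ≤ ρ) :
    IsUI (Measure.map (fun x : ℝ => x ^ (ρ * 1)) (sbMeasure b)) := by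
  have hρ0 : 0 < ρ := by linarith
  have hβ : 0 < 1 + 1 / ρ := by positivity
  have hc : -((4 / ρ : ℝ) : ℂ) ≠ 0 :=
    neg_ne_zero.2 (Complex.ofReal_ne_zero.2 (by positivity))
  have hg := differentiableOn_logTransformPos hρ
  have hE := escapesLeft_pos hρ
  have hlim := tendsto_leftEnd_pos hρ
  refine (isLogTransform_pos hρ).isUI hb hg (hE.properOverLower hβ hc hlim)
    (hE.exists_simple_value hβ hc hlim hg (isOpen_slitStrip 1) (fun u _ h1 h2 => ?_)
      (y₀ := -Real.pi / (2 * (1 + 1 / ρ))) ?_ fun y hy h => unique_angle_pos hρ hy h)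
  · exact ⟨abs_lt.2 ⟨h1, by linarith [Real.pi_pos]⟩, Or.inl h2.ne⟩
  · have h1 : 0 < 1 / ρ := by positivity
    have hpi := Real.pi_pos
    constructor
    · rw [lt_div_iff₀ (by linarith)]
      nlinarith
    · exact div_neg_of_neg_of_pos (by linarith) (by linarith)

theorem isUI_map_rpow_neg {b : ℝ} (hb : 0 < b) (hρ : 1 ≤ ρ) :
    IsUI (Measure.map (fun x : ℝ => x ^ (ρ * -1)) (sbMeasure b)) := by
  have hβ : 0 < 1 - 1 / (2 * ρ) := by linarith [half_le_exponent hρ]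
  have hc := leftCoeff_ne_zero hρ
  have hg := differentiableOn_logTransformNeg hρ
  have hE := escapesLeft_neg hρ
  have hlim := tendsto_leftEnd_neg hρ
  refine (isLogTransform_neg hρ).isUI hb hg (hE.properOverLower hβ hc hlim)
    (hE.exists_simple_value hβ hc hlim hg (isOpen_slitStrip (-1)) (fun u h0 h1 h2 => ?_)
      (leftAngle_mem hρ) fun y hy h => unique_angle_neg hρ hy h)
  exact ⟨abs_lt.2 ⟨h1, h2⟩, Or.inr (by linarith)⟩

end UnivalentInverse

/-- If `S_b` follows `(4/b)·(√(bx-1)/(2πx²))·1_{(1/b,∞)}(x)dx`, then `S_b^r ∈ UI`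
for every `r` with `|r| ≥ 1`. -/
theorem sb_power_UI (b : ℝ) (hb : 0 < b) (r : ℝ) (hr : 1 ≤ |r|) :
    IsUI (Measure.map (fun x : ℝ => x ^ r) (sbMeasure b)) := by
  rcases abs_cases r with ⟨h, -⟩ | ⟨h, -⟩
  · have := isUI_map_rpow hb hr
    rwa [h, mul_one] at this
  · have := isUI_map_rpow_neg hb hr
    rwa [h, mul_neg_one, neg_neg] at this
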